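/- Let n ≥ 3, α > 0, and u(t) = e / exp(t^{−α}). Then the cusp domain 𝔹_u and the unit ball 𝔹 are bi-conformally equivalent (i.e., there exists a homeomorphism h : 𝔹 → 𝔹_u with h ∈ W^{1,n}(𝔹, ℝⁿ) and h⁻¹ ∈ W^{1,n}(𝔹_u, ℝⁿ)) if and only if α < n. -/

import Mathlib

open MeasureTheory Metric Set
open scoped ENNReal NNReal

noncomputable section

abbrev Euc (n : ℕ) : Type := EuclideanSpace ℝ (Fin n)

/-- Operator norm of an `n × n` real matrix, viewed as a linear operator on Euclidean space. -/
noncomputable def opNorm {n : ℕ} (M : Matrix (Fin n) (Fin n) ℝ) : ℝ :=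
  ‖LinearMap.toContinuousLinearMap (Matrix.toEuclideanLin M)‖

/-- `g` belongs to the Sobolev class `W^{1,p}(Ω, ℝⁿ)` with weak differential `Dg`:
`g` and `Dg` are locally integrable on `Ω`, the integration-by-parts identity holds against
every smooth compactly supported test function supported in `Ω`, and `|Dg| ∈ L^p(Ω)`. -/
structure MemSobolev {n : ℕ} (p : ℝ) (Ω : Set (Euc n))
    (g : Euc n → Euc n) (Dg : Euc n → Matrix (Fin n) (Fin n) ℝ) : Prop where
  locInt : ∀ i : Fin n, LocallyIntegrableOn (fun x => g x i) Ω volume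
  locIntD : ∀ i j : Fin n, LocallyIntegrableOn (fun x => Dg x i j) Ω volume
  parts : ∀ φ : Euc n → ℝ, ContDiff ℝ ((⊤ : ℕ∞) : WithTop ℕ∞) φ → HasCompactSupport φ →
    tsupport φ ⊆ Ω → ∀ i j : Fin n,
      ∫ x in Ω, g x i * fderiv ℝ φ x (EuclideanSpace.single j 1) =
        - ∫ x in Ω, Dg x i j * φ x
  lp : IntegrableOn (fun x => opNorm (Dg x) ^ p) Ω volume

/-- `g` belongs to the local Sobolev class `W^{1,1}_loc(Ω, ℝⁿ)` with weak differential `Dg`. -/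
structure MemSobolevLoc {n : ℕ} (Ω : Set (Euc n))
    (g : Euc n → Euc n) (Dg : Euc n → Matrix (Fin n) (Fin n) ℝ) : Prop where
  locInt : ∀ i : Fin n, LocallyIntegrableOn (fun x => g x i) Ω volume
  locIntD : ∀ i j : Fin n, LocallyIntegrableOn (fun x => Dg x i j) Ω volume
  parts : ∀ φ : Euc n → ℝ, ContDiff ℝ ((⊤ : ℕ∞) : WithTop ℕ∞) φ → HasCompactSupport φ →
    tsupport φ ⊆ Ω → ∀ i j : Fin n,
      ∫ x in Ω, g x i * fderiv ℝ φ x (EuclideanSpace.single j 1) =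
        - ∫ x in Ω, Dg x i j * φ x

/-- `h : 𝕏 → 𝕐` is a homeomorphism of `𝕏` onto `𝕐` with inverse `f`. -/
structure IsHomeoOn {n : ℕ} (h f : Euc n → Euc n) (𝕏 𝕐 : Set (Euc n)) : Prop where
  mapsTo : Set.MapsTo h 𝕏 𝕐
  mapsTo_inv : Set.MapsTo f 𝕐 𝕏
  left_inv : ∀ x ∈ 𝕏, f (h x) = x
  right_inv : ∀ y ∈ 𝕐, h (f y) = y
  continuousOn : ContinuousOn h 𝕏
  continuousOn_inv : ContinuousOn f 𝕐

/-- The inner distortion function `K_I(·, h)` of a Sobolev map with weak differential `Dh`;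
`D♯h` is the cofactor (adjugate) matrix, given by Cramer's rule `(D♯h)(Dh) = (det Dh)·Id`. -/
noncomputable def innerDistortion {n : ℕ} (Dh : Euc n → Matrix (Fin n) (Fin n) ℝ)
    (x : Euc n) : ℝ≥0∞ :=
  if 0 < (Dh x).det then
    ENNReal.ofReal (opNorm ((Dh x).adjugate) ^ n / (Dh x).det ^ (n - 1))
  else if (Dh x).adjugate = 0 then 1 else ⊤

/-- The open unit ball `𝔹 ⊂ ℝⁿ`. -/
def unitBall (n : ℕ) : Set (Euc n) := Metric.ball 0 1

/-- The slit `I = {(t,0) : 0 ≤ t < 1}`, the first coordinate playing the role of `t`. -/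
def slit (n : ℕ) [NeZero n] : Set (Euc n) :=
  {p | 0 ≤ p 0 ∧ p 0 < 1 ∧ ∀ i : Fin n, i ≠ 0 → p i = 0}

/-- The model inward-cusp ball `𝔹_u = 𝔹 \ {(t,x) : t ≥ 0, |x| ≤ u(t)}`. -/
noncomputable def cuspBall (n : ℕ) [NeZero n] (u : ℝ → ℝ) : Set (Euc n) :=
  Metric.ball 0 1 \
    {p | 0 ≤ p 0 ∧ Real.sqrt (∑ i ∈ Finset.univ.erase (0 : Fin n), p i ^ 2) ≤ u (p 0)}

/-- `u` is a model cusp profile: a strictly increasing continuous surjection of `[0,∞)` onto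
itself, `C¹` on `(0,∞)`, with `u′` increasing on `(0,∞)`, `u′(s) → 0` as `s → 0⁺`, `u(1) = 1`. -/
structure IsModelCusp (u : ℝ → ℝ) : Prop where
  continuousOn : ContinuousOn u (Set.Ici 0)
  contDiffOn : ContDiffOn ℝ 1 u (Set.Ioi 0)
  strictMonoOn : StrictMonoOn u (Set.Ici 0)
  mapsTo : Set.MapsTo u (Set.Ici 0) (Set.Ici 0)
  surjOn : Set.SurjOn u (Set.Ici 0) (Set.Ici 0)
  deriv_mono : MonotoneOn (deriv u) (Set.Ioi 0)
  deriv_tendsto : Filter.Tendsto (deriv u) (nhdsWithin 0 (Set.Ioi 0)) (nhds 0)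
  one : u 1 = 1

/-- The cusp profile `u(t) = e / exp(t^{-α})` for `t > 0`, and `u(0) = 0`. -/
noncomputable def cuspFun (α : ℝ) (t : ℝ) : ℝ :=
  if 0 < t then Real.exp 1 / Real.exp (t ^ (-α)) else 0

/-- The sphere `S_t = {y ∈ 𝔹_u : |y| = t}` inside the cusp ball. -/
def cuspS (n : ℕ) [NeZero n] (u : ℝ → ℝ) (t : ℝ) : Set (Euc n) :=
  {y ∈ cuspBall n u | ‖y‖ = t}

/-- The boundary circle `C_t = {y ∈ ∂𝔹_u : |y| = t}`. -/
def cuspC (n : ℕ) [NeZero n] (u : ℝ → ℝ) (t : ℝ) : Set (Euc n) :=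
  {y ∈ frontier (cuspBall n u) | ‖y‖ = t}

/-- `S′_t = h⁻¹(S_t) ⊆ 𝔹`. -/
def cuspS' (n : ℕ) [NeZero n] (u : ℝ → ℝ) (h : Euc n → Euc n) (t : ℝ) : Set (Euc n) :=
  {x ∈ unitBall n | h x ∈ cuspS n u t}

/-- `C′_t = cl(S′_t) ∩ ∂𝔹`. -/
def cuspC' (n : ℕ) [NeZero n] (u : ℝ → ℝ) (h : Euc n → Euc n) (t : ℝ) : Set (Euc n) :=
  closure (cuspS' n u h t) ∩ Metric.sphere (0 : Euc n) 1

section Helpers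
open scoped Topology Convolution
open Filter


lemma single_coord_norm {n : ℕ} (x : Euc n) (i : Fin n) : |x i| ≤ ‖x‖ := by
  have := PiLp.norm_apply_le x i
  simpa using this

lemma opNorm_entry {n : ℕ} (M : Matrix (Fin n) (Fin n) ℝ) (i j : Fin n) : |M i j| ≤ opNorm M := by
  have h := (LinearMap.toContinuousLinearMap (Matrix.toEuclideanLin M)).le_opNorm
    (EuclideanSpace.single j (1:ℝ))
  rw [PiLp.norm_single, norm_one, mul_one] at h
  refine le_trans ?_ h
  have h2 := single_coord_norm ((LinearMap.toContinuousLinearMap (Matrix.toEuclideanLin M))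
    (EuclideanSpace.single j (1:ℝ))) i
  refine le_trans (le_of_eq ?_) h2
  simp [Matrix.toLpLin_apply]

lemma opNorm_nonneg {n : ℕ} (M : Matrix (Fin n) (Fin n) ℝ) : 0 ≤ opNorm M := norm_nonneg _

lemma opNorm_of_clm {n : ℕ} (L : Euc n →L[ℝ] Euc n) :
    opNorm (Matrix.of (fun i j => L (EuclideanSpace.single j 1) i)) = ‖L‖ := by
  unfold opNorm
  congr 1
  ext x i
  have hx : x = ∑ j, x j • EuclideanSpace.single j (1:ℝ) := by
    ext k
    simp [Pi.single_apply]
  conv_rhs => rw [hx]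
  simp [Matrix.toLpLin_apply, Matrix.mulVec, dotProduct, mul_comm]

lemma sobolev_of_locLip {n : ℕ} (Ω : Set (Euc n)) (hΩ : IsOpen Ω) (g : Euc n → Euc n)
    (V : Euc n → ℝ) (hV : IntegrableOn (fun x => V x ^ (n:ℝ)) Ω volume)
    (hV0 : ∀ x ∈ Ω, 0 ≤ V x)
    (hg : ∀ x ∈ Ω, ∃ U ∈ 𝓝 x, LipschitzOnWith (V x).toNNReal g U) :
    ∃ Dg, MemSobolev (n:ℝ) Ω g Dg := by
  have hll : LocallyLipschitzOn Ω g := by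
    intro x hx
    obtain ⟨U, hU, hl⟩ := hg x hx
    exact ⟨_, U, mem_nhdsWithin_of_mem_nhds hU, hl⟩
  have hcont : ContinuousOn g Ω := hll.continuousOn
  have hmeas : ∀ j : Fin n, Measurable (fun x => fderiv ℝ g x (EuclideanSpace.single j 1)) :=
    fun j => measurable_fderiv_apply_const ℝ g _
  have hbd : ∀ x ∈ Ω, ‖fderiv ℝ g x‖ ≤ V x := by
    intro x hx
    obtain ⟨U, hU, hl⟩ := hg x hx
    have := norm_fderiv_le_of_lipschitzOn ℝ hU hl
    rwa [Real.coe_toNNReal _ (hV0 x hx)] at this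
  have hcoord : ∀ i : Fin n, Measurable (fun x : Euc n => x i) := fun i => by fun_prop
  refine ⟨fun x => Matrix.of (fun i j => fderiv ℝ g x (EuclideanSpace.single j 1) i), ?_, ?_, ?_, ?_⟩
  · intro i
    refine ContinuousOn.locallyIntegrableOn ?_ hΩ.measurableSet
    have : Continuous (fun x : Euc n => x i) := by fun_prop
    exact this.comp_continuousOn hcont
  · intro i j x hx
    obtain ⟨K, U, hU, hl⟩ := hll hx
    rw [hΩ.nhdsWithin_eq hx] at hU
    obtain ⟨r, hr, hrU⟩ := Metric.mem_nhds_iff.1 hU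
    refine ⟨ball x r, mem_nhdsWithin_of_mem_nhds (ball_mem_nhds x hr), ?_⟩
    refine Measure.integrableOn_of_bounded (M := K) (measure_ball_lt_top).ne
      ((hcoord i).comp (hmeas j)).aestronglyMeasurable ?_
    refine (ae_restrict_iff' measurableSet_ball).2 (Eventually.of_forall fun y hy => ?_)
    have h1 := norm_fderiv_le_of_lipschitzOn ℝ (isOpen_ball.mem_nhds hy) (hl.mono hrU)
    have h2 := opNorm_entry (Matrix.of (fun i j => fderiv ℝ g y (EuclideanSpace.single j 1) i)) i j
    rw [opNorm_of_clm] at h2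
    rw [Real.norm_eq_abs]
    exact h2.trans h1
  · intro φ hφ hφc hφs i j
    obtain ⟨K, hK, hKi, hKΩ⟩ := exists_compact_between hφc hΩ hφs
    obtain ⟨C, hC⟩ := (hll.mono hKΩ).exists_lipschitzOnWith_of_compact hK
    have hCi : LipschitzOnWith C (fun x => g x i) K := by
      refine LipschitzOnWith.of_dist_le_mul fun x hx y hy => ?_
      refine le_trans ?_ (hC.dist_le_mul x hx y hy)
      rw [Real.dist_eq, dist_eq_norm]
      exact single_coord_norm (g x - g y) i
    obtain ⟨G, hG, hGe⟩ := hCi.extend_real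
    obtain ⟨D, hD⟩ := hφ.lipschitzWith_of_hasCompactSupport hφc (by simp)
    have key := hG.integral_lineDeriv_mul_eq (μ := volume) hD hφc (EuclideanSpace.single j 1)
    have hz : ∀ x, x ∉ tsupport φ → φ x = 0 := fun x hx => image_eq_zero_of_notMem_tsupport hx
    have hz' : ∀ x, x ∉ tsupport φ → fderiv ℝ φ x = 0 := fun x hx =>
      image_eq_zero_of_notMem_tsupport (fun h => hx (tsupport_fderiv_subset ℝ h))
    have e1 : ∫ x in Ω, g x i * fderiv ℝ φ x (EuclideanSpace.single j 1)
        = - ∫ x, lineDeriv ℝ φ x (-(EuclideanSpace.single j 1)) * G x := by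
      rw [← integral_neg, setIntegral_eq_integral_of_forall_compl_eq_zero]
      · refine integral_congr_ae (Eventually.of_forall fun x => ?_)
        have hd : DifferentiableAt ℝ φ x := hφ.differentiable (by simp) x
        simp only
        rw [hd.lineDeriv_eq_fderiv, map_neg]
        by_cases hx : x ∈ tsupport φ
        · rw [← hGe (interior_subset (hKi hx))]; ring
        · simp [hz' x hx]
      · intro x hx
        rw [hz' x (fun h => hx (hφs h))]; simp
    have e2 : ∫ x in Ω, (Matrix.of (fun i j => fderiv ℝ g x (EuclideanSpace.single j 1) i)) i j * φ x
        = ∫ x, lineDeriv ℝ G x (EuclideanSpace.single j 1) * φ x := by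
      rw [setIntegral_eq_integral_of_forall_compl_eq_zero]
      · refine integral_congr_ae ?_
        filter_upwards [hC.ae_differentiableWithinAt_of_mem (μ := volume)] with x hx
        by_cases hxs : x ∈ tsupport φ
        · have hxi := hKi hxs
          have hd : DifferentiableAt ℝ g x :=
            (hx (interior_subset hxi)).differentiableAt (mem_interior_iff_mem_nhds.1 hxi)
          have hd2 : HasFDerivAt G ((EuclideanSpace.proj i : Euc n →L[ℝ] ℝ) ∘L fderiv ℝ g x) x := by
            have h3 : HasFDerivAt (fun y => g y i)
              ((EuclideanSpace.proj i : Euc n →L[ℝ] ℝ) ∘L fderiv ℝ g x) x :=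
              (EuclideanSpace.proj i : Euc n →L[ℝ] ℝ).hasFDerivAt.comp x hd.hasFDerivAt
            refine h3.congr_of_eventuallyEq ?_
            filter_upwards [mem_interior_iff_mem_nhds.1 hxi] with y hy using (hGe hy).symm
          rw [hd2.differentiableAt.lineDeriv_eq_fderiv, hd2.fderiv]
          simp
        · simp [hz x hxs]
      · intro x hx
        rw [hz x (fun h => hx (hφs h))]; simp
    rw [e1, e2, key]
  · refine Integrable.mono' hV ?_ ?_
    · simp_rw [opNorm_of_clm]
      exact ((measurable_fderiv ℝ g).norm.pow_const _).aestronglyMeasurable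
    · refine (ae_restrict_iff' hΩ.measurableSet).2 (Eventually.of_forall fun y hy => ?_)
      simp_rw [opNorm_of_clm]
      rw [Real.norm_of_nonneg (by positivity)]
      exact Real.rpow_le_rpow (norm_nonneg _) (hbd y hy) (by positivity)


/-- inverse of the cusp profile -/
def tauF (α r : ℝ) : ℝ := if 0 < r then (1 - Real.log r) ^ (-(1/α)) else 0

lemma cuspFun_pos_eq {α t : ℝ} (ht : 0 < t) : cuspFun α t = Real.exp (1 - t ^ (-α)) := by
  rw [cuspFun, if_pos ht, Real.exp_sub]

lemma cuspFun_zero (α : ℝ) : cuspFun α 0 = 0 := by simp [cuspFun]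

lemma cuspFun_pos {α t : ℝ} (ht : 0 < t) : 0 < cuspFun α t := by
  rw [cuspFun_pos_eq ht]; exact Real.exp_pos _

lemma cuspFun_nonneg (α t : ℝ) : 0 ≤ cuspFun α t := by
  unfold cuspFun; split_ifs
  · positivity
  · exact le_rfl

lemma tauF_pos_eq {α r : ℝ} (hr : 0 < r) : tauF α r = (1 - Real.log r) ^ (-(1/α)) := by
  rw [tauF, if_pos hr]

lemma one_sub_log_pos {r : ℝ} (hr : 0 < r) (h1 : r ≤ 1) : 1 ≤ 1 - Real.log r := by
  have := Real.log_nonpos hr.le h1; linarith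

lemma tauF_pos {α r : ℝ} (hr : 0 < r) (h1 : r ≤ 1) : 0 < tauF α r := by
  rw [tauF_pos_eq hr]
  have := one_sub_log_pos hr h1
  positivity

lemma cuspFun_tauF {α r : ℝ} (hα : 0 < α) (hr : 0 < r) (h1 : r ≤ 1) : cuspFun α (tauF α r) = r := by
  rw [cuspFun_pos_eq (tauF_pos hr h1), tauF_pos_eq hr]
  have := one_sub_log_pos hr h1
  rw [← Real.rpow_mul (by linarith)]
  have h2 : -(1/α) * -α = 1 := by field_simp
  rw [h2, Real.rpow_one, sub_sub_cancel, Real.exp_log hr]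

lemma tauF_cuspFun {α t : ℝ} (hα : 0 < α) (ht : 0 < t) : tauF α (cuspFun α t) = t := by
  rw [tauF_pos_eq (cuspFun_pos ht), cuspFun_pos_eq ht, Real.log_exp, sub_sub_cancel,
    ← Real.rpow_mul ht.le]
  have h2 : -α * -(1/α) = 1 := by field_simp
  rw [h2, Real.rpow_one]

lemma cuspFun_lt {α s t : ℝ} (hα : 0 < α) (hs : 0 ≤ s) (hst : s < t) :
    cuspFun α s < cuspFun α t := by
  have ht : 0 < t := by linarith
  rcases hs.eq_or_lt with rfl | hs
  · rw [cuspFun_zero]; exact cuspFun_pos ht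
  · rw [cuspFun_pos_eq hs, cuspFun_pos_eq ht, Real.exp_lt_exp]
    have := Real.rpow_lt_rpow_of_neg hs hst (neg_lt_zero.2 hα)
    linarith

lemma cuspFun_one (α : ℝ) : cuspFun α 1 = 1 := by
  rw [cuspFun_pos_eq one_pos]; simp

lemma tauF_lt {α r r' : ℝ} (hα : 0 < α) (hr : 0 < r) (hrr : r < r') (h1 : r' ≤ 1) :
    tauF α r < tauF α r' := by
  by_contra! h
  rcases h.eq_or_lt with h | h
  · have e1 := cuspFun_tauF hα hr (by linarith)
    have e2 := cuspFun_tauF hα (hr.trans hrr) h1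
    rw [h] at e2; linarith
  · have := cuspFun_lt hα (tauF_pos (α := α) (hr.trans hrr) h1).le h
    rw [cuspFun_tauF hα hr (by linarith), cuspFun_tauF hα (hr.trans hrr) h1] at this
    linarith

/-- `r ↦ τ(r)/r` is antitone near zero. -/
lemma tauF_div_antitone {α r r' : ℝ} (hα : 0 < α) (hr : 0 < r) (hrr : r ≤ r') (h1 : r' ≤ 1)
    (hL : 1/α ≤ 1 - Real.log r') : tauF α r' / r' ≤ tauF α r / r := by
  have hr' : 0 < r' := by linarith
  have hp := tauF_pos (α := α) hr (by linarith)
  have hp' := tauF_pos (α := α) hr' h1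
  have hL1 := one_sub_log_pos hr' h1
  have hL0 := one_sub_log_pos hr (hrr.trans h1)
  rw [← Real.log_le_log_iff (by positivity) (by positivity), Real.log_div hp.ne' hr.ne',
    Real.log_div hp'.ne' hr'.ne', tauF_pos_eq hr, tauF_pos_eq hr', Real.log_rpow (by linarith),
    Real.log_rpow (by linarith)]
  set L := 1 - Real.log r with hLd
  set L' := 1 - Real.log r' with hLd'
  have hLL : L' ≤ L := by
    have := Real.log_le_log hr hrr; linarith
  have h3 : Real.log (L/L') ≤ L/L' - 1 := Real.log_le_sub_one_of_pos (by positivity)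
  rw [Real.log_div (by positivity) (by positivity)] at h3
  have h4 : L/L' - 1 ≤ α * (L - L') := by
    rw [div_sub_one (by positivity), div_le_iff₀ (by positivity)]
    have : 1 ≤ α * L' := by
      rw [div_le_iff₀ hα] at hL; linarith
    nlinarith
  have h5 : 1/α * (Real.log L - Real.log L') ≤ L - L' := by
    rw [one_div, inv_mul_le_iff₀ hα]; linarith
  have h6 : Real.log r = 1 - L := by rw [hLd]; ring
  have h7 : Real.log r' = 1 - L' := by rw [hLd']; ring
  rw [h6, h7]; linarith

lemma rpow_mul_exp_le {p y : ℝ} (hp : 0 < p) (hy : 0 ≤ y) : y ^ p * Real.exp (-y) ≤ p ^ p := by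
  have h1 : y / p ≤ Real.exp (y/p) := by linarith [Real.add_one_le_exp (y/p)]
  have h2 : (y/p)^p ≤ (Real.exp (y/p))^p := Real.rpow_le_rpow (by positivity) h1 hp.le
  rw [← Real.exp_mul, div_mul_cancel₀ _ hp.ne', Real.div_rpow hy hp.le,
    div_le_iff₀ (by positivity)] at h2
  rw [Real.exp_neg, ← div_eq_mul_inv, div_le_iff₀ (Real.exp_pos _)]
  linarith

lemma cuspFun_hasDerivAt {α t : ℝ} (ht : 0 < t) :
    HasDerivAt (cuspFun α) (Real.exp (1 - t ^ (-α)) * (α * t ^ (-α - 1))) t := by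
  have h1 : HasDerivAt (fun t : ℝ => Real.exp (1 - t ^ (-α)))
      (Real.exp (1 - t ^ (-α)) * (-(-α * t ^ (-α - 1)))) t :=
    ((Real.hasDerivAt_rpow_const (Or.inl ht.ne')).const_sub 1).exp
  have h2 : (fun t : ℝ => Real.exp (1 - t ^ (-α))) =ᶠ[𝓝 t] cuspFun α := by
    filter_upwards [lt_mem_nhds ht] with s hs using (cuspFun_pos_eq hs).symm
  have h3 := h1.congr_of_eventuallyEq h2.symm
  simpa using h3

lemma cuspFun_deriv_bound {α t : ℝ} (hα : 0 < α) (ht : 0 < t) :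
    Real.exp (1 - t ^ (-α)) * (α * t ^ (-α - 1)) ≤
      α * Real.exp 1 * (1 + 1/α) ^ (1 + 1/α) := by
  have hy : (0:ℝ) ≤ t ^ (-α) := by positivity
  have h1 := rpow_mul_exp_le (p := 1 + 1/α) (by positivity) hy
  have h2 : (t ^ (-α)) ^ (1 + 1/α) = t ^ (-α - 1) := by
    rw [← Real.rpow_mul ht.le]; congr 1; field_simp; ring
  rw [h2] at h1
  calc Real.exp (1 - t ^ (-α)) * (α * t ^ (-α - 1)) 
      = α * Real.exp 1 * (t ^ (-α - 1) * Real.exp (-(t ^ (-α)))) := by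
        rw [sub_eq_add_neg, Real.exp_add]; ring
    _ ≤ _ := by gcongr

lemma cuspFun_lip {α s t : ℝ} (hα : 0 < α) (hs : 0 ≤ s) (hst : s ≤ t) :
    cuspFun α t - cuspFun α s ≤ (α * Real.exp 1 * (1 + 1/α) ^ (1 + 1/α)) * (t - s) := by
  set C := α * Real.exp 1 * (1 + 1/α) ^ (1 + 1/α) with hC
  have hpos : ∀ s t : ℝ, 0 < s → s ≤ t → cuspFun α t - cuspFun α s ≤ C * (t - s) := by
    intro s t hs hst
    refine (convex_Ici s).image_sub_le_mul_sub_of_deriv_le (f := cuspFun α) ?_ ?_ ?_ s (by simp) t hst hst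
    · intro x hx
      exact (cuspFun_hasDerivAt (hs.trans_le hx)).continuousAt.continuousWithinAt
    · intro x hx
      rw [interior_Ici] at hx
      exact (cuspFun_hasDerivAt (hs.trans hx)).differentiableAt.differentiableWithinAt
    · intro x hx
      rw [interior_Ici] at hx
      rw [(cuspFun_hasDerivAt (hs.trans hx)).deriv]
      exact cuspFun_deriv_bound hα (hs.trans hx)
  have hC0 : 0 ≤ C := by positivity
  rcases hs.eq_or_lt with rfl | hs
  · rcases hst.eq_or_lt with rfl | hst
    · simp
    · rw [cuspFun_zero]
      -- `u(t) ≤ u(s) + C (t - s)` with `s → 0`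
      have h1 : ∀ ε ∈ Ioo 0 t, cuspFun α t - C * t ≤ Real.exp (1 - ε ^ (-α)) := by
        intro ε hε
        have := hpos ε t hε.1 hε.2.le
        rw [← cuspFun_pos_eq hε.1]
        nlinarith [mul_nonneg hC0 hε.1.le]
      have h2 : Tendsto (fun ε : ℝ => Real.exp (1 - ε ^ (-α))) (𝓝[>] 0) (𝓝 0) := by
        refine Real.tendsto_exp_atBot.comp ?_
        have h3 : Tendsto (fun ε : ℝ => ε ^ (-α)) (𝓝[>] 0) atTop :=
          tendsto_rpow_neg_nhdsGT_zero (neg_lt_zero.2 hα)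
        simpa [sub_eq_add_neg] using tendsto_atBot_add_const_left _ (1:ℝ) (tendsto_neg_atTop_atBot.comp h3)
      have h4 := ge_of_tendsto h2 (by
        filter_upwards [Ioo_mem_nhdsGT hst] with ε hε using h1 ε hε)
      linarith
  · exact hpos s t hs hst


/-- Scalar data used to build the equivalence: a slowly growing stretch `Q` and the inverse `v`
of `r ↦ c r Q(r)`. -/
structure Stretch (c : ℝ) (Q v : ℝ → ℝ) : Prop where
  hc : 0 < c
  one_le : ∀ r, 0 < r → 1 ≤ Q r
  anti : ∀ r r', 0 < r → r ≤ r' → Q r' ≤ Q r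
  mono : ∀ r r', 0 < r → r < r' → r * Q r < r' * Q r'
  v0 : v 0 = 0
  vmono : ∀ s t, 0 ≤ s → s ≤ t → v s ≤ v t
  vinv : ∀ r, 0 < r → v (c * r * Q r) = r
  vpos : ∀ t, 0 < t → 0 < v t
  vinv' : ∀ t, 0 < t → c * v t * Q (v t) = t

def HB (c : ℝ) (Q : ℝ → ℝ) (s ρ : ℝ) : ℝ := s * Q (max ρ (|s| / c))
def FB (Q v : ℝ → ℝ) (t ρ : ℝ) : ℝ := t / Q (max ρ (v |t|))

namespace Stretch
variable {c : ℝ} {Q v : ℝ → ℝ}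

lemma mono' (S : Stretch c Q v) {r r' : ℝ} (hr : 0 < r) (h : r ≤ r') : r * Q r ≤ r' * Q r' := by
  rcases h.eq_or_lt with rfl | h
  · exact le_rfl
  · exact (S.mono r r' hr h).le

lemma Qdiff (S : Stretch c Q v) {r r' : ℝ} (hr : 0 < r) (h : r ≤ r') :
    r' * (Q r - Q r') ≤ Q r * (r' - r) := by
  have := S.mono' hr h
  nlinarith

lemma vnonneg (S : Stretch c Q v) {t : ℝ} (ht : 0 ≤ t) : 0 ≤ v t := by
  have := S.vmono 0 t le_rfl ht; rwa [S.v0] at this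

lemma HB_lip_aux (S : Stretch c Q v) {s ρ s' ρ' : ℝ}
    (h0 : 0 < max ρ (|s|/c)) (hle : max ρ (|s|/c) ≤ max ρ' (|s'|/c)) :
    |HB c Q s ρ - HB c Q s' ρ'| ≤ Q (max ρ (|s|/c)) * (2 * |s - s'| + c * |ρ - ρ'|) := by
  have hc := S.hc
  unfold HB
  set N := max ρ (|s|/c) with hN
  set N' := max ρ' (|s'|/c) with hN'
  have h0' : 0 < N' := h0.trans_le hle
  have hq := S.one_le N h0
  have hd := S.Qdiff h0 hle
  have ha := S.anti N N' h0 hle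
  have hs' : |s'| ≤ c * N' := by
    have : |s'|/c ≤ N' := le_max_right _ _
    rw [div_le_iff₀ hc] at this; linarith
  have hNN : N' - N ≤ |ρ - ρ'| + |s - s'| / c := by
    have e1 : N' ≤ N + (|ρ - ρ'| + |s - s'|/c) := by
      apply max_le
      · have := le_max_left ρ (|s|/c)
        have h2 := neg_abs_le (ρ - ρ')
        have h3 : 0 ≤ |s - s'|/c := by positivity
        linarith
      · have := le_max_right ρ (|s|/c)
        have h2 : |s'| ≤ |s| + |s - s'| := by
          have := abs_sub_abs_le_abs_sub s' s
          rw [abs_sub_comm] at this; linarith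
        have h3 : |s'|/c ≤ |s|/c + |s - s'|/c := by rw [← add_div]; gcongr
        have h4 := abs_nonneg (ρ - ρ')
        linarith
    linarith
  have e : s * Q N - s' * Q N' = (s - s') * Q N + s' * (Q N - Q N') := by ring
  rw [e]
  have h1 : |s' * (Q N - Q N')| ≤ c * (Q N * (N' - N)) := by
    rw [abs_mul, abs_of_nonneg (sub_nonneg.2 ha)]
    calc |s'| * (Q N - Q N') ≤ c * N' * (Q N - Q N') := by gcongr
      _ = c * (N' * (Q N - Q N')) := by ring
      _ ≤ _ := by gcongr
  have h2 : c * (N' - N) ≤ c * |ρ - ρ'| + |s - s'| := by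
    calc c * (N' - N) ≤ c * (|ρ - ρ'| + |s - s'| / c) := by gcongr
      _ = _ := by field_simp
  calc |(s - s') * Q N + s' * (Q N - Q N')| ≤ |(s - s') * Q N| + |s' * (Q N - Q N')| := abs_add_le _ _
    _ ≤ |s - s'| * Q N + c * (Q N * (N' - N)) := by
        rw [abs_mul, abs_of_nonneg (by linarith : 0 ≤ Q N)]; linarith
    _ = Q N * (|s - s'| + c * (N' - N)) := by ring
    _ ≤ Q N * (|s - s'| + (c * |ρ - ρ'| + |s - s'|)) := by gcongr
    _ = _ := by ring

lemma HB_lip (S : Stretch c Q v) {s ρ s' ρ' m : ℝ} (hm : 0 < m)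
    (h0 : m ≤ max ρ (|s|/c)) (h0' : m ≤ max ρ' (|s'|/c)) :
    |HB c Q s ρ - HB c Q s' ρ'| ≤ Q m * (2 * |s - s'| + c * |ρ - ρ'|) := by
  have hc := S.hc
  rcases le_total (max ρ (|s|/c)) (max ρ' (|s'|/c)) with h | h
  · refine (S.HB_lip_aux (hm.trans_le h0) h).trans ?_
    gcongr
    exact S.anti _ _ hm h0
  · rw [abs_sub_comm, abs_sub_comm s, abs_sub_comm ρ]
    refine (S.HB_lip_aux (hm.trans_le h0') h).trans ?_
    gcongr
    exact S.anti _ _ hm h0'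

lemma abs_le_cNQ (S : Stretch c Q v) {t N : ℝ} (hN : v |t| ≤ N) (h0 : 0 < N) :
    |t| ≤ c * (N * Q N) := by
  have hc := S.hc
  rcases (abs_nonneg t).eq_or_lt with h | h
  · have := S.one_le N h0
    rw [← h]; positivity
  · have h1 := S.vinv' _ h
    have h2 := S.mono' (S.vpos _ h) hN
    calc |t| = c * (v |t| * Q (v |t|)) := by linarith
      _ ≤ _ := by gcongr

lemma FB_lip_aux (S : Stretch c Q v) {K : ℝ}
    (hv : ∀ s t, 0 ≤ s → s ≤ t → v t - v s ≤ K * (t - s)) (hK : 0 ≤ K) {t ρ t' ρ' : ℝ}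
    (h0 : 0 < max ρ (v |t|)) (hle : max ρ (v |t|) ≤ max ρ' (v |t'|)) :
    |FB Q v t ρ - FB Q v t' ρ'| ≤ (1 + c * K) * |t - t'| + c * |ρ - ρ'| := by
  have hc := S.hc
  unfold FB
  set N := max ρ (v |t|) with hN
  set N' := max ρ' (v |t'|) with hN'
  have h0' : 0 < N' := h0.trans_le hle
  have hq := S.one_le N h0
  have hq' := S.one_le N' h0'
  have hd := S.Qdiff h0 hle
  have ha := S.anti N N' h0 hle
  have hm := S.mono' h0 hle
  have ht : |t| ≤ c * (N * Q N) := S.abs_le_cNQ (le_max_right _ _) h0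
  have hvl : v |t'| ≤ v |t| + K * |t - t'| := by
    have hK' : 0 ≤ K * |t - t'| := by positivity
    rcases le_total (|t|) (|t'|) with h | h
    · have h1 := hv _ _ (abs_nonneg t) h
      have h2 := abs_sub_abs_le_abs_sub t' t
      rw [abs_sub_comm t' t] at h2
      have h3 := mul_le_mul_of_nonneg_left h2 hK
      linarith
    · have := S.vmono _ _ (abs_nonneg t') h; linarith
  have hNN : N' - N ≤ |ρ - ρ'| + K * |t - t'| := by
    have e1 : N' ≤ N + (|ρ - ρ'| + K * |t - t'|) := by
      apply max_le
      · have := le_max_left ρ (v |t|)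
        have h2 := neg_abs_le (ρ - ρ')
        have h3 : 0 ≤ K * |t - t'| := by positivity
        linarith
      · have := le_max_right ρ (v |t|)
        have h4 := abs_nonneg (ρ - ρ')
        linarith
    linarith
  have e : t / Q N - t' / Q N' = (t - t') / Q N' - t * ((Q N - Q N') / (Q N * Q N')) := by
    field_simp; ring
  rw [e]
  have h1 : |(t - t') / Q N'| ≤ |t - t'| := by
    rw [abs_div, abs_of_nonneg (by linarith : 0 ≤ Q N')]
    exact div_le_self (abs_nonneg _) hq'
  have h2 : |t * ((Q N - Q N') / (Q N * Q N'))| ≤ c * (N' - N) := by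
    have hp : 0 ≤ (Q N - Q N') / (Q N * Q N') :=
      div_nonneg (by linarith) (by positivity)
    rw [abs_mul, abs_of_nonneg hp]
    have hb : (Q N - Q N') / (Q N * Q N') ≤ (N' - N) / (N' * Q N') := by
      rw [div_le_div_iff₀ (by positivity) (by positivity)]
      have := mul_le_mul_of_nonneg_right hd (by linarith : 0 ≤ Q N')
      nlinarith
    calc |t| * ((Q N - Q N') / (Q N * Q N')) ≤ (c * (N' * Q N')) * ((N' - N) / (N' * Q N')) := by
          gcongr
          exact ht.trans (by gcongr)
      _ = c * (N' - N) := by field_simp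
  have h3 : c * (N' - N) ≤ c * (|ρ - ρ'| + K * |t - t'|) := by gcongr
  have h4 := abs_sub ((t - t') / Q N') (t * ((Q N - Q N') / (Q N * Q N')))
  nlinarith

lemma FB_lip (S : Stretch c Q v) {K : ℝ}
    (hv : ∀ s t, 0 ≤ s → s ≤ t → v t - v s ≤ K * (t - s)) (hK : 0 ≤ K) {t ρ t' ρ' : ℝ}
    (h0 : 0 < max ρ (v |t|)) (h0' : 0 < max ρ' (v |t'|)) :
    |FB Q v t ρ - FB Q v t' ρ'| ≤ (1 + c * K) * |t - t'| + c * |ρ - ρ'| := by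
  rcases le_total (max ρ (v |t|)) (max ρ' (v |t'|)) with h | h
  · exact S.FB_lip_aux hv hK h0 h
  · rw [abs_sub_comm, abs_sub_comm t, abs_sub_comm ρ]
    exact S.FB_lip_aux hv hK h0' h

lemma FB_HB (S : Stretch c Q v) {s ρ : ℝ} (h0 : 0 < max ρ (|s|/c)) :
    max ρ (v |HB c Q s ρ|) = max ρ (|s|/c) ∧ FB Q v (HB c Q s ρ) ρ = s := by
  have hc := S.hc
  have hq := S.one_le _ h0
  have key : max ρ (v |HB c Q s ρ|) = max ρ (|s|/c) := by
    unfold HB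
    rw [abs_mul, abs_of_nonneg (by linarith : 0 ≤ Q (max ρ (|s|/c)))]
    rcases le_total ρ (|s|/c) with h | h
    · rw [max_eq_right h] at h0 ⊢
      have : |s| * Q (|s|/c) = c * (|s|/c) * Q (|s|/c) := by field_simp
      rw [this, S.vinv _ h0, max_eq_right h]
    · rw [max_eq_left h] at h0 hq ⊢
      apply max_eq_left
      rw [div_le_iff₀ hc] at h
      have := S.vmono (|s| * Q ρ) (c * ρ * Q ρ) (by positivity) (by gcongr; linarith)
      rwa [S.vinv _ h0] at this
  refine ⟨key, ?_⟩
  rw [FB, key, HB]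
  field_simp

lemma HB_FB (S : Stretch c Q v) {t ρ : ℝ} (h0 : 0 < max ρ (v |t|)) :
    max ρ (|FB Q v t ρ|/c) = max ρ (v |t|) ∧ HB c Q (FB Q v t ρ) ρ = t := by
  have hc := S.hc
  have hq := S.one_le _ h0
  have key : max ρ (|FB Q v t ρ|/c) = max ρ (v |t|) := by
    unfold FB
    rw [abs_div, abs_of_nonneg (by linarith : 0 ≤ Q (max ρ (v |t|)))]
    rcases le_total ρ (v |t|) with h | h
    · rw [max_eq_right h] at h0 hq ⊢
      have ht : 0 < |t| := by
        rcases (abs_nonneg t).eq_or_lt with h | h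
        · rw [← h, S.v0] at h0; exact absurd h0 (lt_irrefl _)
        · exact h
      have h1 := S.vinv' _ ht
      have : |t| / Q (v |t|) / c = v |t| := by
        rw [div_div, div_eq_iff (by positivity)]; linarith
      rw [this, max_eq_right h]
    · rw [max_eq_left h] at h0 hq ⊢
      apply max_eq_left
      rw [div_div, div_le_iff₀ (by positivity)]
      have := S.abs_le_cNQ h h0
      linarith
  refine ⟨key, ?_⟩
  rw [HB, key, FB]
  field_simp

end Stretch

/-- The affine part. -/
def DA (κ ℓ : ℝ → ℝ) (ρ : ℝ) : ℝ := max 0 (1 - κ ρ / ℓ ρ) / 2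
def HA (κ ℓ : ℝ → ℝ) (s ρ : ℝ) : ℝ := s - s * DA κ ℓ ρ - ℓ ρ * DA κ ℓ ρ
def FA (κ ℓ : ℝ → ℝ) (t ρ : ℝ) : ℝ := (t + ℓ ρ * DA κ ℓ ρ) / (1 - DA κ ℓ ρ)

lemma affine_range {k l s d : ℝ} (hl : 0 < l) (hk : 0 ≤ k) (hd : d = max 0 (1 - k / l) / 2) :
    (0 ≤ d ∧ d ≤ 1/2) ∧ ((-l < s ∧ s < l) ↔ (-l < s - s * d - l * d ∧ s - s * d - l * d < l ∧
      s - s * d - l * d < k)) := by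
  have hkl : 0 ≤ k / l := by positivity
  rcases le_total l k with h | h
  · have : 1 ≤ k / l := by rwa [le_div_iff₀ hl, one_mul]
    rw [max_eq_left (by linarith)] at hd
    subst hd
    refine ⟨by norm_num, ?_⟩
    constructor
    · rintro ⟨a, b⟩; refine ⟨by linarith, by linarith, by linarith⟩
    · rintro ⟨a, b, _⟩; exact ⟨by linarith, by linarith⟩
  · have h1 : k / l ≤ 1 := by rwa [div_le_one hl]
    rw [max_eq_right (by linarith)] at hd
    have hk' : k = l * (1 - 2 * d) := by rw [hd]; field_simp; ring
    have hd0 : 0 ≤ d := by rw [hd]; linarith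
    have hd1 : d ≤ 1/2 := by rw [hd]; linarith
    refine ⟨⟨hd0, hd1⟩, ?_⟩
    rw [hk']
    constructor
    · rintro ⟨a, b⟩; refine ⟨by nlinarith, by nlinarith, by nlinarith⟩
    · rintro ⟨a, b, e⟩
      constructor
      · by_contra! hh; nlinarith
      · by_contra! hh; nlinarith


def QF (α r1 r : ℝ) : ℝ := tauF α (min r r1) / ((tauF α r1 / r1) * min r r1)
def vF (α r1 t : ℝ) : ℝ :=
  cuspFun α (min t (tauF α r1)) + (max t (tauF α r1) - tauF α r1) / (tauF α r1 / r1)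
def kF (α r1 ρ : ℝ) : ℝ := tauF α (max ρ r1) - tauF α r1 + (tauF α r1 / r1) * min ρ r1

lemma cuspFun_mono {α s t : ℝ} (hα : 0 < α) (hs : 0 ≤ s) (h : s ≤ t) : cuspFun α s ≤ cuspFun α t := by
  rcases h.eq_or_lt with rfl | h
  · exact le_rfl
  · exact (cuspFun_lt hα hs h).le

lemma tauF_mono {α s t : ℝ} (hα : 0 < α) (hs : 0 < s) (h : s ≤ t) (h1 : t ≤ 1) :
    tauF α s ≤ tauF α t := by
  rcases h.eq_or_lt with rfl | h
  · exact le_rfl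
  · exact (tauF_lt hα hs h h1).le

lemma QF_le {α r1 r : ℝ} (h : r ≤ r1) : QF α r1 r = tauF α r / ((tauF α r1 / r1) * r) := by
  rw [QF, min_eq_left h]
lemma QF_ge {α r1 r : ℝ} (h1 : 0 < r1) (h1' : r1 ≤ 1) (h : r1 ≤ r) : QF α r1 r = 1 := by
  have := tauF_pos (α := α) h1 h1'
  rw [QF, min_eq_right h]; field_simp

lemma cQF {α r1 r : ℝ} (h1 : 0 < r1) (h1' : r1 ≤ 1) (hr : 0 < r) (h : r ≤ r1) :
    (tauF α r1 / r1) * r * QF α r1 r = tauF α r := by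
  have := tauF_pos (α := α) h1 h1'
  rw [QF_le h]; field_simp

lemma stretch_concrete {α r1 : ℝ} (hα : 0 < α) (h1 : 0 < r1) (h1' : r1 ≤ 1)
    (hL : 1/α ≤ 1 - Real.log r1) : Stretch (tauF α r1 / r1) (QF α r1) (vF α r1) := by
  have ht1 := tauF_pos (α := α) h1 h1'
  have hc : 0 < tauF α r1 / r1 := by positivity
  have hct : tauF α r1 / r1 * r1 = tauF α r1 := by field_simp
  have hanti : ∀ r r', 0 < r → r ≤ r' → QF α r1 r' ≤ QF α r1 r := by
    intro r r' hr hrr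
    have hm : 0 < min r r1 := lt_min hr h1
    have hm' : 0 < min r' r1 := lt_min (by linarith) h1
    have hlog : 1/α ≤ 1 - Real.log (min r' r1) := by
      have := Real.log_le_log hm' (min_le_right r' r1); linarith
    have := tauF_div_antitone hα hm (min_le_min_right r1 hrr) ((min_le_right _ _).trans h1') hlog
    unfold QF
    rw [mul_comm, ← div_div, mul_comm, ← div_div]
    gcongr
  have hmono : ∀ r r', 0 < r → r < r' → r * QF α r1 r < r' * QF α r1 r' := by
    have A : ∀ r r', 0 < r → r < r' → r' ≤ r1 → r * QF α r1 r < r' * QF α r1 r' := by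
      intro r r' hr hrr h
      have e1 := cQF (α := α) h1 h1' hr (by linarith)
      have e2 := cQF (α := α) h1 h1' (hr.trans hrr) h
      have e3 := tauF_lt hα hr hrr (h.trans h1')
      rw [← e1, ← e2, mul_assoc, mul_assoc] at e3
      exact lt_of_mul_lt_mul_left e3 hc.le
    intro r r' hr hrr
    rcases le_total r' r1 with h | h
    · exact A r r' hr hrr h
    · have e0 := QF_ge (α := α) h1 h1' h
      rcases lt_or_ge r r1 with h' | h'
      · have := A r r1 hr h' le_rfl
        rw [QF_ge h1 h1' le_rfl] at this
        rw [e0]; linarith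
      · rw [e0, QF_ge h1 h1' h']; linarith
  have hv1 : ∀ t, t ≤ tauF α r1 → vF α r1 t = cuspFun α t := by
    intro t ht; rw [vF, min_eq_left ht, max_eq_right ht]; simp
  have hv2 : ∀ t, tauF α r1 ≤ t → vF α r1 t = t / (tauF α r1 / r1) := by
    intro t ht; rw [vF, min_eq_right ht, max_eq_left ht, cuspFun_tauF hα h1 h1', sub_div]
    field_simp; ring
  refine ⟨hc, ?_, hanti, hmono, ?_, ?_, ?_, ?_, ?_⟩
  · intro r hr
    have := hanti r (max r r1) hr (le_max_left _ _)
    rwa [QF_ge h1 h1' (le_max_right _ _)] at this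
  · rw [hv1 _ ht1.le, cuspFun_zero]
  · intro s t hs hst
    unfold vF
    gcongr
    exact cuspFun_mono hα (le_min hs ht1.le) (min_le_min_right _ hst)
  · intro r hr
    rcases le_total r r1 with h | h
    · rw [cQF h1 h1' hr h, hv1 _ (tauF_mono hα hr h h1'), cuspFun_tauF hα hr (h.trans h1')]
    · rw [QF_ge h1 h1' h, hv2 _ (by rw [mul_one]; nth_rewrite 1 [← hct]; gcongr)]
      field_simp
  · intro t ht
    rcases le_total t (tauF α r1) with h | h
    · rw [hv1 t h]; exact cuspFun_pos ht
    · rw [hv2 t h]; positivity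
  · intro t ht
    rcases le_total t (tauF α r1) with h | h
    · rw [hv1 t h, cQF h1 h1' (cuspFun_pos ht), tauF_cuspFun hα ht]
      have := cuspFun_mono hα ht.le h
      rwa [cuspFun_tauF hα h1 h1'] at this
    · rw [hv2 t h, QF_ge h1 h1']
      · field_simp
      · rw [le_div_iff₀ hc, mul_comm, hct]; exact h

lemma vF_lip {α r1 : ℝ} (hα : 0 < α) (h1 : 0 < r1) (h1' : r1 ≤ 1) :
    ∃ K, 0 ≤ K ∧ ∀ s t, 0 ≤ s → s ≤ t → vF α r1 t - vF α r1 s ≤ K * (t - s) := by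
  have ht1 := tauF_pos (α := α) h1 h1'
  have hc : 0 < tauF α r1 / r1 := by positivity
  refine ⟨(α * Real.exp 1 * (1 + 1/α) ^ (1 + 1/α)) + 1 / (tauF α r1 / r1), by positivity, ?_⟩
  intro s t hs hst
  have hC : 0 ≤ (α * Real.exp 1 * (1 + 1/α) ^ (1 + 1/α)) := by positivity
  have a := cuspFun_lip hα (le_min hs ht1.le) (min_le_min_right (tauF α r1) hst)
  have b : min t (tauF α r1) - min s (tauF α r1) ≤ t - s := by
    rcases le_total t (tauF α r1) with h | h <;> rcases le_total s (tauF α r1) with h' | h' <;>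
      simp [h, h'] <;> linarith
  have c : max t (tauF α r1) - max s (tauF α r1) ≤ t - s := by
    rcases le_total t (tauF α r1) with h | h <;> rcases le_total s (tauF α r1) with h' | h' <;>
      simp [h, h'] <;> linarith
  have d : (max t (tauF α r1) - max s (tauF α r1)) / (tauF α r1 / r1) ≤ (t - s) / (tauF α r1 / r1) := by
    gcongr
  have e := mul_le_mul_of_nonneg_left b hC
  have : vF α r1 t - vF α r1 s = (cuspFun α (min t (tauF α r1)) - cuspFun α (min s (tauF α r1))) +
    (max t (tauF α r1) - max s (tauF α r1)) / (tauF α r1 / r1) := by unfold vF; ring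
  rw [this, add_mul, div_mul_eq_mul_div, one_mul]
  linarith

lemma tauF_lip {α r1 : ℝ} (hα : 0 < α) (h1 : 0 < r1) {s t : ℝ} (hs : r1 ≤ s) (hst : s ≤ t)
    (ht : t ≤ 1) : tauF α t - tauF α s ≤ 1 / (α * r1) * (t - s) := by
  have hd : ∀ x ∈ Icc r1 1, HasDerivAt (fun r : ℝ => (1 - Real.log r) ^ (-(1/α)))
      (-(x⁻¹) * (-(1/α)) * (1 - Real.log x) ^ (-(1/α) - 1)) x := by
    intro x hx
    have hx0 : 0 < x := by linarith [hx.1]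
    have := one_sub_log_pos hx0 hx.2
    exact ((Real.hasDerivAt_log hx0.ne').const_sub 1).rpow_const (Or.inl (by linarith))
  rw [tauF_pos_eq (by linarith), tauF_pos_eq (by linarith)]
  refine (convex_Icc r1 1).image_sub_le_mul_sub_of_deriv_le
    (f := fun r : ℝ => (1 - Real.log r) ^ (-(1/α))) ?_ ?_ ?_ s ⟨hs, by linarith⟩ t ⟨by linarith, ht⟩ hst
  · intro x hx
    exact (hd x hx).continuousAt.continuousWithinAt
  · intro x hx
    exact (hd x (interior_subset hx)).differentiableAt.differentiableWithinAt
  · intro x hx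
    have hx' := interior_subset hx
    rw [(hd x hx').deriv]
    have hx0 : 0 < x := by linarith [hx'.1]
    have h := one_sub_log_pos hx0 hx'.2
    have h2 : (1 - Real.log x) ^ (-(1/α) - 1) ≤ 1 :=
      Real.rpow_le_one_of_one_le_of_nonpos h (by have : 0 < 1/α := by positivity
                                                 linarith)
    have h3 : x⁻¹ ≤ r1⁻¹ := by gcongr; exact hx'.1
    have h4 : 0 ≤ x⁻¹ := by positivity
    calc -(x⁻¹) * (-(1/α)) * (1 - Real.log x) ^ (-(1/α) - 1)
        = (1/α) * x⁻¹ * (1 - Real.log x) ^ (-(1/α) - 1) := by ring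
      _ ≤ (1/α) * r1⁻¹ * 1 := by gcongr
      _ = _ := by field_simp

lemma kF_lip {α r1 : ℝ} (hα : 0 < α) (h1 : 0 < r1) (h1' : r1 ≤ 1) :
    ∃ K, 0 ≤ K ∧ ∀ s t, s ≤ 1 → t ≤ 1 → |kF α r1 t - kF α r1 s| ≤ K * |t - s| := by
  have ht1 := tauF_pos (α := α) h1 h1'
  have hc : 0 < tauF α r1 / r1 := by positivity
  have key : ∀ s t, s ≤ t → t ≤ 1 → |kF α r1 t - kF α r1 s| ≤ (1 / (α * r1) + tauF α r1 / r1) * (t - s) := by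
    intro s t hst ht
    have a := tauF_lip hα h1 (le_max_right s r1) (max_le_max_right r1 hst) (max_le ht h1')
    have a' := tauF_mono hα (lt_max_of_lt_right h1) (max_le_max_right r1 hst) (max_le ht h1')
    have b : min t r1 - min s r1 ≤ t - s := by
      rcases le_total t r1 with h | h <;> rcases le_total s r1 with h' | h' <;>
        simp [h, h'] <;> linarith
    have b' : 0 ≤ min t r1 - min s r1 := sub_nonneg.2 (min_le_min_right _ hst)
    have c : max t r1 - max s r1 ≤ t - s := by
      rcases le_total t r1 with h | h <;> rcases le_total s r1 with h' | h' <;>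
        simp [h, h'] <;> linarith
    have e : kF α r1 t - kF α r1 s = (tauF α (max t r1) - tauF α (max s r1)) +
      (tauF α r1 / r1) * (min t r1 - min s r1) := by unfold kF; ring
    rw [e, abs_of_nonneg (add_nonneg (by linarith) (by positivity)), add_mul]
    have c2 : 1 / (α * r1) * (max t r1 - max s r1) ≤ 1 / (α * r1) * (t - s) := by gcongr
    have b2 : (tauF α r1 / r1) * (min t r1 - min s r1) ≤ (tauF α r1 / r1) * (t - s) := by gcongr
    linarith
  refine ⟨1 / (α * r1) + tauF α r1 / r1, by positivity, fun s t hs ht => ?_⟩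
  rcases le_total s t with h | h
  · rw [abs_of_nonneg (sub_nonneg.2 h)]; exact key s t h ht
  · rw [abs_sub_comm, abs_sub_comm t, abs_of_nonneg (sub_nonneg.2 h)]; exact key t s h hs

lemma kF_le {α r1 ρ : ℝ} (h : ρ ≤ r1) : kF α r1 ρ = (tauF α r1 / r1) * ρ := by
  rw [kF, max_eq_right h, min_eq_left h]; ring
lemma kF_ge {α r1 ρ : ℝ} (h1 : 0 < r1) (h : r1 ≤ ρ) : kF α r1 ρ = tauF α ρ := by
  rw [kF, max_eq_left h, min_eq_right h]; field_simp; ring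

lemma HB_region {α r1 : ℝ} (hα : 0 < α) (h1 : 0 < r1) (h1' : r1 ≤ 1)
    (hL : 1/α ≤ 1 - Real.log r1) (hsmall : tauF α r1 ^ 2 + r1 ^ 2 ≤ 1)
    {s ρ t : ℝ} (hρ : 0 ≤ ρ) (ht : t = HB (tauF α r1 / r1) (QF α r1) s ρ) :
    (s^2 + ρ^2 < 1 ∧ s < kF α r1 ρ) ↔ (t^2 + ρ^2 < 1 ∧ t < tauF α ρ) := by
  have S := stretch_concrete hα h1 h1' hL
  have ht1 := tauF_pos (α := α) h1 h1'
  have hc := S.hc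
  have hct : tauF α r1 / r1 * r1 = tauF α r1 := by field_simp
  set c := tauF α r1 / r1 with hcd
  set N := max ρ (|s|/c) with hN
  have ht' : t = s * QF α r1 N := ht
  have hsN : |s| ≤ c * N := by
    have : |s|/c ≤ N := le_max_right _ _
    rw [div_le_iff₀ hc] at this; linarith
  rcases le_or_gt r1 N with h | h
  · rw [QF_ge h1 h1' h, mul_one] at ht'
    subst ht'
    refine and_congr_right fun hb => ?_
    rcases le_or_gt r1 ρ with h2 | h2
    · rw [kF_ge h1 h2]
    · have h3 : r1 ≤ |t|/c := by
        rcases le_max_iff.1 h with h | h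
        · linarith
        · exact h
      have h3' : tauF α r1 ≤ |t| := by rw [le_div_iff₀ hc] at h3; linarith
      rw [kF_le h2.le]
      have h4 : c * ρ ≤ tauF α r1 := by rw [← hct]; gcongr
      have h5 : tauF α ρ ≤ tauF α r1 := by
        rcases hρ.eq_or_lt with rfl | hρ
        · simp [tauF] at ht1 ⊢; linarith
        · exact tauF_mono hα hρ h2.le h1'
      have h6 : 0 ≤ tauF α ρ := by
        rcases hρ.eq_or_lt with rfl | hρ
        · simp [tauF]
        · exact (tauF_pos hρ (by linarith)).le
      have h7 : 0 ≤ c * ρ := by positivity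
      rcases le_total 0 t with h8 | h8
      · rw [abs_of_nonneg h8] at h3'
        constructor
        · intro h9; linarith
        · intro h9; linarith
      · rw [abs_of_nonpos h8] at h3'
        constructor
        · intro h9; linarith
        · intro h9; linarith
  · have hρ1 : ρ < r1 := (le_max_left _ _).trans_lt h
    rw [kF_le hρ1.le]
    rcases (hρ.trans (le_max_left ρ (|s|/c))).eq_or_lt with h0 | h0
    · have hs0 : s = 0 := by
        rw [← hN] at h0
        rw [← h0, mul_zero] at hsN; simpa using hsN
      have hρ0 : ρ = 0 := le_antisymm ((le_max_left _ _).trans h0.symm.le) hρ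
      rw [hs0, zero_mul] at ht'
      rw [hs0, hρ0, ht']; simp [tauF]
    · have hq := S.one_le N h0
      have hs1 : |s| ≤ tauF α r1 := by rw [← hct]; exact hsN.trans (by gcongr)
      have htm : |t| < tauF α r1 := by
        rw [ht', abs_mul, abs_of_nonneg (by linarith : 0 ≤ QF α r1 N)]
        have a := S.mono N r1 h0 h
        rw [QF_ge h1 h1' le_rfl] at a
        calc |s| * QF α r1 N ≤ c * N * QF α r1 N := by gcongr
          _ = c * (N * QF α r1 N) := by ring
          _ < c * (r1 * 1) := by gcongr
          _ = tauF α r1 := by rw [mul_one, hct]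
      have hb1 : s^2 + ρ^2 < 1 := by
        have a : s^2 ≤ tauF α r1^2 := by rw [← sq_abs]; gcongr
        have b : ρ^2 < r1^2 := by gcongr
        linarith
      have hb2 : t^2 + ρ^2 < 1 := by
        have a : t^2 ≤ tauF α r1^2 := by rw [← sq_abs]; gcongr
        have b : ρ^2 < r1^2 := by gcongr
        linarith
      simp only [hb1, hb2, true_and]
      rcases hρ.eq_or_lt with hρ0 | hρ0
      · rw [← hρ0, mul_zero]
        have : tauF α 0 = 0 := by simp [tauF]
        rw [this, ht']
        constructor
        · intro h; nlinarith
        · intro h; by_contra! hh; nlinarith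
      · have e := cQF (α := α) h1 h1' hρ0 hρ1.le
        rw [← hcd] at e
        constructor
        · intro h3
          rcases le_or_gt s 0 with h4 | h4
          · have := tauF_pos (α := α) hρ0 (by linarith)
            rw [ht']; nlinarith
          · have h5 : N = ρ := by
              rw [hN]; apply max_eq_left
              rw [abs_of_pos h4, div_le_iff₀ hc]; linarith
            rw [h5] at ht' hq
            rw [ht', ← e]; gcongr
        · intro h3
          by_contra! h4
          have hs0 : 0 < s := lt_of_lt_of_le (by positivity) h4
          have h5 : N = s / c := by
            rw [hN, abs_of_pos hs0]; apply max_eq_right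
            rw [le_div_iff₀ hc]; linarith
          have h6 : c * N = s := by rw [h5]; field_simp
          have h7 := S.mono' hρ0 (le_max_left ρ (|s|/c))
          rw [← hN] at h7
          have : tauF α ρ ≤ t := by
            rw [ht', ← e, ← h6, mul_assoc, mul_assoc]; gcongr
          linarith


def lF (r0 ρ : ℝ) : ℝ := √(1 - (min ρ r0)^2)

lemma lF_bounds {r0 ρ : ℝ} (h0 : 0 < r0) (h1 : r0 < 1) (hρ : 0 ≤ ρ) :
    √(1 - r0^2) ≤ lF r0 ρ ∧ lF r0 ρ ≤ 1 := by
  have hm : 0 ≤ min ρ r0 := le_min hρ h0.le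
  constructor
  · apply Real.sqrt_le_sqrt
    have : min ρ r0 ^ 2 ≤ r0^2 := by gcongr; exact min_le_right _ _
    linarith
  · unfold lF
    rw [Real.sqrt_le_left zero_le_one]; nlinarith [sq_nonneg (min ρ r0)]

lemma abs_min_sub_le (a b c : ℝ) : |min a c - min b c| ≤ |a - b| := by
  rcases le_total a c with h | h <;> rcases le_total b c with h' | h' <;>
    simp [h, h'] <;> rw [abs_le] <;> constructor <;>
      first | linarith [le_abs_self (a-b), neg_abs_le (a-b)] 

lemma abs_max_zero_sub_le (a b : ℝ) : |max 0 a - max 0 b| ≤ |a - b| := by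
  have := abs_max_sub_max_le_abs a b 0
  rwa [max_comm a, max_comm b] at this

lemma lF_lip {r0 : ℝ} (h0 : 0 < r0) (h1 : r0 < 1) {ρ ρ' : ℝ} (hρ : 0 ≤ ρ) (hρ' : 0 ≤ ρ') :
    |lF r0 ρ - lF r0 ρ'| ≤ 1 / √(1 - r0^2) * |ρ - ρ'| := by
  have hl : 0 < √(1 - r0^2) := Real.sqrt_pos.2 (by nlinarith)
  obtain ⟨a, -⟩ := lF_bounds h0 h1 hρ
  obtain ⟨b, -⟩ := lF_bounds h0 h1 hρ'
  set m := min ρ r0 with hm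
  set m' := min ρ' r0 with hm'
  have hm0 : 0 ≤ m := le_min hρ h0.le
  have hm0' : 0 ≤ m' := le_min hρ' h0.le
  have hm1 : m ≤ 1 := (min_le_right _ _).trans h1.le
  have hm1' : m' ≤ 1 := (min_le_right _ _).trans h1.le
  have e1 : lF r0 ρ ^ 2 = 1 - m^2 := Real.sq_sqrt (by nlinarith)
  have e2 : lF r0 ρ' ^ 2 = 1 - m'^2 := Real.sq_sqrt (by nlinarith)
  have hmm : |m - m'| ≤ |ρ - ρ'| := abs_min_sub_le _ _ _
  have key : |lF r0 ρ - lF r0 ρ'| * (lF r0 ρ + lF r0 ρ') = |m - m'| * (m + m') := by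
    have x1 : |lF r0 ρ + lF r0 ρ'| = lF r0 ρ + lF r0 ρ' := abs_of_nonneg (by linarith)
    have x2 : |m + m'| = m + m' := abs_of_nonneg (by linarith)
    have x3 : (lF r0 ρ - lF r0 ρ') * (lF r0 ρ + lF r0 ρ') = -((m - m') * (m + m')) := by nlinarith
    have x4 := congrArg abs x3
    rwa [abs_neg, abs_mul, abs_mul, x1, x2] at x4
  rw [div_mul_eq_mul_div, one_mul, le_div_iff₀ hl]
  have k2 : |lF r0 ρ - lF r0 ρ'| * (2 * √(1 - r0^2)) ≤ |m - m'| * (m + m') := by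
    rw [← key]; gcongr; linarith
  have k3 : |m - m'| * (m + m') ≤ |ρ - ρ'| * 2 := by gcongr; linarith
  linarith

/-- properties of the affine part -/
lemma affine_data {κ : ℝ → ℝ} {r0 Kk : ℝ} (h0 : 0 < r0) (h1 : r0 < 1) (hKk : 0 ≤ Kk)
    (hκ0 : ∀ ρ, 0 ≤ ρ → ρ ≤ 1 → 0 ≤ κ ρ ∧ κ ρ ≤ 1)
    (hκ : ∀ s t, s ≤ 1 → t ≤ 1 → |κ t - κ s| ≤ Kk * |t - s|) 
    (hκl : ∀ ρ, r0 ≤ ρ → ρ ≤ 1 → lF r0 ρ ≤ κ ρ) :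
    (∀ ρ, 0 ≤ ρ → ρ ≤ 1 → 0 ≤ DA κ (lF r0) ρ ∧ DA κ (lF r0) ρ ≤ 1/2) ∧
    (∃ K, 0 ≤ K ∧ ∀ ρ ρ', 0 ≤ ρ → ρ ≤ 1 → 0 ≤ ρ' → ρ' ≤ 1 →
      |DA κ (lF r0) ρ - DA κ (lF r0) ρ'| ≤ K * |ρ - ρ'| ∧ 
      |lF r0 ρ * DA κ (lF r0) ρ - lF r0 ρ' * DA κ (lF r0) ρ'| ≤ K * |ρ - ρ'|) ∧
    (∀ s ρ, 0 ≤ ρ → ρ ≤ 1 → (s^2 + ρ^2 < 1 ↔ 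
      (HA κ (lF r0) s ρ)^2 + ρ^2 < 1 ∧ HA κ (lF r0) s ρ < κ ρ)) := by
  have hl : 0 < √(1 - r0^2) := Real.sqrt_pos.2 (by nlinarith)
  have hD : ∀ ρ, 0 ≤ ρ → ρ ≤ 1 → 0 ≤ DA κ (lF r0) ρ ∧ DA κ (lF r0) ρ ≤ 1/2 := fun ρ a b =>
    (affine_range (s := 0) (hl.trans_le (lF_bounds h0 h1 a).1) (hκ0 ρ a b).1 rfl).1
  refine ⟨hD, ?_, ?_⟩
  · set l0 := √(1 - r0^2) with hl0
    have kl : ∀ ρ ρ', 0 ≤ ρ → ρ ≤ 1 → 0 ≤ ρ' → ρ' ≤ 1 → 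
      |DA κ (lF r0) ρ - DA κ (lF r0) ρ'| ≤ (Kk / l0 + 1 / l0^3) * |ρ - ρ'| := by
      intro ρ ρ' a b a' b'
      obtain ⟨q1, q2⟩ := lF_bounds h0 h1 a
      obtain ⟨q1', q2'⟩ := lF_bounds h0 h1 a'
      rw [← hl0] at q1 q1'
      have p : 0 < lF r0 ρ := hl.trans_le q1
      have p' : 0 < lF r0 ρ' := hl.trans_le q1'
      have h3 := lF_lip h0 h1 a' a
      rw [abs_sub_comm ρ'] at h3
      have h4 := hκ ρ ρ' b b'
      rw [abs_sub_comm ρ'] at h4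
      have e : κ ρ' / lF r0 ρ' - κ ρ / lF r0 ρ = (κ ρ' - κ ρ) / lF r0 ρ' - 
        κ ρ * (lF r0 ρ' - lF r0 ρ) / (lF r0 ρ * lF r0 ρ') := by
        field_simp; ring
      have k1 : |(κ ρ' - κ ρ) / lF r0 ρ'| ≤ Kk * |ρ - ρ'| / l0 := by
        rw [abs_div, abs_of_pos p']; gcongr
      have k2 : |κ ρ * (lF r0 ρ' - lF r0 ρ) / (lF r0 ρ * lF r0 ρ')| ≤ 
          1 * (1 / l0 * |ρ - ρ'|) / (l0 * l0) := by
        rw [abs_div, abs_mul, abs_of_nonneg (hκ0 ρ a b).1, abs_of_pos (mul_pos p p')]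
        gcongr
        exact (hκ0 ρ a b).2
      have k3 := abs_sub ((κ ρ' - κ ρ) / lF r0 ρ') (κ ρ * (lF r0 ρ' - lF r0 ρ) / (lF r0 ρ * lF r0 ρ'))
      rw [← e] at k3
      have k4 := abs_max_zero_sub_le (1 - κ ρ / lF r0 ρ) (1 - κ ρ' / lF r0 ρ')
      have k5 : (1 - κ ρ / lF r0 ρ) - (1 - κ ρ' / lF r0 ρ') = κ ρ' / lF r0 ρ' - κ ρ / lF r0 ρ := by ring
      rw [k5] at k4
      unfold DA
      rw [← sub_div, abs_div, abs_two]
      have k6 : 1 * (1 / l0 * |ρ - ρ'|) / (l0 * l0) = 1/l0^3 * |ρ - ρ'| := by field_simp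
      have k7 : Kk * |ρ - ρ'| / l0 = Kk / l0 * |ρ - ρ'| := by ring
      rw [add_mul]
      have k8 := abs_nonneg (κ ρ' / lF r0 ρ' - κ ρ / lF r0 ρ)
      linarith
    refine ⟨(Kk / l0 + 1 / l0^3) + 1 / l0, by positivity, ?_⟩
    intro ρ ρ' a b a' b'
    have hk := kl ρ ρ' a b a' b'
    obtain ⟨q1, q2⟩ := lF_bounds h0 h1 a
    have h3 := lF_lip h0 h1 a a'
    have p1 : 0 ≤ 1 / l0 * |ρ - ρ'| := by positivity
    refine ⟨by rw [add_mul]; linarith, ?_⟩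
    have e : lF r0 ρ * DA κ (lF r0) ρ - lF r0 ρ' * DA κ (lF r0) ρ' = 
      lF r0 ρ * (DA κ (lF r0) ρ - DA κ (lF r0) ρ') + (lF r0 ρ - lF r0 ρ') * DA κ (lF r0) ρ' := by ring
    rw [e]
    obtain ⟨d1, d2⟩ := hD ρ' a' b'
    calc _ ≤ |lF r0 ρ * (DA κ (lF r0) ρ - DA κ (lF r0) ρ')| + |(lF r0 ρ - lF r0 ρ') * DA κ (lF r0) ρ'| := abs_add_le _ _
      _ ≤ 1 * ((Kk / l0 + 1 / l0^3) * |ρ - ρ'|) + (1 / l0 * |ρ - ρ'|) * 1 := by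
        rw [abs_mul, abs_mul, abs_of_nonneg d1, abs_of_nonneg (hl.le.trans q1)]
        gcongr
        linarith
      _ = _ := by ring
  · intro s ρ a b
    have hlp := hl.trans_le (lF_bounds h0 h1 a).1
    rcases le_or_gt r0 ρ with h | h
    · have hk := hκl ρ h b
      have hD0 : DA κ (lF r0) ρ = 0 := by
        unfold DA
        have : 1 ≤ κ ρ / lF r0 ρ := by rwa [le_div_iff₀ hlp, one_mul]
        rw [max_eq_left (by linarith)]; simp
      have : HA κ (lF r0) s ρ = s := by unfold HA; rw [hD0]; ring
      rw [this]
      refine ⟨fun h5 => ⟨h5, ?_⟩, fun h5 => h5.1⟩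
      refine lt_of_lt_of_le ?_ hk
      unfold lF
      rw [min_eq_right h]
      apply Real.lt_sqrt_of_sq_lt
      have : r0^2 ≤ ρ^2 := by gcongr
      linarith
    · have hlv : lF r0 ρ ^ 2 = 1 - ρ^2 := by
        unfold lF
        rw [min_eq_left h.le]; exact Real.sq_sqrt (by nlinarith)
      have A := (affine_range (s := s) hlp (hκ0 ρ a b).1 (d := DA κ (lF r0) ρ) rfl).2
      have B : ∀ x : ℝ, x^2 + ρ^2 < 1 ↔ (-lF r0 ρ < x ∧ x < lF r0 ρ) := by
        intro x
        rw [← abs_lt, ← abs_of_pos hlp, ← sq_lt_sq, hlv]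
        constructor <;> intro h <;> linarith
      rw [B, A, B]
      unfold HA
      tauto

lemma fin_aux {Y A T c Kv KA : ℝ} (L : Y ≤ (1 + c * Kv) * T + c * A) (p3 : 0 ≤ A) (p4 : 0 ≤ T)
    (z1 : 0 ≤ KA * A) (z2 : 0 ≤ KA * T) (z3 : 0 ≤ c * Kv * A) (z4 : 0 ≤ c * Kv * T)
    (z5 : 0 ≤ c * A) (z6 : 0 ≤ c * T) :
    (Y + KA * A) / (1/2) + 2 * (KA * A) / (1/2 * (1/2)) ≤ 12 * (1 + c * Kv + c + KA) * (T + A) := by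
  have e : (Y + KA * A) / (1/2) + 2 * (KA * A) / (1/2 * (1/2)) = 2 * Y + 10 * (KA * A) := by ring
  rw [e]
  nlinarith

set_option maxHeartbeats 2000000 in
/-- The full scalar package. -/
lemma scalar_data {α : ℝ} (hα : 0 < α) : ∃ (H F : ℝ → ℝ → ℝ) (K M r1 : ℝ), 0 ≤ K ∧ 0 < M ∧ 0 < r1 ∧ r1 < 1 ∧
    (∀ s ρ, 0 ≤ ρ → s^2 + ρ^2 < 1 →
      (H s ρ)^2 + ρ^2 < 1 ∧ H s ρ < tauF α ρ ∧ F (H s ρ) ρ = s) ∧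
    (∀ t ρ, 0 ≤ ρ → t^2 + ρ^2 < 1 → t < tauF α ρ →
      (F t ρ)^2 + ρ^2 < 1 ∧ H (F t ρ) ρ = t) ∧
    (∀ t ρ t' ρ', 0 ≤ ρ → t^2 + ρ^2 < 1 → t < tauF α ρ → 
      0 ≤ ρ' → t'^2 + ρ'^2 < 1 → t' < tauF α ρ' → 
      |F t ρ - F t' ρ'| ≤ K * (|t - t'| + |ρ - ρ'|)) ∧
    (∀ m s ρ s' ρ', 0 < m → 0 ≤ ρ → s^2 + ρ^2 < 1 → 0 ≤ ρ' → s'^2 + ρ'^2 < 1 →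
      m ≤ |s - 1| + ρ → m ≤ |s' - 1| + ρ' →
      |H s ρ - H s' ρ'| ≤ K * QF α r1 (m / M) * (|s - s'| + |ρ - ρ'|)) ∧
    (∀ r, 0 < r → 1 ≤ QF α r1 r) ∧ (∀ r r', 0 < r → r ≤ r' → QF α r1 r' ≤ QF α r1 r) := by
  obtain ⟨r1, h1, h1h, hL, ht1⟩ : ∃ r1, 0 < r1 ∧ r1 ≤ 1/2 ∧ 1/α ≤ 1 - Real.log r1 ∧ tauF α r1 ≤ 1/2 := by
    refine ⟨min (min (1/2) (Real.exp (1 - 1/α))) (cuspFun α (1/2)), ?_, ?_, ?_, ?_⟩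
    · exact lt_min (lt_min (by norm_num) (Real.exp_pos _)) (cuspFun_pos (by norm_num))
    · exact (min_le_left _ _).trans (min_le_left _ _)
    · have hp : 0 < min (min (1/2) (Real.exp (1 - 1/α))) (cuspFun α (1/2)) := 
        lt_min (lt_min (by norm_num) (Real.exp_pos _)) (cuspFun_pos (by norm_num))
      have := Real.log_le_log hp ((min_le_left _ _).trans (min_le_right _ _))
      rw [Real.log_exp] at this; linarith
    · have hp : 0 < min (min (1/2) (Real.exp (1 - 1/α))) (cuspFun α (1/2)) := 
        lt_min (lt_min (by norm_num) (Real.exp_pos _)) (cuspFun_pos (by norm_num))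
      have hu : cuspFun α (1/2) ≤ 1 := by
        have := cuspFun_mono hα (s := 1/2) (t := 1) (by norm_num) (by norm_num)
        rwa [cuspFun_one] at this
      have := tauF_mono hα hp (min_le_right _ _) hu
      rwa [tauF_cuspFun hα (by norm_num)] at this
  have h1' : r1 ≤ 1 := by linarith
  have S := stretch_concrete hα h1 h1' hL
  have ht0 := tauF_pos (α := α) h1 h1'
  have hsm : tauF α r1 ^ 2 + r1 ^ 2 ≤ 1 := by nlinarith
  obtain ⟨Kv, hKv, hv⟩ := vF_lip hα h1 h1'
  obtain ⟨Kk, hKk, hk⟩ := kF_lip hα h1 h1'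
  have ht1one : tauF α 1 = 1 := by
    rw [tauF_pos_eq one_pos]; simp
  -- r0
  obtain ⟨r0, h0, h01, h0l, h0t⟩ : ∃ r0, 4/5 ≤ r0 ∧ r0 < 1 ∧ r1 ≤ r0 ∧ 4/5 ≤ tauF α r0 := by
    have hu : cuspFun α (4/5) < 1 := by
      rw [← cuspFun_one α]; exact cuspFun_lt hα (by norm_num) (by norm_num)
    refine ⟨max (4/5) (cuspFun α (4/5)), le_max_left _ _, max_lt (by norm_num) hu, 
      le_trans (by linarith) (le_max_left _ _), ?_⟩
    have := tauF_mono hα (cuspFun_pos (by norm_num)) (le_max_right (4/5) (cuspFun α (4/5)))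
      (max_le (by norm_num) hu.le)
    rwa [tauF_cuspFun hα (by norm_num)] at this
  have hc := S.hc
  have hκ0 : ∀ ρ, 0 ≤ ρ → ρ ≤ 1 → 0 ≤ kF α r1 ρ ∧ kF α r1 ρ ≤ 1 := by
    intro ρ a b
    rcases le_total ρ r1 with h | h
    · rw [kF_le h]
      refine ⟨by positivity, ?_⟩
      calc tauF α r1 / r1 * ρ ≤ tauF α r1 / r1 * r1 := by gcongr
        _ = tauF α r1 := by field_simp
        _ ≤ 1 := by linarith
    · rw [kF_ge h1 h]
      refine ⟨(tauF_pos (h1.trans_le h) b).le, ?_⟩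
      rw [← ht1one]; exact tauF_mono hα (h1.trans_le h) b le_rfl
  have hκl : ∀ ρ, r0 ≤ ρ → ρ ≤ 1 → lF r0 ρ ≤ kF α r1 ρ := by
    intro ρ a b
    rw [kF_ge h1 (h0l.trans a), lF, min_eq_right a]
    have := tauF_mono hα (by linarith : 0 < r0) a b
    have h2 : √(1 - r0^2) ≤ 4/5 := by
      rw [Real.sqrt_le_left (by norm_num)]; nlinarith
    linarith
  have hr0 : 0 < r0 := by linarith
  obtain ⟨hD, ⟨KA, hKA, hA⟩, hreg⟩ := affine_data hr0 h01 hKk hκ0 hk hκl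
  set κ := kF α r1 with hκd
  set ℓ := lF r0 with hℓd
  set c := tauF α r1 / r1 with hcd
  set Q := QF α r1 with hQd
  set v := vF α r1 with hvd
  have hρ1 : ∀ s ρ : ℝ, s^2 + ρ^2 < 1 → 0 ≤ ρ → ρ ≤ 1 ∧ |s| ≤ 1 := by
    intro s ρ h hρ
    constructor
    · nlinarith [sq_nonneg s]
    · rw [← sq_le_one_iff_abs_le_one]; nlinarith [sq_nonneg ρ]
  have hE0 : ∀ ρ, 0 ≤ ρ → ρ ≤ 1 → 0 ≤ ℓ ρ * DA κ ℓ ρ ∧ ℓ ρ * DA κ ℓ ρ ≤ 1 := by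
    intro ρ a b
    obtain ⟨d1, d2⟩ := hD ρ a b
    obtain ⟨l1, l2⟩ := lF_bounds hr0 h01 a
    have l3 : 0 ≤ ℓ ρ := Real.sqrt_nonneg _
    refine ⟨by positivity, ?_⟩
    nlinarith
  have hk0 : κ 0 = 0 := by rw [hκd, kF_le h1.le, mul_zero]
  have hl0 : ℓ 0 = 1 := by rw [hℓd, lF, min_eq_left hr0.le]; simp
  have hD0 : DA κ ℓ 0 = 1/2 := by unfold DA; rw [hk0, hl0]; norm_num
  -- lower bound for N
  have hN : ∀ s ρ, 0 ≤ ρ → s^2 + ρ^2 < 1 → |s - 1| + ρ ≤ (2*c + 4*KA + 1) * max ρ (|HA κ ℓ s ρ| / c) := by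
    intro s ρ hρ hs
    obtain ⟨b1, b2⟩ := hρ1 s ρ hs hρ
    obtain ⟨a1, a2⟩ := hA 0 ρ le_rfl zero_le_one hρ b1
    rw [hD0, hl0, zero_sub, abs_neg, abs_of_nonneg hρ] at a2
    rw [hD0, zero_sub, abs_neg, abs_of_nonneg hρ] at a1
    set N := max ρ (|HA κ ℓ s ρ| / c)
    have n1 : ρ ≤ N := le_max_left _ _
    have n2 : |HA κ ℓ s ρ| ≤ c * N := by
      have : |HA κ ℓ s ρ|/c ≤ N := le_max_right _ _
      rw [div_le_iff₀ hc] at this; linarith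
    have e : (s - 1) / 2 = HA κ ℓ s ρ - s * (1/2 - DA κ ℓ ρ) - (1 * (1/2) - ℓ ρ * DA κ ℓ ρ) := by
      unfold HA; ring
    have e2 : |s - 1| / 2 ≤ |HA κ ℓ s ρ| + KA * ρ + KA * ρ := by
      have : |(s-1)/2| = |s-1|/2 := by rw [abs_div, abs_two]
      rw [← this, e]
      refine (abs_sub _ _).trans ?_
      refine add_le_add ((abs_sub _ _).trans ?_) a2
      gcongr
      rw [abs_mul]
      calc |s| * |1/2 - DA κ ℓ ρ| ≤ 1 * (KA * ρ) := by gcongr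
        _ = _ := one_mul _
    have := mul_le_mul_of_nonneg_left n1 hKA
    nlinarith
  have hNpos : ∀ s ρ, 0 ≤ ρ → s^2 + ρ^2 < 1 → 0 < max ρ (|HA κ ℓ s ρ| / c) := by
    intro s ρ hρ hs
    have := hN s ρ hρ hs
    have h3 : 0 < |s - 1| + ρ := by
      have : s < 1 := by nlinarith
      have : 0 < |s - 1| := abs_pos.2 (by linarith)
      linarith
    by_contra! hh
    nlinarith [hc]
  have hFN : ∀ t ρ, 0 ≤ ρ → t < tauF α ρ → 0 < max ρ (v |t|) := by
    intro t ρ hρ ht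
    rcases hρ.eq_or_lt with rfl | hρ
    · have : tauF α 0 = 0 := by simp [tauF]
      rw [this] at ht
      exact lt_max_of_lt_right (S.vpos _ (abs_pos.2 ht.ne))
    · exact lt_max_of_lt_left hρ
  have hAF : ∀ t ρ, 0 ≤ ρ → ρ ≤ 1 → HA κ ℓ (FA κ ℓ t ρ) ρ = t := by
    intro t ρ a b
    obtain ⟨d1, d2⟩ := hD ρ a b
    have : 1 - DA κ ℓ ρ ≠ 0 := by linarith
    unfold HA FA
    field_simp; ring
  have hFAH : ∀ t ρ, 0 ≤ ρ → ρ ≤ 1 → FA κ ℓ (HA κ ℓ t ρ) ρ = t := by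
    intro t ρ a b
    obtain ⟨d1, d2⟩ := hD ρ a b
    have : 1 - DA κ ℓ ρ ≠ 0 := by linarith
    unfold HA FA
    field_simp; ring
  have hFBreg : ∀ t ρ, 0 ≤ ρ → t^2 + ρ^2 < 1 → t < tauF α ρ → 
      (FB Q v t ρ)^2 + ρ^2 < 1 ∧ FB Q v t ρ < κ ρ := by
    intro t ρ hρ ht ht'
    have := (S.HB_FB (hFN t ρ hρ ht')).2
    exact (HB_region hα h1 h1' hL hsm hρ this.symm).2 ⟨ht, ht'⟩
  refine ⟨fun s ρ => HB c Q (HA κ ℓ s ρ) ρ, fun t ρ => FA κ ℓ (FB Q v t ρ) ρ,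
    max ((2 + c + 4 * KA)) (12 * (1 + c*Kv + c + KA)), 2*c+4*KA+1, r1, ?_, by positivity, h1, by linarith, ?_, ?_, ?_, ?_, S.one_le, S.anti⟩
  · exact le_max_of_le_left (by positivity)
  · intro s ρ hρ hs
    obtain ⟨b1, b2⟩ := hρ1 s ρ hs hρ
    have h2 := (hreg s ρ hρ b1).1 hs
    have h3 := (HB_region hα h1 h1' hL hsm hρ rfl).1 h2
    refine ⟨h3.1, h3.2, ?_⟩
    simp only
    rw [(S.FB_HB (hNpos s ρ hρ hs)).2, hFAH _ _ hρ b1]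
  · intro t ρ hρ ht ht'
    obtain ⟨b1, b2⟩ := hρ1 t ρ ht hρ
    obtain ⟨c1, c2⟩ := hFBreg t ρ hρ ht ht'
    have e := hAF (FB Q v t ρ) ρ hρ b1
    refine ⟨?_, ?_⟩
    · rw [hreg _ _ hρ b1, e]; exact ⟨c1, c2⟩
    · simp only
      rw [e, (S.HB_FB (hFN t ρ hρ ht')).2]
  · intro t ρ t' ρ' hρ ht htt hρ' ht' htt'
    obtain ⟨b1, b2⟩ := hρ1 t ρ ht hρ
    obtain ⟨b1', b2'⟩ := hρ1 t' ρ' ht' hρ'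
    have L := S.FB_lip hv hKv (hFN t ρ hρ htt) (hFN t' ρ' hρ' htt')
    obtain ⟨c1, c2⟩ := hFBreg t ρ hρ ht htt
    obtain ⟨c1', c2'⟩ := hFBreg t' ρ' hρ' ht' htt'
    obtain ⟨-, c3'⟩ := hρ1 _ ρ' c1' hρ'
    set y := FB Q v t ρ
    set y' := FB Q v t' ρ'
    obtain ⟨d1, d2⟩ := hD ρ hρ b1
    obtain ⟨d1', d2'⟩ := hD ρ' hρ' b1'
    obtain ⟨a1, a2⟩ := hA ρ ρ' hρ b1 hρ' b1'
    obtain ⟨e1, e2⟩ := hE0 ρ' hρ' b1'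
    have hq1 : 0 < 1 - DA κ ℓ ρ := by linarith
    have hq2 : 0 < 1 - DA κ ℓ ρ' := by linarith
    have e : FA κ ℓ y ρ - FA κ ℓ y' ρ' = ((y - y') + (ℓ ρ * DA κ ℓ ρ - ℓ ρ' * DA κ ℓ ρ')) / (1 - DA κ ℓ ρ)
      + (y' + ℓ ρ' * DA κ ℓ ρ') * (DA κ ℓ ρ - DA κ ℓ ρ') / ((1 - DA κ ℓ ρ) * (1 - DA κ ℓ ρ')) := by
      unfold FA; field_simp; ring
    have p1 : |((y - y') + (ℓ ρ * DA κ ℓ ρ - ℓ ρ' * DA κ ℓ ρ')) / (1 - DA κ ℓ ρ)| ≤ 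
        (|y - y'| + KA * |ρ - ρ'|) / (1/2) := by
      rw [abs_div, abs_of_pos hq1]
      gcongr
      · exact (abs_add_le _ _).trans (by gcongr)
      · linarith
    have p2 : |(y' + ℓ ρ' * DA κ ℓ ρ') * (DA κ ℓ ρ - DA κ ℓ ρ') / ((1 - DA κ ℓ ρ) * (1 - DA κ ℓ ρ'))| ≤ 
        2 * (KA * |ρ - ρ'|) / ((1/2) * (1/2)) := by
      rw [abs_div, abs_mul, abs_of_pos (mul_pos hq1 hq2)]
      gcongr
      · rw [abs_le] at c3' ⊢; constructor <;> linarith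
      · linarith
      · linarith
    have p3 := abs_nonneg (ρ - ρ')
    have p4 := abs_nonneg (t - t')
    have q1 : 0 ≤ c * Kv := by positivity
    have hfin : |FA κ ℓ y ρ - FA κ ℓ y' ρ'| ≤ (12 * (1 + c*Kv + c + KA)) * (|t - t'| + |ρ - ρ'|) := by
      rw [e]
      refine (abs_add_le _ _).trans ?_
      have z1 := mul_nonneg hKA p3
      have z2 := mul_nonneg hKA p4
      have z3 := mul_nonneg q1 p3
      have z4 := mul_nonneg q1 p4
      have z5 := mul_nonneg hc.le p3
      have z6 := mul_nonneg hc.le p4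
      refine (add_le_add p1 p2).trans ?_
      exact fin_aux L p3 p4 z1 z2 z3 z4 z5 z6
    refine hfin.trans ?_
    gcongr
    exact le_max_right _ _
  · intro m s ρ s' ρ' hm hρ hs hρ' hs' hms hms'
    obtain ⟨b1, b2⟩ := hρ1 s ρ hs hρ
    obtain ⟨b1', b2'⟩ := hρ1 s' ρ' hs' hρ'
    have hMpos : 0 < 2*c+4*KA+1 := by positivity
    have L := S.HB_lip (m := m / (2*c+4*KA+1)) (s := HA κ ℓ s ρ) (s' := HA κ ℓ s' ρ') (ρ := ρ) (ρ' := ρ')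
      (by positivity)
      (by rw [div_le_iff₀ hMpos]; have := hN s ρ hρ hs; linarith)
      (by rw [div_le_iff₀ hMpos]; have := hN s' ρ' hρ' hs'; linarith)
    obtain ⟨d1, d2⟩ := hD ρ hρ b1
    obtain ⟨a1, a2⟩ := hA ρ ρ' hρ b1 hρ' b1'
    have LA : |HA κ ℓ s ρ - HA κ ℓ s' ρ'| ≤ |s - s'| + 2 * KA * |ρ - ρ'| := by
      have e : HA κ ℓ s ρ - HA κ ℓ s' ρ' = (s - s') * (1 - DA κ ℓ ρ) - s' * (DA κ ℓ ρ - DA κ ℓ ρ')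
        - (ℓ ρ * DA κ ℓ ρ - ℓ ρ' * DA κ ℓ ρ') := by unfold HA; ring
      rw [e]
      have x1 : |(s - s') * (1 - DA κ ℓ ρ)| ≤ |s - s'| * 1 := by
        rw [abs_mul, abs_of_nonneg (by linarith : 0 ≤ 1 - DA κ ℓ ρ)]; gcongr; linarith
      have x2 : |s' * (DA κ ℓ ρ - DA κ ℓ ρ')| ≤ 1 * (KA * |ρ - ρ'|) := by
        rw [abs_mul]; gcongr
      have x3 := abs_sub ((s - s') * (1 - DA κ ℓ ρ) - s' * (DA κ ℓ ρ - DA κ ℓ ρ')) (ℓ ρ * DA κ ℓ ρ - ℓ ρ' * DA κ ℓ ρ')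
      have x4 := abs_sub ((s - s') * (1 - DA κ ℓ ρ)) (s' * (DA κ ℓ ρ - DA κ ℓ ρ'))
      linarith
    have hQ0 : 0 ≤ Q (m / (2*c+4*KA+1)) := by
      have := S.one_le (m / (2*c+4*KA+1)) (by positivity); linarith
    simp only
    calc _ ≤ _ := L
      _ ≤ Q (m / (2*c+4*KA+1)) * ((2 + c + 4 * KA) * (|s - s'| + |ρ - ρ'|)) := by
        gcongr
        have p3 := abs_nonneg (ρ - ρ')
        have p4 := abs_nonneg (s - s')
        have z2 := mul_nonneg hKA p4
        have z6 := mul_nonneg hc.le p4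
        linarith
      _ = (2 + c + 4 * KA) * Q (m / (2*c+4*KA+1)) * (|s - s'| + |ρ - ρ'|) := by ring
      _ ≤ _ := by gcongr; exact le_max_left _ _


lemma log_int {γ b r1 : ℝ} (hγ : 1 < γ) (hb : 0 < b) (hr1 : r1 < 1) :
    IntegrableOn (fun y : ℝ => y⁻¹ * (1 - Real.log (y/b)) ^ (-γ)) (Ioc 0 (b * r1)) volume := by
  have hpos : ∀ y, 0 < y → y ≤ b * r1 → 1 ≤ 1 - Real.log (y/b) := by
    intro y hy hy2
    apply one_sub_log_pos (by positivity)
    rw [div_le_one hb]; nlinarith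
  have hd : ∀ x ∈ Ioc 0 (b*r1), HasDerivAt (fun y : ℝ => (1 - Real.log (y/b)) ^ (1-γ) / (γ - 1))
      (x⁻¹ * (1 - Real.log (x/b)) ^ (-γ)) x := by
    intro x hx
    have h1 := hpos x hx.1 hx.2
    have hx0 : 0 < x := hx.1
    have h2 : HasDerivAt (fun y : ℝ => 1 - Real.log (y/b)) (-((1/b) / (x/b))) x :=
      (((hasDerivAt_id x).div_const b).log (by simp only [id]; positivity)).const_sub 1
    have h3 := (h2.rpow_const (p := 1 - γ) (Or.inl (by linarith))).div_const (γ - 1)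
    have hγ' : γ - 1 ≠ 0 := by linarith
    have e : x⁻¹ * (1 - Real.log (x/b)) ^ (-γ) =
        (-(1 / b / (x / b)) * (1 - γ) * (1 - Real.log (x / b)) ^ (1 - γ - 1) / (γ - 1)) := by
      have : 1 - γ - 1 = -γ := by ring
      rw [this]
      field_simp; ring
    rw [e]; exact h3
  refine intervalIntegral.integrableOn_deriv_of_nonneg 
    (g := fun y => if y ≤ 0 then 0 else (1 - Real.log (y/b)) ^ (1-γ) / (γ - 1)) ?_ ?_ ?_
  · intro x hx
    rcases hx.1.eq_or_lt with h | h
    · rw [← h]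
      have T : Tendsto (fun y : ℝ => (1 - Real.log (y/b)) ^ (1-γ) / (γ - 1)) (𝓝[>] 0) (𝓝 0) := by
        have h1 : Tendsto (fun y : ℝ => y / b) (𝓝[>] 0) (𝓝[>] 0) := by
          apply tendsto_nhdsWithin_iff.2
          constructor
          · have : Tendsto (fun y : ℝ => y / b) (𝓝 0) (𝓝 (0/b)) := (continuous_id.div_const b).tendsto 0
            rw [zero_div] at this
            exact this.mono_left nhdsWithin_le_nhds
          · filter_upwards [self_mem_nhdsWithin] with y hy
            have : 0 < y := hy
            show 0 < y / b
            positivity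
        have h2 := Real.tendsto_log_nhdsGT_zero.comp h1
        have h3 : Tendsto (fun y : ℝ => 1 - Real.log (y/b)) (𝓝[>] 0) atTop := by
          simpa [sub_eq_add_neg] using tendsto_atTop_add_const_left _ (1:ℝ) (tendsto_neg_atBot_atTop.comp h2)
        have h4 := (tendsto_rpow_neg_atTop (sub_pos.2 hγ)).comp h3
        have h5 := h4.div_const (γ - 1)
        simpa [neg_sub] using h5
      have e : (if (0:ℝ) ≤ 0 then 0 else (1 - Real.log (0/b)) ^ (1-γ) / (γ - 1)) = 0 := by simp
      unfold ContinuousWithinAt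
      simp only [le_refl, if_true]
      have h6 : Icc 0 (b*r1) ⊆ insert 0 (Ioi 0) := by
        intro y hy; rcases hy.1.eq_or_lt with h | h
        · left; exact h.symm
        · right; exact h
      refine Tendsto.mono_left ?_ (nhdsWithin_mono _ h6)
      rw [nhdsWithin_insert, tendsto_sup]
      constructor
      · have := tendsto_pure_nhds (fun y => if y ≤ 0 then 0 else (1 - Real.log (y/b)) ^ (1-γ) / (γ - 1)) (0:ℝ)
        simpa using this
      · refine T.congr' ?_
        filter_upwards [self_mem_nhdsWithin] with y hy
        rw [if_neg (not_le.2 hy)]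
    · refine ContinuousAt.continuousWithinAt ?_
      refine (hd x ⟨h, hx.2⟩).continuousAt.congr ?_
      filter_upwards [lt_mem_nhds h] with y hy
      rw [if_neg (not_le.2 hy)]
  · intro x hx
    refine (hd x ⟨hx.1, hx.2.le⟩).congr_of_eventuallyEq ?_
    filter_upwards [lt_mem_nhds hx.1] with y hy
    rw [if_neg (not_le.2 hy)]
  · intro x hx
    have h1 := hpos x hx.1 hx.2.le
    have := hx.1
    positivity

lemma QF_int {n : ℕ} (hn : 1 ≤ n) {α r1 b : ℝ} (hα : 0 < α) (hαn : α < n) (h1 : 0 < r1) (h1' : r1 < 1) (hb : 0 < b) :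
    IntegrableOn (fun z : Euc n => QF α r1 (‖z‖ / b) ^ (n:ℝ)) (ball 0 2) volume := by
  have hτ := tauF_pos (α := α) h1 h1'.le
  have : Nonempty (Fin n) := ⟨⟨0, hn⟩⟩
  have : Nontrivial (Euc n) := inferInstance
  rw [← integrable_indicator_iff measurableSet_ball]
  have e : (ball (0 : Euc n) 2).indicator (fun z : Euc n => QF α r1 (‖z‖ / b) ^ (n:ℝ)) = 
      fun z => (Iio (2:ℝ)).indicator (fun r => QF α r1 (r / b) ^ (n:ℝ)) ‖z‖ := by
    ext z
    by_cases hz : ‖z‖ < 2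
    · rw [indicator_of_mem (by simpa using hz), indicator_of_mem (by exact hz)]
    · rw [indicator_of_notMem (by simpa using hz), indicator_of_notMem (by exact hz)]
  rw [e, integrable_fun_norm_addHaar, finrank_euclideanSpace_fin]
  have hsub : Ioi (0:ℝ) ⊆ Ioc 0 (b * r1) ∪ Ioi (b * r1) := by
    intro y hy
    rcases le_or_gt y (b*r1) with h | h
    · exact Or.inl ⟨hy, h⟩
    · exact Or.inr h
  refine IntegrableOn.mono_set (IntegrableOn.union ?_ ?_) hsub
  · have hI := (log_int (γ := n/α) (b := b) (r1 := r1) (by rw [lt_div_iff₀ hα]; linarith) hb h1').const_mul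
      (b^n / (tauF α r1 / r1)^n)
    have hI2 : IntegrableOn (fun y => (Iio (2:ℝ)).indicator 
        (fun y => (b^n / (tauF α r1 / r1)^n) * (y⁻¹ * (1 - Real.log (y/b)) ^ (-((n:ℝ)/α)))) y) (Ioc 0 (b*r1)) volume := 
      hI.indicator measurableSet_Iio
    refine hI2.congr_fun ?_ measurableSet_Ioc
    intro y hy
    have hy0 : 0 < y := hy.1
    simp only
    by_cases h2 : y < 2
    · rw [indicator_of_mem (by exact h2), indicator_of_mem (by exact h2)]
      have hyb : y / b ≤ r1 := by rw [div_le_iff₀ hb]; linarith [hy.2]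
      rw [QF_le hyb]
      have hte := tauF_pos_eq (α := α) (by positivity : 0 < y / b)
      have hL := one_sub_log_pos (by positivity : 0 < y / b) (hyb.trans h1'.le)
      have e1 : ((1 - Real.log (y/b)) ^ (-(1/α))) ^ n = (1 - Real.log (y/b)) ^ (-((n:ℝ)/α)) := by
        rw [← Real.rpow_natCast, ← Real.rpow_mul (by linarith)]
        congr 1; ring
      rw [← hte] at e1
      rw [Real.rpow_natCast, ← e1, smul_eq_mul, div_pow (tauF α (y/b))]
      generalize tauF α (y/b) = X
      clear e1 hI hI2 e hte
      obtain ⟨k, rfl⟩ : ∃ k, n = k + 1 := ⟨n - 1, by omega⟩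
      simp only [Nat.add_sub_cancel, mul_pow, div_pow]
      field_simp
      ring
    · rw [indicator_of_notMem (by exact h2), indicator_of_notMem (by exact h2)]; simp
  · have hI : IntegrableOn (fun y : ℝ => y^(n-1)) (Ioc (b*r1) 2) volume := 
      (ContinuousOn.integrableOn_Icc (by fun_prop)).mono_set Ioc_subset_Icc_self
    have hI2 : IntegrableOn ((Ioc (b*r1) 2).indicator (fun y : ℝ => y^(n-1))) (Ioi (b*r1)) volume :=
      (hI.integrable_indicator measurableSet_Ioc).integrableOn
    refine hI2.congr_fun_ae ?_
    have hne : ∀ᵐ y ∂(volume.restrict (Ioi (b*r1))), y ≠ (2:ℝ) := by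
      refine ae_restrict_of_ae ?_
      exact Measure.ae_ne volume 2
    filter_upwards [ae_restrict_mem measurableSet_Ioi, hne] with y hy hy2
    have hy1 : b * r1 < y := hy
    by_cases h2 : y < 2
    · rw [indicator_of_mem (show y ∈ Iio (2:ℝ) from h2), indicator_of_mem (show y ∈ Ioc (b*r1) 2 from ⟨hy1, h2.le⟩), QF_ge h1 h1'.le]
      · simp
      · rw [le_div_iff₀ hb]; linarith
    · rw [indicator_of_notMem (show y ∉ Iio (2:ℝ) from h2), indicator_of_notMem]
      · simp
      · rintro ⟨_, h⟩; exact h2 (lt_of_le_of_ne h hy2)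


def rho {n : ℕ} [NeZero n] (p : Euc n) : ℝ :=
  √(∑ i ∈ Finset.univ.erase (0 : Fin n), p i ^ 2)

def e0 (n : ℕ) [NeZero n] : Euc n := EuclideanSpace.single (0 : Fin n) (1:ℝ)

lemma rho_nonneg {n : ℕ} [NeZero n] (p : Euc n) : 0 ≤ rho p := Real.sqrt_nonneg _

lemma rho_sq {n : ℕ} [NeZero n] (p : Euc n) : ‖p‖^2 = p 0 ^ 2 + rho p ^ 2 := by
  rw [rho, Real.sq_sqrt (Finset.sum_nonneg fun i _ => sq_nonneg _), EuclideanSpace.norm_sq_eq,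
    ← Finset.add_sum_erase _ _ (Finset.mem_univ (0 : Fin n))]
  simp

lemma e0_norm {n : ℕ} [NeZero n] : ‖e0 n‖ = 1 := by simp [e0]

lemma e0_zero {n : ℕ} [NeZero n] : (e0 n) 0 = 1 := by simp [e0]

lemma rho_add {n : ℕ} [NeZero n] (p : Euc n) (a : ℝ) : rho (p + a • e0 n) = rho p := by
  unfold rho
  congr 1
  refine Finset.sum_congr rfl fun i hi => ?_
  have : i ≠ 0 := Finset.ne_of_mem_erase hi
  simp [e0, this]

lemma add_e0_zero {n : ℕ} [NeZero n] (p : Euc n) (a : ℝ) : (p + a • e0 n) 0 = p 0 + a := by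
  simp [e0]

lemma rho_eq_norm {n : ℕ} [NeZero n] (p : Euc n) : rho p = ‖p - p 0 • e0 n‖ := by
  have h := rho_sq (p - p 0 • e0 n)
  have h2 : (p - p 0 • e0 n) = p + (-(p 0)) • e0 n := by rw [neg_smul, sub_eq_add_neg]
  rw [h2, add_e0_zero, rho_add] at h
  rw [h2]
  have := rho_nonneg p
  rw [← abs_of_nonneg this, ← abs_of_nonneg (norm_nonneg (p + (-(p 0)) • e0 n)), ← sq_eq_sq_iff_abs_eq_abs]
  rw [h]; ring

lemma rho_le_norm {n : ℕ} [NeZero n] (p : Euc n) : rho p ≤ ‖p‖ := by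
  have := rho_sq p
  have h := rho_nonneg p
  apply le_of_sq_le_sq _ (norm_nonneg p)
  nlinarith [sq_nonneg (p 0)]

lemma rho_lip {n : ℕ} [NeZero n] (p q : Euc n) : |rho p - rho q| ≤ ‖p - q‖ := by
  rw [rho_eq_norm p, rho_eq_norm q]
  refine (abs_norm_sub_norm_le _ _).trans ?_
  have : p - p 0 • e0 n - (q - q 0 • e0 n) = (p - q) - (p - q) 0 • e0 n := by
    simp [sub_smul]; abel
  rw [this, ← rho_eq_norm]
  exact rho_le_norm _

lemma coord_lip {n : ℕ} [NeZero n] (p q : Euc n) : |p 0 - q 0| ≤ ‖p - q‖ := by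
  simpa using single_coord_norm (p - q) 0

lemma norm_le_coord {n : ℕ} [NeZero n] (p : Euc n) : ‖p‖ ≤ |p 0| + rho p := by
  have := rho_sq p
  have h := rho_nonneg p
  apply le_of_sq_le_sq _ (by positivity)
  nlinarith [sq_abs (p 0), mul_nonneg (abs_nonneg (p 0)) h]

lemma cusp_scalar {α t ρ : ℝ} (hα : 0 < α) (hρ : 0 ≤ ρ) (h1 : ρ ≤ 1) :
    (0 ≤ t ∧ ρ ≤ cuspFun α t) ↔ tauF α ρ ≤ t := by
  rcases hρ.eq_or_lt with rfl | hρ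
  · have : tauF α 0 = 0 := by simp [tauF]
    rw [this]
    exact ⟨fun h => h.1, fun h => ⟨h, cuspFun_nonneg _ _⟩⟩
  · have hp := tauF_pos (α := α) hρ h1
    have e := cuspFun_tauF hα hρ h1
    constructor
    · rintro ⟨a, b⟩
      by_contra! hh
      have := cuspFun_lt hα a hh
      linarith
    · intro h
      refine ⟨by linarith, ?_⟩
      rw [← e]; exact cuspFun_mono hα hp.le h

lemma ball_iff {n : ℕ} [NeZero n] (p : Euc n) : p ∈ ball (0 : Euc n) 1 ↔ p 0 ^ 2 + rho p ^ 2 < 1 := by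
  rw [mem_ball_zero_iff, ← rho_sq, sq_lt_one_iff_abs_lt_one, abs_norm]

lemma cuspBall_iff {n : ℕ} [NeZero n] {α : ℝ} (hα : 0 < α) (p : Euc n) :
    p ∈ cuspBall n (cuspFun α) ↔ (p 0 ^ 2 + rho p ^ 2 < 1 ∧ p 0 < tauF α (rho p)) := by
  have : p ∈ cuspBall n (cuspFun α) ↔ p ∈ ball (0 : Euc n) 1 ∧ ¬ (0 ≤ p 0 ∧ rho p ≤ cuspFun α (p 0)) := Iff.rfl
  rw [this, ball_iff]
  refine and_congr_right fun h => ?_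
  rw [cusp_scalar hα (rho_nonneg p) (by nlinarith [sq_nonneg (p 0)]), not_le]

lemma cuspFun_continuous {α : ℝ} (hα : 0 < α) : Continuous (cuspFun α) := by
  set C := (α * Real.exp 1 * (1 + 1/α) ^ (1 + 1/α))
  have hC : 0 ≤ C := by positivity
  have : LipschitzWith C.toNNReal (cuspFun α) := by
    apply LipschitzWith.of_le_add_mul
    intro x y
    rw [Real.coe_toNNReal _ hC]
    have e : ∀ x, cuspFun α x = cuspFun α (max x 0) := by
      intro x
      rcases le_total 0 x with h | h
      · rw [max_eq_left h]
      · rw [max_eq_right h, cuspFun, if_neg (not_lt.2 h), cuspFun_zero]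
    rw [e x, e y]
    have hd : 0 ≤ C * dist x y := by positivity
    rcases le_total x y with h | h
    · have := cuspFun_mono hα (le_max_right x 0) (max_le_max_right 0 h)
      linarith
    · have := cuspFun_lip hα (le_max_right y 0) (max_le_max_right 0 h)
      have h2 : max x 0 - max y 0 ≤ dist x y := by
        rw [Real.dist_eq]
        exact (le_abs_self _).trans (abs_max_sub_max_le_abs x y 0)
      have := mul_le_mul_of_nonneg_left h2 hC
      linarith
  exact this.continuous

lemma rho_continuous {n : ℕ} [NeZero n] : Continuous (rho (n := n)) := by
  unfold rho; fun_prop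

lemma cuspBall_isOpen {n : ℕ} [NeZero n] {α : ℝ} (hα : 0 < α) : IsOpen (cuspBall n (cuspFun α)) := by
  refine isOpen_ball.sdiff ?_
  have c0 : Continuous (fun p : Euc n => p 0) := by fun_prop
  exact (isClosed_le continuous_const c0).inter
    (isClosed_le rho_continuous ((cuspFun_continuous hα).comp c0))

def fib {n : ℕ} [NeZero n] (H : ℝ → ℝ → ℝ) (p : Euc n) : Euc n :=
  p + (H (p 0) (rho p) - p 0) • e0 n

lemma fib_zero {n : ℕ} [NeZero n] (H : ℝ → ℝ → ℝ) (p : Euc n) : (fib H p) 0 = H (p 0) (rho p) := by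
  rw [fib, add_e0_zero]; ring
lemma fib_rho {n : ℕ} [NeZero n] (H : ℝ → ℝ → ℝ) (p : Euc n) : rho (fib H p) = rho p := rho_add _ _
lemma fib_fib {n : ℕ} [NeZero n] (H F : ℝ → ℝ → ℝ) (p : Euc n) (h : F (H (p 0) (rho p)) (rho p) = p 0) :
    fib F (fib H p) = p := by
  rw [fib, fib_zero, fib_rho, h, fib, add_assoc, ← add_smul]; simp

lemma fib_dist {n : ℕ} [NeZero n] (H : ℝ → ℝ → ℝ) (p q : Euc n) {L : ℝ} (hL : 0 ≤ L)
    (h : |H (p 0) (rho p) - H (q 0) (rho q)| ≤ L * (|p 0 - q 0| + |rho p - rho q|)) :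
    ‖fib H p - fib H q‖ ≤ (2 + 2 * L) * ‖p - q‖ := by
  have e : fib H p - fib H q = (p - q) + ((H (p 0) (rho p) - H (q 0) (rho q)) - (p 0 - q 0)) • e0 n := by
    unfold fib; module
  rw [e]
  refine (norm_add_le _ _).trans ?_
  rw [norm_smul, e0_norm, mul_one, Real.norm_eq_abs]
  have h1 := abs_sub (H (p 0) (rho p) - H (q 0) (rho q)) (p 0 - q 0)
  have h2 := coord_lip p q
  have h3 := rho_lip p q
  have h4 : L * (|p 0 - q 0| + |rho p - rho q|) ≤ L * (‖p - q‖ + ‖p - q‖) := by gcongr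
  linarith

theorem bwd {n : ℕ} [NeZero n] (α : ℝ) (hα : 0 < α) (hαn : α < n) :
    (∃ (h f : Euc n → Euc n) (Dh Df : Euc n → Matrix (Fin n) (Fin n) ℝ),
        IsHomeoOn h f (unitBall n) (cuspBall n (cuspFun α)) ∧
        MemSobolev (n : ℝ) (unitBall n) h Dh ∧
        MemSobolev (n : ℝ) (cuspBall n (cuspFun α)) f Df) := by
  have hn : 1 ≤ n := Nat.one_le_iff_ne_zero.2 (NeZero.ne n)
  obtain ⟨H, F, K, M, r1, hK, hM, hr1, hr1', hH, hF, hFl, hHl, hQ1, hQa⟩ := scalar_data hα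
  have hopen := cuspBall_isOpen (n := n) hα
  have hHm : ∀ p ∈ ball (0 : Euc n) 1, fib H p ∈ cuspBall n (cuspFun α) ∧ fib F (fib H p) = p := by
    intro p hp
    rw [ball_iff] at hp
    obtain ⟨a, b, c⟩ := hH _ _ (rho_nonneg p) hp
    refine ⟨?_, fib_fib H F p c⟩
    rw [cuspBall_iff hα, fib_zero, fib_rho]; exact ⟨a, b⟩
  have hFm : ∀ p ∈ cuspBall n (cuspFun α), fib F p ∈ ball (0 : Euc n) 1 ∧ fib H (fib F p) = p := by
    intro p hp
    rw [cuspBall_iff hα] at hp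
    obtain ⟨a, c⟩ := hF _ _ (rho_nonneg p) hp.1 hp.2
    refine ⟨?_, fib_fib F H p c⟩
    rw [ball_iff, fib_zero, fib_rho]; exact a
  have lipF : LipschitzOnWith (2 + 2 * K).toNNReal (fib F) (cuspBall n (cuspFun α)) := by
    apply LipschitzOnWith.of_dist_le_mul
    intro p hp q hq
    rw [cuspBall_iff hα] at hp hq
    rw [dist_eq_norm, dist_eq_norm, Real.coe_toNNReal _ (by positivity)]
    exact fib_dist F p q hK (hFl _ _ _ _ (rho_nonneg p) hp.1 hp.2 (rho_nonneg q) hq.1 hq.2)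
  set V : Euc n → ℝ := fun z => (2 + 2 * K) * QF α r1 (‖z - e0 n‖ / (2 * M)) with hV
  have hne : ∀ z ∈ ball (0 : Euc n) 1, 0 < ‖z - e0 n‖ := by
    intro z hz
    rw [norm_pos_iff, sub_ne_zero]
    rintro rfl
    rw [mem_ball_zero_iff, e0_norm] at hz
    exact lt_irrefl _ hz
  have hlow : ∀ z : Euc n, ‖z - e0 n‖ ≤ |z 0 - 1| + rho z := by
    intro z
    have h1 := norm_le_coord (z - e0 n)
    have h2 : z - e0 n = z + (-1 : ℝ) • e0 n := by simp [sub_eq_add_neg]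
    rw [h2, add_e0_zero, rho_add] at h1
    rw [h2]; simpa [sub_eq_add_neg] using h1
  have lipH : ∀ z ∈ ball (0 : Euc n) 1, ∃ U ∈ 𝓝 z, LipschitzOnWith (V z).toNNReal (fib H) U := by
    intro z hz
    have hz0 := hne z hz
    refine ⟨ball 0 1 ∩ {w | ‖z - e0 n‖ / 2 < ‖w - e0 n‖}, ?_, ?_⟩
    · refine inter_mem (isOpen_ball.mem_nhds hz) ?_
      refine (isOpen_lt continuous_const (by fun_prop)).mem_nhds ?_
      show ‖z - e0 n‖ / 2 < ‖z - e0 n‖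
      linarith
    · apply LipschitzOnWith.of_dist_le_mul
      intro p hp q hq
      have hq1 : 1 ≤ QF α r1 (‖z - e0 n‖ / (2 * M)) := hQ1 _ (by positivity)
      have hV0 : 0 ≤ V z := by rw [hV]; positivity
      rw [dist_eq_norm, dist_eq_norm, Real.coe_toNNReal _ hV0]
      have hp1 := hp.1
      have hq1' := hq.1
      rw [ball_iff] at hp1 hq1'
      have hp2 : ‖z - e0 n‖ / 2 < ‖p - e0 n‖ := hp.2
      have hq2 : ‖z - e0 n‖ / 2 < ‖q - e0 n‖ := hq.2
      have L := hHl (‖z - e0 n‖ / 2) _ _ _ _ (by positivity) (rho_nonneg p) hp1 (rho_nonneg q) hq1'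
        (hp2.le.trans (hlow p)) (hq2.le.trans (hlow q))
      rw [div_div] at L
      have := fib_dist H p q (by positivity) L
      refine this.trans ?_
      gcongr
      rw [hV]; simp only
      nlinarith
  have contH : ContinuousOn (fib H) (ball (0 : Euc n) 1) := by
    intro z hz
    obtain ⟨U, hU, hl⟩ := lipH z hz
    exact (hl.continuousOn.continuousAt hU).continuousWithinAt
  have hVint : IntegrableOn (fun x => V x ^ (n:ℝ)) (ball (0 : Euc n) 1) volume := by
    have h1 := QF_int hn hα hαn hr1 hr1' (by positivity : 0 < 2 * M)
    rw [← integrable_indicator_iff measurableSet_ball] at h1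
    have h2 := (h1.comp_sub_right (e0 n)).const_mul ((2 + 2 * K) ^ (n:ℝ))
    refine (h2.integrableOn (s := ball (0 : Euc n) 1)).congr_fun ?_ measurableSet_ball
    intro z hz
    have hz0 := hne z hz
    have hq1 : 1 ≤ QF α r1 (‖z - e0 n‖ / (2 * M)) := hQ1 _ (by positivity)
    have hmem : z - e0 n ∈ ball (0 : Euc n) 2 := by
      rw [mem_ball_zero_iff] at hz ⊢
      have := norm_sub_le z (e0 n)
      rw [e0_norm] at this; linarith
    simp only [hV]
    rw [indicator_of_mem hmem, Real.mul_rpow (by positivity) (by positivity)]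
  obtain ⟨Dh, hDh⟩ := sobolev_of_locLip (ball (0 : Euc n) 1) isOpen_ball (fib H) V hVint (by
    intro z hz
    have hz0 := hne z hz
    have hq1 : 1 ≤ QF α r1 (‖z - e0 n‖ / (2 * M)) := hQ1 _ (by positivity)
    rw [hV]; positivity) lipH
  have hfin : volume (cuspBall n (cuspFun α)) < ⊤ :=
    (measure_mono (sdiff_subset)).trans_lt (measure_ball_lt_top (x := (0 : Euc n)) (r := 1))
  obtain ⟨Df, hDf⟩ := sobolev_of_locLip (cuspBall n (cuspFun α)) hopen (fib F) (fun _ => 2 + 2 * K)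
    (integrableOn_const hfin.ne) (fun z _ => by positivity) (fun z hz => ⟨_, hopen.mem_nhds hz, lipF⟩)
  exact ⟨fib H, fib F, Dh, Df, ⟨fun p hp => (hHm p hp).1, fun p hp => (hFm p hp).1,
    fun p hp => (hHm p hp).2, fun p hp => (hFm p hp).2, contH, lipF.continuousOn⟩, hDh, hDf⟩


theorem jensen_pow {X : Type*} [MeasurableSpace X] (μ : Measure X) (f : X → ℝ≥0∞)
    (hf : AEMeasurable f μ) (m : ℕ) (hm : 1 ≤ m) :
    (∫⁻ x, f x ∂μ) ^ (m + 1) ≤ μ univ ^ m * ∫⁻ x, f x ^ (m + 1) ∂μ := by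
  have hm0 : (0:ℝ) < m := by exact_mod_cast hm
  have hc : Real.HolderConjugate ((m:ℝ) + 1) (((m:ℝ) + 1) / m) := by
    rw [Real.holderConjugate_iff]
    constructor
    · linarith
    · field_simp; ring
  have h := ENNReal.lintegral_mul_le_Lp_mul_Lq μ hc hf (aemeasurable_const (b := (1:ℝ≥0∞)))
  simp only [Pi.mul_apply, mul_one, ENNReal.one_rpow, lintegral_one] at h
  calc (∫⁻ x, f x ∂μ) ^ (m + 1)
      ≤ ((∫⁻ a, f a ^ ((m:ℝ) + 1) ∂μ) ^ (1 / ((m:ℝ) + 1)) * μ univ ^ (1 / (((m:ℝ) + 1) / m))) ^ (m+1) := by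
        gcongr
    _ = _ := by
        rw [mul_pow, mul_comm, ← ENNReal.rpow_natCast, ← ENNReal.rpow_mul,
          ← ENNReal.rpow_natCast (_ ^ _), ← ENNReal.rpow_mul, ← ENNReal.rpow_natCast (μ univ)]
        have e1 : 1 / (((m:ℝ) + 1) / m) * ((m+1 : ℕ):ℝ) = m := by push_cast; field_simp
        have e2 : 1 / ((m:ℝ) + 1) * ((m+1 : ℕ):ℝ) = 1 := by push_cast; field_simp
        rw [e1, e2, ENNReal.rpow_one]
        congr 1
        refine lintegral_congr fun x => ?_
        rw [← ENNReal.rpow_natCast]; push_cast; rfl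

theorem path_bound {E : Type*} [NormedAddCommGroup E] [NormedSpace ℝ E]
    (φ : E → ℝ) (hφ : ContDiff ℝ 1 φ) (γ : ℝ → E) (L : ℝ≥0) (hγ : LipschitzWith L γ) :
    ENNReal.ofReal |φ (γ 1) - φ (γ 0)| ≤ L * ∫⁻ s in Ioo (0:ℝ) 1, ‖fderiv ℝ φ (γ s)‖ₑ := by
  have hcont : Continuous fun s => ‖fderiv ℝ φ (γ s)‖ :=
    ((hφ.continuous_fderiv one_ne_zero).comp hγ.continuous).norm
  -- Use the derivative bound with boundary function
  set D : ℝ → ℝ := fun s => L * ‖fderiv ℝ φ (γ s)‖ with hD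
  have hDc : Continuous D := continuous_const.mul hcont
  have hB : ∀ x, HasDerivAt (fun y => ∫ s in (0:ℝ)..y, D s) (D x) x := fun x =>
    intervalIntegral.integral_hasDerivAt_right
      (hDc.intervalIntegrable _ _) (hDc.stronglyMeasurableAtFilter _ _) hDc.continuousAt
  have key : |φ (γ 1) - φ (γ 0)| ≤ ∫ s in (0:ℝ)..1, D s := by
    refine image_le_of_liminf_slope_right_le_deriv_boundary
      (f := fun s => |φ (γ s) - φ (γ 0)|) (a := 0) (b := 1) (B' := D)
      (B := fun y => ∫ s in (0:ℝ)..y, D s)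
      ((hφ.continuous.comp hγ.continuous).sub continuous_const).abs.continuousOn
      (by simp) (fun x _ => (hB x).continuousAt.continuousWithinAt)
      (fun x _ => (hB x).hasDerivWithinAt) ?_ (by simp)
    intro s hs r hr
    apply Eventually.frequently
    have hd : HasFDerivAt φ (fderiv ℝ φ (γ s)) (γ s) :=
      (hφ.differentiable one_ne_zero _).hasFDerivAt
    obtain ⟨K, hK1, hK2⟩ : ∃ K : ℝ, ‖fderiv ℝ φ (γ s)‖ < K ∧ L * K < r := by
      rcases eq_or_lt_of_le (L.2 : (0:ℝ) ≤ L) with h0 | h0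
      · refine ⟨‖fderiv ℝ φ (γ s)‖ + 1, by linarith, ?_⟩
        have : (L:ℝ) = 0 := h0.symm
        simp only [hD, this, zero_mul] at hr ⊢
        exact hr
      · have h0' : (0:ℝ) < L := h0
        have : ‖fderiv ℝ φ (γ s)‖ < r / L := by
          rw [lt_div_iff₀ h0']; simpa [hD, mul_comm] using hr
        refine ⟨(‖fderiv ℝ φ (γ s)‖ + r / L) / 2, by linarith, ?_⟩
        calc (L:ℝ) * ((‖fderiv ℝ φ (γ s)‖ + r / L) / 2) < L * (r / L) :=
              mul_lt_mul_of_pos_left (by linarith) h0'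
          _ = r := by field_simp
    have hev : ∀ᶠ q in 𝓝 (γ s), ‖φ q - φ (γ s)‖ ≤ K * ‖q - γ s‖ := by
      have h1 := hd.isLittleO.def (sub_pos.2 hK1)
      filter_upwards [h1] with q hq
      have h2 := (fderiv ℝ φ (γ s)).le_opNorm (q - γ s)
      have h3 : ‖φ q - φ (γ s)‖ ≤ ‖φ q - φ (γ s) - fderiv ℝ φ (γ s) (q - γ s)‖ + ‖fderiv ℝ φ (γ s) (q - γ s)‖ := by
        have := norm_add_le (φ q - φ (γ s) - fderiv ℝ φ (γ s) (q - γ s)) (fderiv ℝ φ (γ s) (q - γ s))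
        simpa using this
      linarith
    have hev2 := (hγ.continuous.continuousAt (x := s)).eventually hev
    have hev3 : ∀ᶠ z in 𝓝[>] s, ‖φ (γ z) - φ (γ s)‖ ≤ K * ‖γ z - γ s‖ :=
      nhdsWithin_le_nhds hev2
    filter_upwards [hev3, self_mem_nhdsWithin] with z hz hz'
    have hzs : 0 < z - s := sub_pos.2 hz'
    rw [slope_def_field, div_lt_iff₀ hzs]
    have h1 := hγ.dist_le_mul z s
    rw [dist_eq_norm, Real.dist_eq, abs_of_pos hzs] at h1
    have hK0 : 0 ≤ K := (norm_nonneg _).trans hK1.le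
    have h4 : |φ (γ z) - φ (γ 0)| - |φ (γ s) - φ (γ 0)| ≤ ‖φ (γ z) - φ (γ s)‖ := by
      have := abs_sub_abs_le_abs_sub (φ (γ z) - φ (γ 0)) (φ (γ s) - φ (γ 0))
      simpa using this
    calc _ ≤ K * (L * (z - s)) := by
          refine h4.trans (hz.trans ?_); gcongr
      _ = (L * K) * (z - s) := by ring
      _ < _ := by gcongr
  calc ENNReal.ofReal |φ (γ 1) - φ (γ 0)| ≤ ENNReal.ofReal (∫ s in (0:ℝ)..1, D s) :=
        ENNReal.ofReal_le_ofReal key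
    _ = ∫⁻ s in Ioo (0:ℝ) 1, ENNReal.ofReal (D s) := by
        rw [intervalIntegral.integral_of_le zero_le_one, integral_Ioc_eq_integral_Ioo,
          ofReal_integral_eq_lintegral_ofReal]
        · exact (hDc.continuousOn.integrableOn_compact isCompact_Icc).mono_set Ioo_subset_Icc_self
        · exact Eventually.of_forall fun s => by positivity
    _ = ∫⁻ s in Ioo (0:ℝ) 1, L * ‖fderiv ℝ φ (γ s)‖ₑ := by
        refine lintegral_congr fun s => ?_
        rw [hD]
        simp only
        rw [ENNReal.ofReal_mul (NNReal.coe_nonneg L), ofReal_norm]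
        simp
    _ = _ := lintegral_const_mul' _ _ (by simp)


theorem lintegral_homothety {m : ℕ} (F : Euc m → ℝ≥0∞) (hF : Measurable F) (x : Euc m) (s : ℝ)
    (hs : 0 < s) : ∫⁻ z, F (x + s • (z - x)) = ENNReal.ofReal ((s ^ m)⁻¹) * ∫⁻ z, F z := by
  have h1 : ∫⁻ z, F (x + s • (z - x)) = ∫⁻ z, F (x + s • z) :=
    lintegral_sub_right_eq_self (fun z => F (x + s • z)) x
  have h2 : ∫⁻ z, F (x + s • z) = ∫⁻ z, F (x + z) ∂(Measure.map (s • ·) volume) := by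
    rw [lintegral_map (f := fun z => F (x + z)) (hF.comp (measurable_const_add x)) (measurable_const_smul s)]
  rw [h1, h2, Measure.map_addHaar_smul _ hs.ne', lintegral_smul_measure,
    lintegral_add_left_eq_self, abs_of_pos (by positivity)]
  simp

theorem lintegral_rpow_01 (m : ℕ) :
    ∫⁻ s in Ioo (0:ℝ) 1, ENNReal.ofReal (s ^ (-(m:ℝ) / (m + 1))) = ENNReal.ofReal (m + 1) := by
  have hr : (-1:ℝ) < -(m:ℝ) / (m + 1) := by
    rw [lt_div_iff₀ (by positivity)]; linarith
  have hi := intervalIntegral.intervalIntegrable_rpow' (a := 0) (b := 1) hr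
  rw [← ofReal_integral_eq_lintegral_ofReal]
  · rw [← integral_Ioc_eq_integral_Ioo, ← intervalIntegral.integral_of_le zero_le_one,
      integral_rpow (Or.inl hr)]
    congr 1
    have : -(m:ℝ) / (m + 1) + 1 = 1 / (m+1) := by field_simp; ring
    rw [this, Real.zero_rpow (by positivity), Real.one_rpow]
    simp
  · rw [intervalIntegrable_iff_integrableOn_Ioo_of_le zero_le_one] at hi
    exact hi
  · filter_upwards [self_mem_ae_restrict measurableSet_Ioo] with s hs
    exact Real.rpow_nonneg hs.1.le _

theorem morrey_half {E : Type*} [NormedAddCommGroup E] [NormedSpace ℝ E] (m : ℕ) (hm : 1 ≤ m)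
    (φ : E → ℝ) (hφ : ContDiff ℝ 1 φ) (Ψ : Euc m → E) (hΨ : LipschitzWith 2 Ψ)
    (a : Euc m) (ρ : ℝ) (hρ : 0 < ρ) (x : Euc m) (hx : x ∈ closedBall a ρ) :
    ∫⁻ z in closedBall a ρ, ENNReal.ofReal |φ (Ψ z) - φ (Ψ x)| ≤
      4 * ENNReal.ofReal ρ * ((m:ℝ≥0∞) + 1) * (volume (closedBall a ρ) ^ m *
        ∫⁻ z in closedBall a ρ, ‖fderiv ℝ φ (Ψ z)‖ₑ ^ (m + 1)) ^ (1 / ((m:ℝ) + 1)) := by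
  set B := closedBall a ρ with hB
  set v : Euc m → ℝ≥0∞ := fun z => ‖fderiv ℝ φ (Ψ z)‖ₑ with hv
  have hvc : Continuous v := by
    have := (hφ.continuous_fderiv one_ne_zero).comp hΨ.continuous
    exact this.enorm
  have hvm : Measurable v := hvc.measurable
  set V := volume B
  set I := ∫⁻ z in B, v z ^ (m + 1)
  have hBm : MeasurableSet B := isClosed_closedBall.measurableSet
  have step1 : ∀ z ∈ B, ENNReal.ofReal |φ (Ψ z) - φ (Ψ x)| ≤
      4 * ENNReal.ofReal ρ * ∫⁻ s in Ioo (0:ℝ) 1, v (x + s • (z - x)) := by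
    intro z hz
    have hl : LipschitzWith (2 * ‖z - x‖₊) (fun s : ℝ => Ψ (x + s • (z - x))) := by
      refine hΨ.comp (LipschitzWith.of_dist_le_mul fun s t => ?_)
      rw [dist_eq_norm, Real.dist_eq]
      have : x + s • (z - x) - (x + t • (z - x)) = (s - t) • (z - x) := by
        rw [sub_smul]; abel
      rw [this, norm_smul, Real.norm_eq_abs, mul_comm]
      simp
    have h := path_bound φ hφ _ _ hl
    simp only [one_smul, zero_smul, add_zero, add_sub_cancel] at h
    refine h.trans ?_
    gcongr
    have : ‖z - x‖ ≤ 2 * ρ := by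
      rw [← dist_eq_norm]
      have h1 := mem_closedBall.1 hz
      have h2 := mem_closedBall'.1 hx
      linarith [dist_triangle z a x]
    push_cast
    have h3 : ((‖z - x‖₊ : ℝ≥0) : ℝ≥0∞) ≤ 2 * ENNReal.ofReal ρ := by
      have h4 : (2:ℝ≥0∞) * ENNReal.ofReal ρ = ENNReal.ofReal (2 * ρ) := by
        rw [ENNReal.ofReal_mul (by norm_num)]; simp
      rw [h4, ← enorm_eq_nnnorm, ← ofReal_norm]
      exact ENNReal.ofReal_le_ofReal this
    calc (2:ℝ≥0∞) * ((‖z - x‖₊ : ℝ≥0) : ℝ≥0∞) ≤ 2 * (2 * ENNReal.ofReal ρ) := by gcongr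
      _ = _ := by rw [← mul_assoc]; norm_num
  have step2 : ∀ s ∈ Ioo (0:ℝ) 1, ∫⁻ z in B, v (x + s • (z - x)) ≤
      (V ^ m * I) ^ (1 / ((m:ℝ) + 1)) * ENNReal.ofReal (s ^ (-(m:ℝ) / (m + 1))) := by
    intro s hs
    have hmeas : Measurable fun z => v (x + s • (z - x)) := by
      refine hvm.comp ?_
      fun_prop
    have h1 := jensen_pow (volume.restrict B) (fun z => v (x + s • (z - x))) hmeas.aemeasurable m hm
    rw [Measure.restrict_apply_univ] at h1
    have h2 : ∫⁻ z in B, v (x + s • (z - x)) ^ (m + 1) ≤ ENNReal.ofReal ((s ^ m)⁻¹) * I := by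
      rw [← lintegral_indicator hBm, show I = _ from (lintegral_indicator hBm _).symm,
        ← lintegral_homothety _ ((hvm.pow_const _).indicator hBm) x s hs.1]
      refine lintegral_mono fun z => ?_
      by_cases hz : z ∈ B
      · have : x + s • (z - x) ∈ B := by
          have := (convex_closedBall a ρ).add_smul_sub_mem hx hz ⟨hs.1.le, hs.2.le⟩
          exact this
        rw [indicator_of_mem hz, indicator_of_mem this]
      · rw [indicator_of_notMem hz]; exact zero_le
    have h3 := h1.trans (mul_le_mul_right h2 (V ^ m))
    have h4 := ENNReal.rpow_le_rpow h3 (z := 1 / ((m:ℝ) + 1)) (by positivity)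
    have e1 : ((m + 1 : ℕ):ℝ) * (1 / ((m:ℝ) + 1)) = 1 := by push_cast; field_simp
    rw [← ENNReal.rpow_natCast, ← ENNReal.rpow_mul, e1, ENNReal.rpow_one] at h4
    refine h4.trans_eq ?_
    rw [mul_left_comm, mul_comm, ENNReal.mul_rpow_of_nonneg _ _ (by positivity)]
    congr 1
    rw [ENNReal.ofReal_rpow_of_pos (by have := hs.1; positivity)]
    congr 1
    rw [← Real.rpow_natCast, ← Real.rpow_neg hs.1.le, ← Real.rpow_mul hs.1.le]
    congr 1
    field_simp
  calc ∫⁻ z in B, ENNReal.ofReal |φ (Ψ z) - φ (Ψ x)|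
      ≤ ∫⁻ z in B, 4 * ENNReal.ofReal ρ * ∫⁻ s in Ioo (0:ℝ) 1, v (x + s • (z - x)) :=
        setLIntegral_mono' hBm step1
    _ = 4 * ENNReal.ofReal ρ * ∫⁻ z in B, ∫⁻ s in Ioo (0:ℝ) 1, v (x + s • (z - x)) :=
        lintegral_const_mul' _ _ (by finiteness)
    _ = 4 * ENNReal.ofReal ρ * ∫⁻ s in Ioo (0:ℝ) 1, ∫⁻ z in B, v (x + s • (z - x)) := by
        rw [lintegral_lintegral_swap]
        refine (hvm.comp ?_).aemeasurable
        fun_prop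
    _ ≤ 4 * ENNReal.ofReal ρ * ∫⁻ s in Ioo (0:ℝ) 1,
          (V ^ m * I) ^ (1 / ((m:ℝ) + 1)) * ENNReal.ofReal (s ^ (-(m:ℝ) / (m + 1))) := by
        gcongr 4 * ENNReal.ofReal ρ * ?_
        exact setLIntegral_mono' measurableSet_Ioo step2
    _ = _ := by
        rw [lintegral_const_mul _ (by fun_prop), lintegral_rpow_01]
        rw [ENNReal.ofReal_add (by positivity) (by norm_num)]
        simp only [ENNReal.ofReal_natCast, ENNReal.ofReal_one]
        ring

def morreyC (m : ℕ) : ℝ≥0∞ := (8 * ((m:ℝ≥0∞) + 1)) ^ (m + 1) / volume (ball (0 : Euc m) 1)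

theorem morreyC_ne_top (m : ℕ) : morreyC m ≠ ⊤ := by
  unfold morreyC
  refine ENNReal.div_ne_top (by finiteness) (measure_ball_pos _ _ one_pos).ne'

theorem morrey {E : Type*} [NormedAddCommGroup E] [NormedSpace ℝ E] (m : ℕ) (hm : 1 ≤ m)
    (φ : E → ℝ) (hφ : ContDiff ℝ 1 φ) (Ψ : Euc m → E) (hΨ : LipschitzWith 2 Ψ)
    (a : Euc m) (ρ : ℝ) (hρ : 0 < ρ) (x y : Euc m) (hx : x ∈ closedBall a ρ)
    (hy : y ∈ closedBall a ρ) :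
    ENNReal.ofReal |φ (Ψ x) - φ (Ψ y)| ^ (m + 1) ≤ morreyC m * ENNReal.ofReal ρ *
        ∫⁻ z in closedBall a ρ, ‖fderiv ℝ φ (Ψ z)‖ₑ ^ (m + 1) := by
  have h1 := morrey_half m hm φ hφ Ψ hΨ a ρ hρ x hx
  have h2 := morrey_half m hm φ hφ Ψ hΨ a ρ hρ y hy
  set B := closedBall a ρ with hB
  set I := ∫⁻ z in B, ‖fderiv ℝ φ (Ψ z)‖ₑ ^ (m + 1)
  set V := volume B with hV
  set ω := volume (ball (0 : Euc m) 1) with hω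
  have hω0 : ω ≠ 0 := (measure_ball_pos _ _ one_pos).ne'
  have hωt : ω ≠ ⊤ := measure_ball_lt_top.ne
  have hVe : V = ENNReal.ofReal ρ ^ m * ω := by
    rw [hV, hB, Measure.addHaar_closedBall _ _ hρ.le]
    simp [ENNReal.ofReal_pow hρ.le, hω]
  have hr0 : ENNReal.ofReal ρ ≠ 0 := by simpa using hρ
  have hV0 : V ≠ 0 := by rw [hVe]; exact mul_ne_zero (pow_ne_zero _ hr0) hω0
  have hVt : V ≠ ⊤ := by rw [hVe]; finiteness
  set G := ENNReal.ofReal |φ (Ψ x) - φ (Ψ y)| with hG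
  have hc : Continuous fun z => φ (Ψ z) := hφ.continuous.comp hΨ.continuous
  have h3 : V * G ≤ (8 * ENNReal.ofReal ρ * ((m:ℝ≥0∞) + 1)) * (V ^ m * I) ^ (1 / ((m:ℝ) + 1)) := by
    calc V * G = ∫⁻ z in B, G := by rw [setLIntegral_const, mul_comm]
      _ ≤ ∫⁻ z in B, (ENNReal.ofReal |φ (Ψ z) - φ (Ψ x)| + ENNReal.ofReal |φ (Ψ z) - φ (Ψ y)|) := by
          refine lintegral_mono fun z => ?_
          rw [hG, ← ENNReal.ofReal_add (abs_nonneg _) (abs_nonneg _)]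
          apply ENNReal.ofReal_le_ofReal
          rw [abs_sub_comm (φ (Ψ z)) (φ (Ψ x))]
          exact abs_sub_le _ _ _
      _ = _ := lintegral_add_left' (by
          exact (hc.sub continuous_const).abs.measurable.ennreal_ofReal.aemeasurable) _
      _ ≤ _ := add_le_add h1 h2
      _ = _ := by ring
  have h4 := pow_le_pow_left' h3 (m + 1)
  rw [mul_pow, mul_pow _ (_ ^ _), ← ENNReal.rpow_natCast ((V ^ m * I) ^ _), ← ENNReal.rpow_mul] at h4
  have e1 : (1 / ((m:ℝ) + 1)) * ((m + 1 : ℕ):ℝ)  = 1 := by push_cast; field_simp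
  rw [e1, ENNReal.rpow_one, pow_succ V, mul_assoc, mul_left_comm _ (V ^ m)] at h4
  have h5 := (ENNReal.mul_le_mul_iff_right (pow_ne_zero m hV0) (ENNReal.pow_ne_top hVt)).1 h4
  rw [hVe] at h5
  have h6 : ENNReal.ofReal ρ ^ m * (ω * G ^ (m+1)) ≤
      ENNReal.ofReal ρ ^ m * ((8 * ((m:ℝ≥0∞) + 1)) ^ (m+1) * ENNReal.ofReal ρ * I) := by
    calc _ = ENNReal.ofReal ρ ^ m * ω * G ^ (m+1) := by ring
      _ ≤ _ := h5
      _ = _ := by simp only [mul_pow]; ring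
  have h7 := (ENNReal.mul_le_mul_iff_right (pow_ne_zero m hr0) (by finiteness)).1 h6
  unfold morreyC
  rw [← hω]
  calc G ^ (m+1) = ω * G ^ (m+1) / ω := by
        rw [mul_comm, ENNReal.mul_div_cancel_right hω0 hωt]
    _ ≤ ((8 * ((m:ℝ≥0∞) + 1)) ^ (m+1) * ENNReal.ofReal ρ * I) / ω := by gcongr
    _ = _ := by rw [div_eq_mul_inv, div_eq_mul_inv]; ring


theorem opnorm_le_sum {n : ℕ} (L : Euc n →L[ℝ] ℝ) :
    ‖L‖ ≤ ∑ j, |L (EuclideanSpace.single j 1)| := by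
  refine ContinuousLinearMap.opNorm_le_bound _ (Finset.sum_nonneg fun _ _ => abs_nonneg _) fun x => ?_
  have hx : x = ∑ j, x j • (EuclideanSpace.single j (1:ℝ) : Euc n) := by
    ext i
    simp [Finset.sum_apply, Pi.single_apply]
  conv_lhs => rw [hx]
  rw [map_sum, Finset.sum_mul]
  refine (norm_sum_le _ _).trans (Finset.sum_le_sum fun j _ => ?_)
  rw [map_smul, norm_smul, mul_comm]
  exact mul_le_mul_of_nonneg_left (single_coord_norm x j) (norm_nonneg _)

/-- mollified gradient bound -/
theorem moll_bound {n : ℕ} (U : Set (Euc n)) (hU : IsOpen U) (g : Euc n → ℝ)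
    (d : Fin n → Euc n → ℝ)
    (hG : LocallyIntegrable (U.indicator g))
    (parts : ∀ φ : Euc n → ℝ, ContDiff ℝ ((⊤ : ℕ∞) : WithTop ℕ∞) φ → HasCompactSupport φ →
      tsupport φ ⊆ U → ∀ j : Fin n,
      ∫ x in U, g x * fderiv ℝ φ x (EuclideanSpace.single j 1) = - ∫ x in U, d j x * φ x)
    (w : Euc n → ℝ≥0∞) (hw : ∀ j, ∀ᵐ x ∂(volume.restrict U), ‖d j x‖ₑ ≤ w x)
    (φ : ContDiffBump (0 : Euc n)) (x : Euc n) (hx : closedBall x φ.rOut ⊆ U) :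
    ‖fderiv ℝ (φ.normed volume ⋆[ContinuousLinearMap.lsmul ℝ ℝ, volume] (U.indicator g)) x‖ₑ ≤
      n * ∫⁻ y, ENNReal.ofReal (φ.normed volume (x - y)) * w y := by
  set f := φ.normed volume with hf
  have hfc : HasCompactSupport f := φ.hasCompactSupport_normed
  have hf1 : ContDiff ℝ 1 f := φ.contDiff_normed
  have hd := hfc.hasFDerivAt_convolution_left (ContinuousLinearMap.lsmul ℝ ℝ) hf1 hG x
  rw [hd.fderiv]
  set L := (fderiv ℝ f ⋆[(ContinuousLinearMap.lsmul ℝ ℝ).precompL (Euc n), volume] U.indicator g) x with hL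
  have hψs : ContDiff ℝ ((⊤ : ℕ∞) : WithTop ℕ∞) fun y => f (x - y) :=
    (φ.contDiff_normed).comp (contDiff_const.sub contDiff_id)
  have hψc : HasCompactSupport fun y => f (x - y) := by
    have := hfc.comp_homeomorph (Homeomorph.subLeft x)
    exact this
  have hψt : tsupport (fun y => f (x - y)) ⊆ U := by
    refine Subset.trans ?_ hx
    refine closure_minimal ?_ isClosed_closedBall
    intro y hy
    have : x - y ∈ Function.support f := hy
    rw [hf, φ.support_normed_eq, mem_ball_zero_iff] at this
    rw [mem_closedBall, dist_comm, dist_eq_norm]; exact this.le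
  have key : ∀ j, L (EuclideanSpace.single j 1) = ∫ y in U, d j y * f (x - y) := by
    intro j
    have hintg := hfc.fderiv (𝕜 := ℝ) |>.convolutionExists_left
      ((ContinuousLinearMap.lsmul ℝ ℝ).precompL (Euc n)) (hf1.continuous_fderiv one_ne_zero) hG x
    have e1 : L (EuclideanSpace.single j 1) =
        ∫ t, fderiv ℝ f t (EuclideanSpace.single j 1) * U.indicator g (x - t) := by
      rw [hL, convolution_def, ContinuousLinearMap.integral_apply hintg]
      rfl
    rw [e1, ← integral_sub_left_eq_self (fun t => fderiv ℝ f t (EuclideanSpace.single j 1) * U.indicator g (x - t)) volume x]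
    have h2 := parts _ hψs hψc hψt j
    rw [← neg_eq_iff_eq_neg] at h2
    rw [← h2, ← integral_neg, ← integral_indicator hU.measurableSet]
    refine integral_congr_ae (Eventually.of_forall fun y => ?_)
    simp only [sub_sub_cancel]
    by_cases hy : y ∈ U
    · rw [indicator_of_mem hy, indicator_of_mem hy]
      have h3 : HasFDerivAt (fun y => f (x - y)) ((fderiv ℝ f (x - y)).comp (-ContinuousLinearMap.id ℝ (Euc n))) y := by
        have h4 : HasFDerivAt (fun y : Euc n => x - y) (-ContinuousLinearMap.id ℝ (Euc n)) y :=
          (hasFDerivAt_id y).const_sub x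
        exact ((hf1.differentiable one_ne_zero (x - y)).hasFDerivAt).comp y h4
      rw [h3.fderiv]
      simp [mul_comm]
    · rw [indicator_of_notMem hy, indicator_of_notMem hy, mul_zero]
  have hj : ∀ j, ENNReal.ofReal |L (EuclideanSpace.single j 1)| ≤
      ∫⁻ y, ENNReal.ofReal (f (x - y)) * w y := by
    intro j
    rw [key, ← Real.norm_eq_abs, ofReal_norm]
    calc ‖∫ y in U, d j y * f (x - y)‖ₑ ≤ ∫⁻ y in U, ‖d j y * f (x - y)‖ₑ :=
          enorm_integral_le_lintegral_enorm _
      _ ≤ ∫⁻ y in U, ENNReal.ofReal (f (x - y)) * w y := by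
          refine lintegral_mono_ae ?_
          filter_upwards [hw j] with y hy
          rw [enorm_mul, mul_comm, Real.enorm_of_nonneg (φ.nonneg_normed _)]
          gcongr
      _ ≤ _ := setLIntegral_le_lintegral _ _
  calc ‖L‖ₑ = ENNReal.ofReal ‖L‖ := (ofReal_norm _).symm
    _ ≤ ENNReal.ofReal (∑ j, |L (EuclideanSpace.single j 1)|) :=
        ENNReal.ofReal_le_ofReal (opnorm_le_sum L)
    _ = ∑ j, ENNReal.ofReal |L (EuclideanSpace.single j 1)| :=
        ENNReal.ofReal_sum_of_nonneg fun _ _ => abs_nonneg _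
    _ ≤ ∑ j : Fin n, ∫⁻ y, ENNReal.ofReal (f (x - y)) * w y := Finset.sum_le_sum fun j _ => hj j
    _ = _ := by simp

theorem lintegral_bump {n : ℕ} (φ : ContDiffBump (0 : Euc n)) :
    ∫⁻ y, ENNReal.ofReal (φ.normed volume y) = 1 := by
  rw [← ofReal_integral_eq_lintegral_ofReal φ.integrable_normed
    (Eventually.of_forall fun y => φ.nonneg_normed y), φ.integral_normed, ENNReal.ofReal_one]

theorem moll_jensen {m : ℕ} (hm : 1 ≤ m) {n : ℕ} (φ : ContDiffBump (0 : Euc n)) (w : Euc n → ℝ≥0∞)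
    (hw : Measurable w) (x : Euc n) :
    (∫⁻ y, ENNReal.ofReal (φ.normed volume (x - y)) * w y) ^ (m + 1) ≤
      ∫⁻ y, ENNReal.ofReal (φ.normed volume (x - y)) * w y ^ (m + 1) := by
  have hm1 : Measurable fun y => ENNReal.ofReal (φ.normed volume (x - y)) :=
    (φ.continuous_normed.measurable.comp (by fun_prop)).ennreal_ofReal
  have h := jensen_pow (volume.withDensity fun y => ENNReal.ofReal (φ.normed volume (x - y))) w
    hw.aemeasurable m hm
  rw [lintegral_withDensity_eq_lintegral_mul _ hm1 hw,
    lintegral_withDensity_eq_lintegral_mul _ hm1 (hw.pow_const _),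
    withDensity_apply _ MeasurableSet.univ, setLIntegral_univ,
    lintegral_sub_left_eq_self (fun y => ENNReal.ofReal (φ.normed volume y)), lintegral_bump, one_pow, one_mul] at h
  exact h

theorem moll_mass {n : ℕ} (φ : ContDiffBump (0 : Euc n)) (w : Euc n → ℝ≥0∞)
    (hw : Measurable w) :
    ∫⁻ x, ∫⁻ y, ENNReal.ofReal (φ.normed volume (x - y)) * w y = ∫⁻ y, w y := by
  have hm1 : Measurable fun p : Euc n × Euc n => ENNReal.ofReal (φ.normed volume (p.1 - p.2)) :=
    (φ.continuous_normed.measurable.comp (by fun_prop)).ennreal_ofReal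
  rw [lintegral_lintegral_swap (hm1.mul (hw.comp measurable_snd)).aemeasurable]
  refine lintegral_congr fun y => ?_
  have h1 : Measurable fun x : Euc n => ENNReal.ofReal (φ.normed volume (x - y)) :=
    (φ.continuous_normed.measurable.comp (by fun_prop)).ennreal_ofReal
  have h2 := lintegral_mul_const (μ := (volume : Measure (Euc n))) (w y) h1
  have h3 := lintegral_sub_right_eq_self (μ := (volume : Measure (Euc n)))
    (fun x => ENNReal.ofReal (φ.normed volume x)) y
  rw [h3, lintegral_bump, one_mul] at h2
  exact h2


/-- bump functions with radius tending to zero -/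
def bumpK (n : ℕ) (k : ℕ) : ContDiffBump (0 : Euc n) where
  rIn := 1 / (2 * (k + 1))
  rOut := 1 / (k + 1)
  rIn_pos := by positivity
  rIn_lt_rOut := by
    rw [div_lt_div_iff₀ (by positivity) (by positivity)]
    have : (0:ℝ) < (k:ℝ) + 1 := by positivity
    linarith

theorem bumpK_rOut (n k : ℕ) : (bumpK n k).rOut = 1 / ((k:ℝ) + 1) := rfl

theorem bumpK_tendsto (n : ℕ) : Tendsto (fun k => (bumpK n k).rOut) atTop (𝓝 0) := by
  simp only [bumpK_rOut]
  exact tendsto_one_div_add_atTop_nhds_zero_nat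

def sliceW {n : ℕ} (W : Euc n → ℝ≥0∞) (k : ℕ) (x : Euc n) : ℝ≥0∞ :=
  ∫⁻ y, ENNReal.ofReal ((bumpK n k).normed volume (x - y)) * W y

theorem sliceW_measurable {n : ℕ} (W : Euc n → ℝ≥0∞) (hW : Measurable W) (k : ℕ) :
    Measurable (sliceW W k) := by
  have hm1 : Measurable fun p : Euc n × Euc n =>
      ENNReal.ofReal ((bumpK n k).normed volume (p.1 - p.2)) :=
    ((bumpK n k).continuous_normed.measurable.comp (by fun_prop)).ennreal_ofReal
  exact Measurable.lintegral_prod_right' (hm1.mul (hW.comp measurable_snd))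

theorem slice_scalar {m : ℕ} (hm : 1 ≤ m) (U : Set (Euc (m+1))) (hU : IsOpen U)
    (g : Euc (m+1) → ℝ) (d : Fin (m+1) → Euc (m+1) → ℝ) (hgc : ContinuousOn g U)
    (M : ℝ) (hM : ∀ x ∈ U, |g x| ≤ M)
    (parts : ∀ φ : Euc (m+1) → ℝ, ContDiff ℝ ((⊤ : ℕ∞) : WithTop ℕ∞) φ → HasCompactSupport φ →
      tsupport φ ⊆ U → ∀ j : Fin (m+1),
      ∫ x in U, g x * fderiv ℝ φ x (EuclideanSpace.single j 1) = - ∫ x in U, d j x * φ x)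
    (w : Euc (m+1) → ℝ≥0∞) (hwm : Measurable w)
    (hw : ∀ j, ∀ᵐ x ∂(volume.restrict U), ‖d j x‖ₑ ≤ w x)
    (Ψ : Euc m → Euc (m+1)) (hΨ : LipschitzWith 2 Ψ)
    (a : Euc m) (ρ : ℝ) (hρ : 0 < ρ) (hB : ∀ z ∈ closedBall a ρ, Ψ z ∈ U)
    (x y : Euc m) (hx : x ∈ closedBall a ρ) (hy : y ∈ closedBall a ρ) :
    ENNReal.ofReal |g (Ψ x) - g (Ψ y)| ^ (m + 1) ≤ morreyC m * ((m:ℝ≥0∞) + 1) ^ (m + 1) *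
      ENNReal.ofReal ρ * liminf (fun k => ∫⁻ z, sliceW (fun p => w p ^ (m+1)) k (Ψ z)) atTop := by
  set G := U.indicator g with hG
  have hGm : AEStronglyMeasurable G volume :=
    (aestronglyMeasurable_indicator_iff hU.measurableSet).2
      (hgc.aestronglyMeasurable hU.measurableSet)
  have hGl : LocallyIntegrable G volume := by
    have hMx : ∀ x, ‖G x‖ ≤ |M| := by
      intro x
      by_cases h : x ∈ U
      · rw [hG, indicator_of_mem h]; exact (hM x h).trans (le_abs_self _)
      · rw [hG, indicator_of_notMem h]; simp
    refine (locallyIntegrable_const (|M|)).mono hGm (Eventually.of_forall fun x => ?_)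
    rw [Real.norm_eq_abs |M|, abs_abs]; exact hMx x
  set gk : ℕ → Euc (m+1) → ℝ := fun k =>
    (bumpK (m+1) k).normed volume ⋆[ContinuousLinearMap.lsmul ℝ ℝ, volume] G with hgk
  have hgk1 : ∀ k, ContDiff ℝ 1 (gk k) := fun k =>
    (bumpK (m+1) k).hasCompactSupport_normed.contDiff_convolution_left _
      (bumpK (m+1) k).contDiff_normed hGl
  have hlim : ∀ p ∈ U, Tendsto (fun k => gk k p) atTop (𝓝 (g p)) := by
    intro p hp
    have hcp : ContinuousAt G p := by
      refine (hgc.continuousAt (hU.mem_nhds hp)).congr ?_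
      filter_upwards [hU.mem_nhds hp] with q hq
      rw [hG, indicator_of_mem hq]
    have h := ContDiffBump.convolution_tendsto_right (μ := volume) (φ := fun k => bumpK (m+1) k)
      (l := atTop) (g := fun _ => G) (k := fun _ => p) (x₀ := p) (z₀ := G p) (bumpK_tendsto _)
      (Eventually.of_forall fun _ => hGm) (hcp.tendsto.comp tendsto_snd) tendsto_const_nhds
    have hGp : G p = g p := by rw [hG, indicator_of_mem hp]
    rw [hGp] at h
    exact h
  -- the thickening
  obtain ⟨ε, hε, hεU⟩ : ∃ ε > 0, ∀ z ∈ closedBall a ρ, closedBall (Ψ z) ε ⊆ U := by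
    have hK : IsCompact (Ψ '' closedBall a ρ) := (isCompact_closedBall a ρ).image hΨ.continuous
    obtain ⟨ε, hε, h⟩ := hK.exists_cthickening_subset_open hU (by rintro _ ⟨z, hz, rfl⟩; exact hB z hz)
    refine ⟨ε, hε, fun z hz => Subset.trans ?_ h⟩
    exact closedBall_subset_cthickening (mem_image_of_mem _ hz) ε
  have hev : ∀ᶠ k in atTop, (bumpK (m+1) k).rOut ≤ ε :=
    ((bumpK_tendsto (m+1)).eventually (gt_mem_nhds hε)).mono fun k hk => le_of_lt hk
  set c := morreyC m * ((m:ℝ≥0∞) + 1) ^ (m + 1) * ENNReal.ofReal ρ with hc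
  have hC0 : morreyC m ≠ 0 := by
    unfold morreyC
    refine (ENNReal.div_pos (by positivity) measure_ball_lt_top.ne).ne'
  have hc0 : c ≠ 0 := by
    refine mul_ne_zero (mul_ne_zero hC0 (by positivity)) (by simpa using hρ)
  have hct : c ≠ ⊤ := by
    have := morreyC_ne_top m
    finiteness
  have hk : ∀ᶠ k in atTop, c⁻¹ * ENNReal.ofReal |gk k (Ψ x) - gk k (Ψ y)| ^ (m + 1) ≤
      ∫⁻ z, sliceW (fun p => w p ^ (m+1)) k (Ψ z) := by
    filter_upwards [hev] with k hk
    have h1 := morrey m hm (gk k) (hgk1 k) Ψ hΨ a ρ hρ x y hx hy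
    have h2 : ∫⁻ z in closedBall a ρ, ‖fderiv ℝ (gk k) (Ψ z)‖ₑ ^ (m + 1) ≤
        ∫⁻ z in closedBall a ρ, ((m:ℝ≥0∞) + 1) ^ (m + 1) * sliceW (fun p => w p ^ (m+1)) k (Ψ z) := by
      refine setLIntegral_mono' isClosed_closedBall.measurableSet fun z hz => ?_
      have h3 := moll_bound U hU g d hGl parts w hw (bumpK (m+1) k) (Ψ z)
        ((closedBall_subset_closedBall hk).trans (hεU z hz))
      calc _ ≤ _ := pow_le_pow_left' h3 (m+1)
        _ ≤ _ := by
          rw [mul_pow]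
          push_cast
          gcongr
          exact moll_jensen hm _ w hwm _
    rw [lintegral_const_mul' _ _ (by finiteness)] at h2
    have h4 : ENNReal.ofReal |gk k (Ψ x) - gk k (Ψ y)| ^ (m + 1) ≤ c * ∫⁻ z, sliceW (fun p => w p ^ (m+1)) k (Ψ z) := by
      calc _ ≤ _ := h1
        _ ≤ morreyC m * ENNReal.ofReal ρ * (((m:ℝ≥0∞) + 1) ^ (m + 1) * ∫⁻ z, sliceW (fun p => w p ^ (m+1)) k (Ψ z)) := by
            gcongr
            exact h2.trans (by gcongr; exact Measure.restrict_le_self)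
        _ = _ := by rw [hc]; ring
    calc _ ≤ c⁻¹ * (c * ∫⁻ z, sliceW (fun p => w p ^ (m+1)) k (Ψ z)) := by gcongr
      _ = _ := by rw [← mul_assoc, ENNReal.inv_mul_cancel hc0 hct, one_mul]
  have ht : Tendsto (fun k => c⁻¹ * ENNReal.ofReal |gk k (Ψ x) - gk k (Ψ y)| ^ (m + 1)) atTop
      (𝓝 (c⁻¹ * ENNReal.ofReal |g (Ψ x) - g (Ψ y)| ^ (m + 1))) := by
    refine ENNReal.Tendsto.const_mul (ENNReal.Tendsto.pow ?_) (Or.inr (ENNReal.inv_ne_top.2 hc0))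
    exact ENNReal.tendsto_ofReal (((hlim _ (hB x hx)).sub (hlim _ (hB y hy))).abs)
  have hfin := liminf_le_liminf hk
  rw [ht.liminf_eq] at hfin
  calc _ = c * (c⁻¹ * ENNReal.ofReal |g (Ψ x) - g (Ψ y)| ^ (m + 1)) := by
        rw [← mul_assoc, ENNReal.mul_inv_cancel hc0 hct, one_mul]
    _ ≤ _ := by gcongr

def sliceC (m : ℕ) : ℝ≥0∞ :=
  ((m:ℝ≥0∞) + 1) ^ (m + 1) * (morreyC m * ((m:ℝ≥0∞) + 1) ^ (m + 1))

theorem sliceC_ne_top (m : ℕ) : sliceC m ≠ ⊤ := by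
  unfold sliceC
  have := morreyC_ne_top m
  finiteness

theorem norm_le_sum_coord {n : ℕ} (x : Euc n) : ‖x‖ ≤ ∑ i, |x i| := by
  have hx : x = ∑ j, x j • (EuclideanSpace.single j (1:ℝ) : Euc n) := by
    ext i
    simp [Finset.sum_apply, Pi.single_apply]
  conv_lhs => rw [hx]
  refine (norm_sum_le _ _).trans (Finset.sum_le_sum fun j _ => ?_)
  rw [norm_smul]
  simp

theorem slice {m : ℕ} (hm : 1 ≤ m) (U : Set (Euc (m+1))) (hU : IsOpen U)
    (g : Euc (m+1) → Euc (m+1)) (Dg : Euc (m+1) → Matrix (Fin (m+1)) (Fin (m+1)) ℝ)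
    (hgc : ContinuousOn g U) (M : ℝ) (hM : ∀ x ∈ U, ‖g x‖ ≤ M)
    (hS : MemSobolev ((m+1 : ℕ):ℝ) U g Dg)
    (Ψ : ℝ → Euc m → Euc (m+1)) (hΨ : ∀ r, LipschitzWith 2 (Ψ r))
    (hΨm : MeasurePreserving (fun p : ℝ × Euc m => Ψ p.1 p.2)) :
    ∃ A : ℝ → ℝ≥0∞, Measurable A ∧
      ∫⁻ r, A r ≤ ∫⁻ x in U, ENNReal.ofReal (opNorm (Dg x) ^ (m+1)) ∧
      ∀ r a ρ, 0 < ρ → (∀ z ∈ closedBall a ρ, Ψ r z ∈ U) →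
        ∀ x ∈ closedBall a ρ, ∀ y ∈ closedBall a ρ,
        ENNReal.ofReal ‖g (Ψ r x) - g (Ψ r y)‖ ^ (m+1) ≤ sliceC m * ENNReal.ofReal ρ * A r := by
  have hlp := hS.lp
  simp only [Real.rpow_natCast] at hlp
  have hae : AEMeasurable (fun x => ENNReal.ofReal (opNorm (Dg x) ^ (m+1))) (volume.restrict U) :=
    hlp.1.aemeasurable.ennreal_ofReal
  set W : Euc (m+1) → ℝ≥0∞ := U.indicator (hae.mk _) with hW
  have hWm : Measurable W := hae.measurable_mk.indicator hU.measurableSet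
  have hWae : ∀ᵐ x ∂(volume.restrict U), W x = ENNReal.ofReal (opNorm (Dg x) ^ (m+1)) := by
    filter_upwards [hae.ae_eq_mk, self_mem_ae_restrict hU.measurableSet] with x hx hxU
    rw [hW, indicator_of_mem hxU, ← hx]
  have hWint : ∫⁻ x, W x = ∫⁻ x in U, ENNReal.ofReal (opNorm (Dg x) ^ (m+1)) := by
    rw [hW, lintegral_indicator hU.measurableSet]
    exact lintegral_congr_ae hae.ae_eq_mk.symm
  set w : Euc (m+1) → ℝ≥0∞ := fun x => W x ^ (1 / ((m:ℝ) + 1)) with hw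
  have hwm : Measurable w := hWm.pow_const _
  have hww : (fun p => w p ^ (m+1)) = W := by
    funext p
    rw [hw]
    simp only
    rw [← ENNReal.rpow_natCast, ← ENNReal.rpow_mul]
    have e1 : (1 / ((m:ℝ) + 1)) * ((m + 1 : ℕ):ℝ)  = 1 := by push_cast; field_simp
    rw [e1, ENNReal.rpow_one]
  have hwd : ∀ i j, ∀ᵐ x ∂(volume.restrict U), ‖Dg x i j‖ₑ ≤ w x := by
    intro i j
    filter_upwards [hWae] with x hx
    rw [hw]
    simp only
    rw [hx, ENNReal.ofReal_pow (opNorm_nonneg _), ← ENNReal.rpow_natCast, ← ENNReal.rpow_mul]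
    have e1 : ((m + 1 : ℕ):ℝ) * (1 / ((m:ℝ) + 1)) = 1 := by push_cast; field_simp
    rw [e1, ENNReal.rpow_one, ← ofReal_norm]
    exact ENNReal.ofReal_le_ofReal (opNorm_entry _ i j)
  have hcm : ∀ k, Measurable fun p : ℝ × Euc m => sliceW W k (Ψ p.1 p.2) := fun k =>
    (sliceW_measurable W hWm k).comp hΨm.measurable
  have hGm : ∀ k, Measurable fun r => ∫⁻ z, sliceW W k (Ψ r z) := fun k =>
    Measurable.lintegral_prod_right' (hcm k)
  refine ⟨fun r => liminf (fun k => ∫⁻ z, sliceW W k (Ψ r z)) atTop,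
    Measurable.liminf hGm, ?_, ?_⟩
  · refine (lintegral_liminf_le hGm).trans ?_
    have : ∀ k, ∫⁻ r, ∫⁻ z, sliceW W k (Ψ r z) = ∫⁻ x in U, ENNReal.ofReal (opNorm (Dg x) ^ (m+1)) := by
      intro k
      have h1 := lintegral_prod (μ := (volume : Measure ℝ)) (ν := (volume : Measure (Euc m))) _ (hcm k).aemeasurable
      rw [← h1, ← hWint, ← moll_mass (bumpK (m+1) k) W hWm]
      exact hΨm.lintegral_comp (sliceW_measurable W hWm k)
    simp only [this]
    simp
  · intro r a ρ hρ hB x hx y hy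
    have hi : ∀ i, ENNReal.ofReal |g (Ψ r x) i - g (Ψ r y) i| ^ (m + 1) ≤
        morreyC m * ((m:ℝ≥0∞) + 1) ^ (m + 1) * ENNReal.ofReal ρ *
          liminf (fun k => ∫⁻ z, sliceW W k (Ψ r z)) atTop := by
      intro i
      have h1 := slice_scalar hm U hU (fun p => g p i) (fun j p => Dg p i j)
        (by
          have : Continuous fun q : Euc (m+1) => q i := by fun_prop
          exact this.comp_continuousOn hgc) M
        (fun p hp => (single_coord_norm _ i).trans (hM p hp))
        (fun φ h1 h2 h3 j => hS.parts φ h1 h2 h3 i j) w hwm (hwd i) (Ψ r) (hΨ r) a ρ hρ hB x y hx hy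
      rw [hww] at h1
      exact h1
    set K := morreyC m * ((m:ℝ≥0∞) + 1) ^ (m + 1) * ENNReal.ofReal ρ *
          liminf (fun k => ∫⁻ z, sliceW W k (Ψ r z)) atTop with hK
    have hi2 : ∀ i, ENNReal.ofReal |g (Ψ r x) i - g (Ψ r y) i| ≤ K ^ (1 / ((m:ℝ)+1)) := by
      intro i
      have h4 := ENNReal.rpow_le_rpow (hi i) (z := 1 / ((m:ℝ) + 1)) (by positivity)
      have e1 : ((m + 1 : ℕ):ℝ) * (1 / ((m:ℝ) + 1)) = 1 := by push_cast; field_simp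
      rwa [← ENNReal.rpow_natCast, ← ENNReal.rpow_mul, e1, ENNReal.rpow_one] at h4
    have h5 : ENNReal.ofReal ‖g (Ψ r x) - g (Ψ r y)‖ ≤ ((m:ℝ≥0∞)+1) * K ^ (1 / ((m:ℝ)+1)) := by
      calc _ ≤ ENNReal.ofReal (∑ i, |(g (Ψ r x) - g (Ψ r y)) i|) :=
            ENNReal.ofReal_le_ofReal (norm_le_sum_coord _)
        _ = ∑ i, ENNReal.ofReal |(g (Ψ r x) - g (Ψ r y)) i| :=
            ENNReal.ofReal_sum_of_nonneg fun _ _ => abs_nonneg _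
        _ ≤ ∑ i : Fin (m+1), K ^ (1 / ((m:ℝ)+1)) := Finset.sum_le_sum fun i _ => hi2 i
        _ = _ := by simp
    have h6 := pow_le_pow_left' h5 (m+1)
    refine h6.trans_eq ?_
    rw [mul_pow, ← ENNReal.rpow_natCast (K ^ _), ← ENNReal.rpow_mul]
    have e1 : (1 / ((m:ℝ) + 1)) * ((m + 1 : ℕ):ℝ)  = 1 := by push_cast; field_simp
    rw [e1, ENNReal.rpow_one, hK, sliceC]
    ring


def consE {m : ℕ} (t : ℝ) (y : Euc m) : Euc (m+1) := WithLp.toLp 2 (Fin.cons t y.ofLp : Fin (m+1) → ℝ)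
def tailE {m : ℕ} (q : Euc (m+1)) : Euc m := WithLp.toLp 2 (fun i => q i.succ)

lemma consE_zero {m : ℕ} (t : ℝ) (y : Euc m) : consE t y 0 = t := rfl
lemma consE_succ {m : ℕ} (t : ℝ) (y : Euc m) (i : Fin m) : consE t y i.succ = y i := rfl

lemma consE_tailE {m : ℕ} (q : Euc (m+1)) : consE (q 0) (tailE q) = q := by
  ext i
  refine Fin.cases ?_ (fun j => ?_) i
  · rfl
  · rfl
lemma tailE_consE {m : ℕ} (t : ℝ) (y : Euc m) : tailE (consE t y) = y := by
  ext i; rfl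

lemma consE_norm_sq {m : ℕ} (t : ℝ) (y : Euc m) : ‖consE t y‖ ^ 2 = t ^ 2 + ‖y‖ ^ 2 := by
  rw [EuclideanSpace.norm_sq_eq, EuclideanSpace.norm_sq_eq, Fin.sum_univ_succ]
  simp [consE_zero, consE_succ]

lemma rho_consE {m : ℕ} (t : ℝ) (y : Euc m) : rho (consE t y) = ‖y‖ := by
  have h1 := rho_sq (consE t y)
  rw [consE_norm_sq, consE_zero] at h1
  have h2 : rho (consE t y) ^ 2 = ‖y‖ ^ 2 := by linarith
  exact (pow_left_inj₀ (rho_nonneg _) (norm_nonneg _) two_ne_zero).1 h2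

lemma norm_tailE {m : ℕ} (q : Euc (m+1)) : ‖tailE q‖ = rho q := by
  rw [← rho_consE (q 0), consE_tailE]

lemma consE_sub {m : ℕ} (s t : ℝ) (x y : Euc m) : consE s x - consE t y = consE (s - t) (x - y) := by
  ext i
  refine Fin.cases ?_ (fun j => ?_) i
  · rfl
  · rfl

lemma consE_norm_le {m : ℕ} (t : ℝ) (y : Euc m) : ‖consE t y‖ ≤ |t| + ‖y‖ := by
  have := norm_le_coord (consE t y)
  rwa [rho_consE, consE_zero] at this

lemma consE_mp (m : ℕ) : MeasurePreserving (fun p : ℝ × Euc m => consE p.1 p.2) := by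
  have h1 : MeasurePreserving (fun p : ℝ × Euc m => (p.1, p.2.ofLp)) :=
    (MeasurePreserving.id (volume : Measure ℝ)).prod (PiLp.volume_preserving_ofLp (Fin m))
  have h2 := (volume_preserving_piFinSuccAbove (fun _ : Fin (m+1) => ℝ) 0).symm
  have h3 := (PiLp.volume_preserving_toLp (Fin (m+1))).comp (h2.comp h1)
  convert h3 using 1
  funext p
  simp [consE, Function.comp, MeasurableEquiv.piFinSuccAbove, Fin.insertNthEquiv]

lemma shear_mp (m : ℕ) (κ : ℝ) :
    MeasurePreserving (fun p : ℝ × Euc m => (p.1 - κ * ‖p.2‖, p.2)) := by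
  have h1 : MeasurePreserving (fun p : Euc m × ℝ => (p.1, p.2 - κ * ‖p.1‖)) := by
    refine MeasurePreserving.skew_product (g := fun y r => r - κ * ‖y‖)
      (MeasurePreserving.id (volume : Measure (Euc m))) ?_ ?_
    · exact Continuous.measurable (by fun_prop)
    · refine Eventually.of_forall fun y => ?_
      exact (measurePreserving_sub_right volume (κ * ‖y‖)).map_eq
  have h2 := (Measure.measurePreserving_swap (μ := (volume : Measure (Euc m))) (ν := (volume : Measure ℝ))).comp
    (h1.comp (Measure.measurePreserving_swap (μ := (volume : Measure ℝ)) (ν := (volume : Measure (Euc m)))))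
  exact h2

def PsiM {m : ℕ} (b : Euc (m+1)) (R : Euc (m+1) ≃ₗᵢ[ℝ] Euc (m+1)) (κ : ℝ) (r : ℝ) (y : Euc m) :
    Euc (m+1) := b + R (consE (r - κ * ‖y‖) y)

lemma PsiM_mp {m : ℕ} (b : Euc (m+1)) (R : Euc (m+1) ≃ₗᵢ[ℝ] Euc (m+1)) (κ : ℝ) :
    MeasurePreserving (fun p : ℝ × Euc m => PsiM b R κ p.1 p.2) := by
  have h := (measurePreserving_add_left (volume : Measure (Euc (m+1))) b).comp
    ((LinearIsometryEquiv.measurePreserving R).comp ((consE_mp m).comp (shear_mp m κ)))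
  exact h

lemma PsiM_lip {m : ℕ} (b : Euc (m+1)) (R : Euc (m+1) ≃ₗᵢ[ℝ] Euc (m+1)) (κ : ℝ) (h0 : 0 ≤ κ)
    (h1 : κ ≤ 1) (r : ℝ) : LipschitzWith 2 (PsiM b R κ r) := by
  refine LipschitzWith.of_dist_le_mul fun x y => ?_
  rw [dist_eq_norm, dist_eq_norm, PsiM, PsiM, add_sub_add_left_eq_sub, ← map_sub,
    LinearIsometryEquiv.norm_map, consE_sub]
  refine (consE_norm_le _ _).trans ?_
  have h2 : |r - κ * ‖x‖ - (r - κ * ‖y‖)| ≤ ‖x - y‖ := by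
    have h3 : r - κ * ‖x‖ - (r - κ * ‖y‖) = κ * (‖y‖ - ‖x‖) := by ring
    rw [h3, abs_mul, abs_of_nonneg h0, abs_sub_comm]
    have h4 := abs_norm_sub_norm_le x y
    calc κ * |‖x‖ - ‖y‖| ≤ 1 * ‖x - y‖ := by gcongr
      _ = _ := one_mul _
  simp only [NNReal.coe_ofNat]
  linarith

lemma exists_R {m : ℕ} (x0 : Euc (m+1)) (hx : ‖x0‖ = 1) :
    ∃ R : Euc (m+1) ≃ₗᵢ[ℝ] Euc (m+1), R (e0 (m+1)) = -x0 := by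
  refine ⟨(ℝ ∙ (e0 (m+1) - -x0))ᗮ.reflection, ?_⟩
  apply Submodule.reflection_sub
  rw [norm_neg, hx, e0_norm]


lemma exists_orth {m : ℕ} (hm : 2 ≤ m) (ω : Euc m) : ∃ η : Euc m, ‖η‖ = 1 ∧ inner ℝ ω η = 0 := by
  have hne : (ℝ ∙ ω)ᗮ ≠ ⊥ := by
    intro h
    rw [Submodule.orthogonal_eq_bot_iff] at h
    have h1 := finrank_span_le_card (R := ℝ) ({ω} : Set (Euc m))
    rw [h, finrank_top, finrank_euclideanSpace_fin] at h1
    simp at h1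
    omega
  obtain ⟨v, hv, hv0⟩ := Submodule.exists_mem_ne_zero_of_ne_bot hne
  refine ⟨‖v‖⁻¹ • v, ?_, ?_⟩
  · rw [norm_smul, norm_inv, norm_norm, inv_mul_cancel₀ (norm_ne_zero_iff.2 hv0)]
  · rw [inner_smul_right, Submodule.mem_orthogonal_singleton_iff_inner_right.1 hv, mul_zero]

lemma half_dist {m : ℕ} (c : ℝ) (hc : 0 < c) (ω η : Euc m) (h1 : ‖ω‖ = 1) (h2 : ‖η‖ = 1)
    (h : 0 ≤ inner ℝ ω η) : ‖(c/2) • (ω + η) - c • ω‖ ≤ 3 * c / 4 := by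
  have e : (c/2) • (ω + η) - c • ω = (c/2) • (η - ω) := by
    module
  rw [e, norm_smul, Real.norm_of_nonneg (by positivity)]
  have h3 : ‖η - ω‖ ^ 2 ≤ 2 := by
    rw [norm_sub_sq_real, h1, h2, real_inner_comm]; linarith
  have h4 : ‖η - ω‖ ≤ 3 / 2 := by
    nlinarith [norm_nonneg (η - ω)]
  nlinarith

theorem slice_real {m : ℕ} {S A : ℝ≥0∞} {d ρ Q : ℝ} (hS : S ≠ ⊤) (hd : 0 ≤ d) (hρ : 0 ≤ ρ) (hQ : 0 ≤ Q)
    (hA : A ≤ ENNReal.ofReal Q) (h : ENNReal.ofReal d ^ (m+1) ≤ S * ENNReal.ofReal ρ * A) :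
    d ^ (m+1) ≤ S.toReal * ρ * Q := by
  have h1 : ENNReal.ofReal (d ^ (m+1)) ≤ ENNReal.ofReal (S.toReal * ρ * Q) := by
    rw [ENNReal.ofReal_pow hd, ENNReal.ofReal_mul (by positivity), ENNReal.ofReal_mul (by positivity),
      ENNReal.ofReal_toReal hS]
    exact h.trans (by gcongr)
  exact (ENNReal.ofReal_le_ofReal_iff (by positivity)).1 h1

theorem use1 {m : ℕ} (hm : 2 ≤ m) (α : ℝ) (hα : 0 < α) (f : Euc (m+1) → Euc (m+1))
    (Df : Euc (m+1) → Matrix (Fin (m+1)) (Fin (m+1)) ℝ)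
    (hfc : ContinuousOn f (cuspBall (m+1) (cuspFun α)))
    (hfm : MapsTo f (cuspBall (m+1) (cuspFun α)) (unitBall (m+1)))
    (hS : MemSobolev ((m+1 : ℕ):ℝ) (cuspBall (m+1) (cuspFun α)) f Df) :
    ∃ K : ℝ, 0 < K ∧ ∀ t2 : ℝ, 0 < t2 → t2 ≤ 1 / 2 → 8 * cuspFun α t2 ≤ 1 / 2 →
      ∃ t ∈ Ioo (t2 / 2) t2, ∀ p ∈ cuspBall (m+1) (cuspFun α), ∀ q ∈ cuspBall (m+1) (cuspFun α),
        p 0 = t → q 0 = t → rho p < 4 * cuspFun α t2 → rho q < 4 * cuspFun α t2 →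
        ‖f p - f q‖ ^ (m+1) ≤ K * cuspFun α t2 / t2 := by
  set V := cuspBall (m+1) (cuspFun α) with hV
  obtain ⟨A, hAm, hAi, hA⟩ := slice (by omega : 1 ≤ m) V (cuspBall_isOpen hα) f Df hfc 1
    (fun x hx => by have := hfm hx; rw [unitBall, mem_ball_zero_iff] at this; exact this.le) hS
    (PsiM 0 (LinearIsometryEquiv.refl ℝ _) 0) (PsiM_lip _ _ 0 le_rfl zero_le_one) (PsiM_mp _ _ 0)
  have hlp := hS.lp
  simp only [Real.rpow_natCast] at hlp
  set En := ∫⁻ x in V, ENNReal.ofReal (opNorm (Df x) ^ (m+1)) with hEn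
  have hEt : En ≠ ⊤ := hlp.lintegral_lt_top.ne
  set K := 3 ^ (m+1) * ((sliceC m).toReal * 4 * (En.toReal * 2)) + 1 with hK
  refine ⟨K, by positivity, fun t2 h0 h1 h2 => ?_⟩
  set u := cuspFun α t2 with hu
  have hu0 : 0 < u := cuspFun_pos h0
  set c := 4 * u with hc
  have hc0 : 0 < c := by positivity
  obtain ⟨t, ht, hAt⟩ : ∃ t ∈ Ioo (t2/2) t2, A t ≤ ENNReal.ofReal (En.toReal * 2 / t2) := by
    have hvol : volume (Ioo (t2/2) t2) = ENNReal.ofReal (t2 / 2) := by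
      rw [Real.volume_Ioo]; congr 1; ring
    obtain ⟨t, ht, h⟩ := exists_le_setLAverage (μ := volume) (s := Ioo (t2/2) t2) (f := A)
      (by rw [hvol]; simpa using by linarith) (by rw [hvol]; finiteness) hAm.aemeasurable
    refine ⟨t, ht, h.trans ?_⟩
    rw [setLAverage_eq, hvol]
    calc _ ≤ En / ENNReal.ofReal (t2/2) := by
          gcongr
          exact (setLIntegral_le_lintegral _ _).trans hAi
      _ = _ := by
          rw [← ENNReal.ofReal_toReal hEt, ← ENNReal.ofReal_div_of_pos (by positivity), ENNReal.ofReal_toReal hEt]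
          congr 1
          field_simp
  refine ⟨t, ht, ?_⟩
  have ht0 : 0 < t := by linarith [ht.1]
  set ut := cuspFun α t with hut
  have hutu : ut < u := cuspFun_lt hα ht0.le ht.2
  have hut0 : 0 < ut := cuspFun_pos ht0
  set Q := En.toReal * 2 / t2 with hQ
  have hQ0 : 0 ≤ Q := by positivity
  set Bd := (sliceC m).toReal * c * Q with hBd
  have hBd0 : 0 ≤ Bd := by positivity
  -- single ball estimate
  have ball1 : ∀ ω : Euc m, ‖ω‖ = 1 → ∀ ρ, 0 < ρ → ρ < c - ut →
      ∀ x ∈ closedBall (c • ω) ρ, ∀ y ∈ closedBall (c • ω) ρ,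
      ‖f (consE t x) - f (consE t y)‖ ^ (m+1) ≤ Bd := by
    intro ω hω ρ hρ hρc x hx y hy
    have hPsi : ∀ z : Euc m, PsiM 0 (LinearIsometryEquiv.refl ℝ _) 0 t z = consE t z := by
      intro z; simp [PsiM]
    have h := hA t (c • ω) ρ hρ (by
      intro z hz
      rw [hPsi, hV]
      rw [mem_closedBall, dist_eq_norm] at hz
      have hcω : ‖c • ω‖ = c := by rw [norm_smul, hω, Real.norm_of_nonneg hc0.le, mul_one]
      have hz1 : ‖z‖ ≤ c + ρ := by
        have := norm_sub_norm_le z (c • ω)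
        linarith
      have hz2 : c - ρ ≤ ‖z‖ := by
        have := norm_sub_norm_le (c • ω) z
        rw [norm_sub_rev] at this
        linarith
      refine ⟨?_, ?_⟩
      · rw [ball_iff, consE_zero, rho_consE]
        have : ‖z‖ < 1/2 := by linarith
        have : t < 1/2 := by linarith [ht.2]
        nlinarith [norm_nonneg z]
      · rintro ⟨-, h5⟩
        have h6 : rho (consE t z) ≤ ut := h5
        rw [rho_consE] at h6
        linarith) x hx y hy
    rw [hPsi, hPsi] at h
    have h7 := slice_real (sliceC_ne_top m) (norm_nonneg _) hρ.le hQ0 hAt h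
    refine h7.trans ?_
    rw [hBd]
    gcongr
    linarith
  intro p hp q hq hp0 hq0 hpc hqc
  have hpe : p = consE t (tailE p) := by rw [← hp0, consE_tailE]
  have hqe : q = consE t (tailE q) := by rw [← hq0, consE_tailE]
  have hpu : ut < rho p := by
    by_contra hcon
    exact hp.2 ⟨by rw [hp0]; exact ht0.le, by rw [hp0]; exact not_lt.1 hcon⟩
  have hqu : ut < rho q := by
    by_contra hcon
    exact hq.2 ⟨by rw [hq0]; exact ht0.le, by rw [hq0]; exact not_lt.1 hcon⟩
  rw [← norm_tailE] at hpu hqu hpc hqc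
  set x := tailE p
  set y := tailE q
  have hx0 : 0 < ‖x‖ := hut0.trans hpu
  have hy0 : 0 < ‖y‖ := hut0.trans hqu
  have dir : ∀ z : Euc m, ut < ‖z‖ → ‖z‖ < c → ∃ ω : Euc m, ‖ω‖ = 1 ∧ ‖z - c • ω‖ = c - ‖z‖ := by
    intro z hz1 hz2
    have hz0 : 0 < ‖z‖ := hut0.trans hz1
    refine ⟨‖z‖⁻¹ • z, ?_, ?_⟩
    · rw [norm_smul, norm_inv, norm_norm, inv_mul_cancel₀ hz0.ne']
    · have : z - c • ‖z‖⁻¹ • z = (1 - c * ‖z‖⁻¹) • z := by rw [smul_smul, sub_smul, one_smul]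
      rw [this, norm_smul, Real.norm_eq_abs, abs_sub_comm, abs_of_nonneg]
      · field_simp
      · rw [sub_nonneg, ← div_eq_mul_inv, le_div_iff₀ hz0]; linarith
  obtain ⟨ω1, hω1, hxω⟩ := dir x hpu hpc
  obtain ⟨ω2, hω2, hyω⟩ := dir y hqu hqc
  obtain ⟨η, hη, h1η, h2η⟩ : ∃ η : Euc m, ‖η‖ = 1 ∧ 0 ≤ inner ℝ ω1 η ∧ 0 ≤ inner ℝ ω2 η := by
    obtain ⟨η, hη, h⟩ := exists_orth hm ω1
    rcases le_total 0 (inner ℝ ω2 η) with h' | h'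
    · exact ⟨η, hη, h.ge, h'⟩
    · refine ⟨-η, by rw [norm_neg, hη], ?_, ?_⟩
      · rw [inner_neg_right, h, neg_zero]
      · rw [inner_neg_right]; linarith
  set a1 := (c/2) • (ω1 + η)
  set a2 := (c/2) • (ω2 + η)
  have s1 : ‖f (consE t x) - f (consE t a1)‖ ^ (m+1) ≤ Bd := by
    refine ball1 ω1 hω1 (max (3*c/4) (c - ‖x‖)) (lt_max_of_lt_left (by positivity))
      (max_lt (by linarith) (by linarith)) _ ?_ _ ?_
    · rw [mem_closedBall, dist_eq_norm, hxω]; exact le_max_right _ _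
    · rw [mem_closedBall, dist_eq_norm]
      exact (half_dist c hc0 ω1 η hω1 hη h1η).trans (le_max_left _ _)
  have s3 : ‖f (consE t a2) - f (consE t y)‖ ^ (m+1) ≤ Bd := by
    refine ball1 ω2 hω2 (max (3*c/4) (c - ‖y‖)) (lt_max_of_lt_left (by positivity))
      (max_lt (by linarith) (by linarith)) _ ?_ _ ?_
    · rw [mem_closedBall, dist_eq_norm]
      exact (half_dist c hc0 ω2 η hω2 hη h2η).trans (le_max_left _ _)
    · rw [mem_closedBall, dist_eq_norm, hyω]; exact le_max_right _ _
  have s2 : ‖f (consE t a1) - f (consE t a2)‖ ^ (m+1) ≤ Bd := by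
    refine ball1 η hη (3*c/4) (by positivity) (by linarith) _ ?_ _ ?_
    · rw [mem_closedBall, dist_eq_norm]
      have := half_dist c hc0 η ω1 hη hω1 (by rwa [real_inner_comm])
      rwa [add_comm η] at this
    · rw [mem_closedBall, dist_eq_norm]
      have := half_dist c hc0 η ω2 hη hω2 (by rwa [real_inner_comm])
      rwa [add_comm η] at this
  rw [hpe, hqe]
  set d1 := ‖f (consE t x) - f (consE t a1)‖
  set d2 := ‖f (consE t a1) - f (consE t a2)‖
  set d3 := ‖f (consE t a2) - f (consE t y)‖
  have htri : ‖f (consE t x) - f (consE t y)‖ ≤ 3 * max d1 (max d2 d3) := by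
    have e : f (consE t x) - f (consE t y) = (f (consE t x) - f (consE t a1)) +
      (f (consE t a1) - f (consE t a2)) + (f (consE t a2) - f (consE t y)) := by abel
    rw [e]
    refine (norm_add₃_le).trans ?_
    have h1 := le_max_left d1 (max d2 d3)
    have h2 := (le_max_left d2 d3).trans (le_max_right d1 (max d2 d3))
    have h3 := (le_max_right d2 d3).trans (le_max_right d1 (max d2 d3))
    linarith
  have hmax : (max d1 (max d2 d3)) ^ (m+1) ≤ Bd := by
    rcases max_cases d1 (max d2 d3) with ⟨h, -⟩ | ⟨h, -⟩
    · rw [h]; exact s1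
    · rw [h]
      rcases max_cases d2 d3 with ⟨h, -⟩ | ⟨h, -⟩
      · rw [h]; exact s2
      · rw [h]; exact s3
  calc _ ≤ (3 * max d1 (max d2 d3)) ^ (m+1) := by gcongr
    _ = 3 ^ (m+1) * (max d1 (max d2 d3)) ^ (m+1) := mul_pow _ _ _
    _ ≤ 3 ^ (m+1) * Bd := by gcongr
    _ = (3 ^ (m+1) * ((sliceC m).toReal * 4 * (En.toReal * 2))) * u / t2 := by
        rw [hBd, hQ, hc]; ring
    _ ≤ _ := by
        gcongr
        rw [hK]; linarith


lemma consE_cont {m : ℕ} : Continuous (fun p : ℝ × Euc m => consE p.1 p.2) := by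
  unfold consE
  refine (PiLp.continuous_toLp 2 _).comp (continuous_pi fun i => ?_)
  refine Fin.cases ?_ (fun j => ?_) i
  · exact continuous_fst
  · simp only [Fin.cons_succ]; fun_prop

theorem proper {n : ℕ} {h f : Euc n → Euc n} {V : Set (Euc n)} (hh : IsHomeoOn h f (unitBall n) V)
    {p : Euc n} (hp : p ∉ V) {ε : ℝ} (hε : 0 < ε) :
    ∀ᶠ q in 𝓝 p, q ∈ V → 1 - ε < ‖f q‖ := by
  have hsub : closedBall (0 : Euc n) (1 - ε) ⊆ unitBall n := closedBall_subset_ball (by linarith)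
  have hK : IsCompact (h '' closedBall (0 : Euc n) (1 - ε)) :=
    (isCompact_closedBall _ _).image_of_continuousOn (hh.continuousOn.mono hsub)
  have hpK : p ∈ (h '' closedBall (0 : Euc n) (1 - ε))ᶜ := by
    rintro ⟨z, hz, rfl⟩
    exact hp (hh.mapsTo (hsub hz))
  filter_upwards [hK.isClosed.isOpen_compl.mem_nhds hpK] with q hq hqV
  by_contra hcon
  exact hq ⟨f q, by rw [mem_closedBall_zero_iff]; linarith, hh.right_inv q hqV⟩

theorem compact_inside {n : ℕ} {f : Euc n → Euc n} {K : Set (Euc n)} (hK : IsCompact K)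
    (hf : ContinuousOn f K) (hm : MapsTo f K (unitBall n)) {δ : ℝ} (hδ : 0 < δ) :
    ∃ ε, 0 < ε ∧ ε ≤ δ ∧ ∀ p ∈ K, ‖f p‖ ≤ 1 - ε := by
  rcases K.eq_empty_or_nonempty with rfl | hne
  · exact ⟨δ, hδ, le_rfl, by simp⟩
  · obtain ⟨p, hp, hmax⟩ := hK.exists_isMaxOn hne hf.norm
    have h1 : ‖f p‖ < 1 := by simpa [unitBall] using hm hp
    refine ⟨min δ (1 - ‖f p‖), lt_min hδ (by linarith), min_le_left _ _, fun q hq => ?_⟩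
    have h2 : ‖f q‖ ≤ ‖f p‖ := hmax hq
    linarith [min_le_right δ (1 - ‖f p‖)]

def PP {m : ℕ} (x0 : Euc (m+1)) (R : Euc (m+1) ≃ₗᵢ[ℝ] Euc (m+1)) (z : Euc (m+1)) : ℝ :=
  (R.symm (z - x0)) 0 + rho (R.symm (z - x0))

lemma PP_cont {m : ℕ} (x0 : Euc (m+1)) (R : Euc (m+1) ≃ₗᵢ[ℝ] Euc (m+1)) : Continuous (PP x0 R) := by
  have h1 : Continuous fun z => R.symm (z - x0) := R.symm.continuous.comp (by fun_prop)
  have h0 : Continuous fun p : Euc (m+1) => p 0 := by fun_prop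
  exact (h0.comp h1).add (rho_continuous.comp h1)

lemma PP_PsiM {m : ℕ} (x0 : Euc (m+1)) (R : Euc (m+1) ≃ₗᵢ[ℝ] Euc (m+1)) (r : ℝ) (y : Euc m) :
    PP x0 R (PsiM x0 R 1 r y) = r := by
  have : R.symm (PsiM x0 R 1 r y - x0) = consE (r - 1 * ‖y‖) y := by
    rw [PsiM, add_sub_cancel_left, LinearIsometryEquiv.symm_apply_apply]
  rw [PP, this, rho_consE, consE_zero]; ring

lemma PsiM_PP {m : ℕ} (x0 : Euc (m+1)) (R : Euc (m+1) ≃ₗᵢ[ℝ] Euc (m+1)) (z : Euc (m+1)) :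
    PsiM x0 R 1 (PP x0 R z) (tailE (R.symm (z - x0))) = z := by
  rw [PsiM, norm_tailE, PP, one_mul, add_sub_cancel_right, consE_tailE,
    LinearIsometryEquiv.apply_symm_apply, add_sub_cancel]

lemma norm_R {m : ℕ} {x0 : Euc (m+1)} (hx : ‖x0‖ = 1) {R : Euc (m+1) ≃ₗᵢ[ℝ] Euc (m+1)}
    (hR : R (e0 (m+1)) = -x0) (q : Euc (m+1)) :
    ‖x0 + R q‖ ^ 2 = (1 - q 0) ^ 2 + rho q ^ 2 := by
  have h1 : inner ℝ x0 (R q) = - q 0 := by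
    have : x0 = - R (e0 (m+1)) := by rw [hR, neg_neg]
    rw [this, inner_neg_left, LinearIsometryEquiv.inner_map_map, e0, EuclideanSpace.inner_single_left]
    simp
  have h2 := rho_sq q
  rw [norm_add_sq_real, h1, hx, LinearIsometryEquiv.norm_map, h2]
  ring

lemma norm_PsiM {m : ℕ} {x0 : Euc (m+1)} (hx : ‖x0‖ = 1) {R : Euc (m+1) ≃ₗᵢ[ℝ] Euc (m+1)}
    (hR : R (e0 (m+1)) = -x0) (r : ℝ) (y : Euc m) :
    ‖PsiM x0 R 1 r y‖ ^ 2 = (1 - r + ‖y‖) ^ 2 + ‖y‖ ^ 2 := by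
  rw [PsiM, norm_R hx hR, consE_zero, rho_consE]; ring

lemma PP_facts {m : ℕ} {x0 : Euc (m+1)} (hx : ‖x0‖ = 1) {R : Euc (m+1) ≃ₗᵢ[ℝ] Euc (m+1)}
    (hR : R (e0 (m+1)) = -x0) {z : Euc (m+1)} (hz : z ∈ unitBall (m+1)) :
    ‖tailE (R.symm (z - x0))‖ ≤ PP x0 R z ∧ ‖z - x0‖ ≤ PP x0 R z ∧ PP x0 R z ≤ 2 * ‖z - x0‖ := by
  set q := R.symm (z - x0) with hq
  have h1 : ‖z‖ ^ 2 = (1 - q 0) ^ 2 + rho q ^ 2 := by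
    rw [← norm_R hx hR, hq, LinearIsometryEquiv.apply_symm_apply, add_sub_cancel]
  have h2 : ‖z‖ < 1 := by simpa [unitBall] using hz
  have h3 : 0 ≤ q 0 := by nlinarith [norm_nonneg z, rho_nonneg q, sq_nonneg (q 0)]
  have h4 : ‖z - x0‖ = ‖q‖ := by rw [hq, LinearIsometryEquiv.norm_map]
  have h5 := rho_sq q
  have h6 := rho_nonneg q
  have h7 : PP x0 R z = q 0 + rho q := rfl
  rw [h7, h4, norm_tailE]
  refine ⟨by linarith, ?_, ?_⟩
  · exact le_of_sq_le_sq (by nlinarith) (by linarith)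
  · have := rho_le_norm q
    have := single_coord_norm q 0
    rw [abs_of_nonneg h3] at this
    linarith

theorem exists_x0 {m : ℕ} {α : ℝ} {h f : Euc (m+1) → Euc (m+1)}
    (hh : IsHomeoOn h f (unitBall (m+1)) (cuspBall (m+1) (cuspFun α))) (ζ : Euc m) (hζ : ‖ζ‖ = 1)
    {t c d0 : ℝ} (ht : 0 < t) (ht2 : t < 1/2) (hc : cuspFun α t < c) (hc2 : c ≤ 1/2) (hd : 0 < d0) (hd2 : d0 ≤ 1/2)
    (hA : ∀ p ∈ cuspBall (m+1) (cuspFun α), ∀ q ∈ cuspBall (m+1) (cuspFun α),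
      p 0 = t → q 0 = t → rho p < c → rho q < c → ‖f p - f q‖ ≤ d0) :
    ∃ x0 : Euc (m+1), ‖x0‖ = 1 ∧ ∀ p ∈ cuspBall (m+1) (cuspFun α), p 0 = t → rho p < c →
      1 - 2 * d0 ≤ inner ℝ (f p) x0 := by
  have hu := cuspFun_pos (α := α) ht
  set u := cuspFun α t with hudef
  have hnu : ∀ s : ℝ, 0 ≤ s → ‖s • ζ‖ = s := fun s hs => by
    rw [norm_smul, hζ, mul_one, Real.norm_of_nonneg hs]
  have hb : consE t (u • ζ) ∉ cuspBall (m+1) (cuspFun α) := by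
    intro hb
    refine hb.2 ⟨ht.le, ?_⟩
    change rho (consE t (u • ζ)) ≤ u
    rw [rho_consE, hnu u hu.le]
  have hev := proper hh hb hd
  have hcont : Continuous fun s : ℝ => consE t (s • ζ) :=
    consE_cont.comp (by fun_prop : Continuous fun s : ℝ => ((t, s • ζ) : ℝ × Euc m))
  have hev2 := (hcont.tendsto u).eventually hev
  have hev3 := (hev2.filter_mono (nhdsWithin_le_nhds (s := Ioi u))).and (Ioo_mem_nhdsGT hc)
  obtain ⟨s, hs1, hs2⟩ := hev3.exists
  have hs0 : 0 < s := hu.trans hs2.1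
  have hsV : consE t (s • ζ) ∈ cuspBall (m+1) (cuspFun α) := by
    refine ⟨?_, ?_⟩
    · rw [ball_iff, consE_zero, rho_consE, hnu s hs0.le]
      nlinarith [hs2.2]
    · rintro ⟨-, h5⟩
      have h6 : rho (consE t (s • ζ)) ≤ u := h5
      rw [rho_consE, hnu s hs0.le] at h6
      linarith [hs2.1]
  have hz := hs1 hsV
  set z1 := f (consE t (s • ζ)) with hz1
  have hz0 : 0 < ‖z1‖ := by linarith
  refine ⟨‖z1‖⁻¹ • z1, ?_, fun p hp hp0 hpc => ?_⟩
  · rw [norm_smul, norm_inv, norm_norm, inv_mul_cancel₀ hz0.ne']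
  · have h1 := hA p hp _ hsV hp0 rfl hpc (by rw [rho_consE, hnu s hs0.le]; exact hs2.2)
    have hn : ‖‖z1‖⁻¹ • z1‖ = 1 := by
      rw [norm_smul, norm_inv, norm_norm, inv_mul_cancel₀ hz0.ne']
    have h2 : inner ℝ (f p) (‖z1‖⁻¹ • z1) = inner ℝ (f p - z1) (‖z1‖⁻¹ • z1) + ‖z1‖ := by
      rw [inner_sub_left, inner_smul_right _ z1, inner_smul_right z1 z1, real_inner_self_eq_norm_sq]
      field_simp
      ring
    have h3 := abs_real_inner_le_norm (f p - z1) (‖z1‖⁻¹ • z1)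
    rw [hn, mul_one] at h3
    have h4 := (abs_le.1 (h3.trans h1)).1
    rw [h2]; linarith

lemma shell_preconn {n : ℕ} {x0 : Euc n} (hx : ‖x0‖ = 1) {δ ε : ℝ} (hδ : 0 < δ) (hδ1 : δ < 1)
    (hε1 : ε < 1) :
    IsPreconnected {z : Euc n | 1 - ε < ‖z‖ ∧ ‖z‖ < 1 ∧ inner ℝ z x0 < (1 - δ) * ‖z‖} := by
  set C := {v : Euc n | inner ℝ v x0 < (1 - δ) * ‖v‖} with hC
  have hC0 : ∀ v ∈ C, v ≠ 0 := by
    rintro v hv rfl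
    simp [hC] at hv
  have hmx : -x0 ∈ C := by
    simp only [hC, mem_setOf_eq, inner_neg_left, norm_neg, hx, real_inner_self_eq_norm_sq]
    linarith
  have hstar : StarConvex ℝ (-x0) C := by
    intro v hv a b ha hb hab
    rcases hb.eq_or_lt with rfl | hb
    · have : a = 1 := by linarith
      subst this; simpa using hmx
    · simp only [hC, mem_setOf_eq] at hv ⊢
      have h1 : inner ℝ (a • -x0 + b • v) x0 = -a + b * inner ℝ v x0 := by
        rw [inner_add_left, real_inner_smul_left, real_inner_smul_left, inner_neg_left,
          real_inner_self_eq_norm_sq, hx]; ring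
      have h2 : b * ‖v‖ - a ≤ ‖a • -x0 + b • v‖ := by
        have h3 : b • v = (a • -x0 + b • v) - a • (-x0) := by abel
        have h4 : ‖b • v‖ ≤ ‖a • -x0 + b • v‖ + ‖a • (-x0)‖ := by
          conv_lhs => rw [h3]
          exact norm_sub_le _ _
        rw [norm_smul, norm_smul, norm_neg, hx, Real.norm_of_nonneg hb.le, Real.norm_of_nonneg ha] at h4
        linarith
      rw [h1]
      nlinarith [mul_lt_mul_of_pos_left hv hb, mul_le_mul_of_nonneg_left h2 (by linarith : (0:ℝ) ≤ 1 - δ),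
        mul_nonneg ha hδ.le]
  have hCp : IsPreconnected C := (hstar.isPathConnected hmx).isConnected.isPreconnected
  have hprod : IsPreconnected (Ioo (1 - ε) 1 ×ˢ C) := isPreconnected_Ioo.prod hCp
  have hcont : ContinuousOn (fun p : ℝ × Euc n => (p.1 * ‖p.2‖⁻¹) • p.2) (Ioo (1 - ε) 1 ×ˢ C) := by
    refine ContinuousOn.smul (ContinuousOn.mul continuousOn_fst (ContinuousOn.inv₀ (by fun_prop) ?_)) continuousOn_snd
    rintro ⟨a, v⟩ ⟨-, hv⟩
    exact norm_ne_zero_iff.2 (hC0 v hv)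
  convert hprod.image _ hcont using 1
  ext z
  constructor
  · rintro ⟨h1, h2, h3⟩
    have hz : 0 < ‖z‖ := by linarith
    exact ⟨(‖z‖, z), ⟨⟨h1, h2⟩, h3⟩, by simp [mul_inv_cancel₀ hz.ne']⟩
  · rintro ⟨⟨a, v⟩, ⟨⟨h1, h2⟩, h3⟩, rfl⟩
    have ha : 0 < a := by dsimp at h1; linarith
    have hv := norm_pos_iff.2 (hC0 v h3)
    have hn : ‖(a * ‖v‖⁻¹) • v‖ = a := by
      rw [norm_smul, Real.norm_of_nonneg (by positivity)]; field_simp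
    refine ⟨by rw [hn]; exact h1, by rw [hn]; exact h2, ?_⟩
    rw [hn, real_inner_smul_left]
    have h4 : inner ℝ v x0 < (1 - δ) * ‖v‖ := h3
    calc a * ‖v‖⁻¹ * inner ℝ v x0 < a * ‖v‖⁻¹ * ((1 - δ) * ‖v‖) := by
          apply mul_lt_mul_of_pos_left h4 (by positivity)
      _ = _ := by field_simp


def NN {n : ℕ} [NeZero n] (p : Euc n) : ℝ := max |p 0| (rho p)

lemma NN_cont {n : ℕ} [NeZero n] : Continuous (NN (n := n)) := by
  have h0 : Continuous fun p : Euc n => p 0 := by fun_prop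
  exact h0.abs.max rho_continuous

lemma NN_lip {n : ℕ} [NeZero n] (p q : Euc n) : NN p - NN q ≤ ‖p - q‖ := by
  have h1 := rho_lip p q
  have h2 := (abs_abs_sub_abs_le (p 0) (q 0)).trans (coord_lip p q)
  have h3 := (abs_le.1 h1).2
  have h4 := (abs_le.1 h2).2
  have : NN p ≤ NN q + ‖p - q‖ := by
    refine max_le ?_ ?_
    · have := le_max_left |q 0| (rho q)
      unfold NN; linarith
    · have := le_max_right |q 0| (rho q)
      unfold NN; linarith
  linarith

lemma ivt_cross {g : ℝ → ℝ} {a b r : ℝ} (hg : ContinuousOn g (uIcc a b)) (h1 : g a ≤ r) (h2 : r ≤ g b) :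
    ∃ s ∈ uIcc a b, g s = r := by
  have := intermediate_value_uIcc hg (mem_uIcc_of_le h1 h2)
  obtain ⟨s, hs, h⟩ := this
  exact ⟨s, hs, h⟩

theorem crossing {m : ℕ} {α : ℝ} (hα : 0 < α) {h f : Euc (m+1) → Euc (m+1)}
    (hh : IsHomeoOn h f (unitBall (m+1)) (cuspBall (m+1) (cuspFun α))) (ζ : Euc m) (hζ : ‖ζ‖ = 1)
    {x0 : Euc (m+1)} (hx : ‖x0‖ = 1) {R : Euc (m+1) ≃ₗᵢ[ℝ] Euc (m+1)} (hR : R (e0 (m+1)) = -x0)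
    {δ t c r : ℝ} (hδ : 0 < δ) (hδ1 : δ < 1) (ht : 0 < t) (ht4 : t ≤ 1/4) (hc : cuspFun α t < c)
    (hct : c < t)
    (hA : ∀ p ∈ cuspBall (m+1) (cuspFun α), p 0 = t → rho p < c → 1 - δ ≤ inner ℝ (f p) x0)
    (hr : 4 * √δ < r) (hr1 : r < 1) (hd1 : r < 1 - ‖f (consE (-(1/2)) 0)‖)
    (hd2 : r < 1 - ‖f (consE 0 ((1/2 : ℝ) • ζ))‖) :
    ∃ z ∈ unitBall (m+1), ∃ z' ∈ unitBall (m+1), PP x0 R z = r ∧ PP x0 R z' = r ∧ t / 2 ≤ ‖h z - h z'‖ := by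
  set V := cuspBall (m+1) (cuspFun α) with hV
  have hnu : ∀ s : ℝ, 0 ≤ s → ‖s • ζ‖ = s := fun s hs => by
    rw [norm_smul, hζ, mul_one, Real.norm_of_nonneg hs]
  have hsq : √δ ^ 2 = δ := Real.sq_sqrt hδ.le
  have hsp : 0 < √δ := Real.sqrt_pos.2 hδ
  have hs1 : √δ < 1 := by nlinarith
  -- compact part
  obtain ⟨ε, hε, hεδ, hM⟩ : ∃ ε, 0 < ε ∧ ε ≤ δ ∧
      ∀ p ∈ {p : Euc (m+1) | NN p = t ∧ (c ≤ rho p ∨ p 0 ≤ 0)}, ‖f p‖ ≤ 1 - ε := by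
    have hsub : {p : Euc (m+1) | NN p = t ∧ (c ≤ rho p ∨ p 0 ≤ 0)} ⊆ V := by
      rintro p ⟨hp1, hp2⟩
      have ha : |p 0| ≤ t := by rw [← hp1]; exact le_max_left _ _
      have hb : rho p ≤ t := by rw [← hp1]; exact le_max_right _ _
      refine ⟨?_, ?_⟩
      · rw [ball_iff, ← sq_abs (p 0)]
        nlinarith [abs_nonneg (p 0), rho_nonneg p]
      · rintro ⟨h5, h6⟩
        have h6 : rho p ≤ cuspFun α (p 0) := h6
        rw [abs_of_nonneg h5] at ha
        have h7 : cuspFun α (p 0) ≤ cuspFun α t := by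
          rcases ha.eq_or_lt with h | h
          · rw [h]
          · exact (cuspFun_lt hα h5 h).le
        rcases hp2 with h8 | h8
        · linarith
        · have h9 : p 0 = 0 := le_antisymm h8 h5
          have h10 : rho p = t := by
            rw [NN, h9, abs_zero, max_eq_right (rho_nonneg p)] at hp1; exact hp1
          linarith
    have h0 : Continuous fun p : Euc (m+1) => p 0 := by fun_prop
    have hcl : IsClosed {p : Euc (m+1) | NN p = t ∧ (c ≤ rho p ∨ p 0 ≤ 0)} :=
      (isClosed_eq NN_cont continuous_const).inter
        ((isClosed_le continuous_const rho_continuous).union (isClosed_le h0 continuous_const))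
    have hcpt : IsCompact {p : Euc (m+1) | NN p = t ∧ (c ≤ rho p ∨ p 0 ≤ 0)} := by
      refine (isCompact_closedBall (0 : Euc (m+1)) 1).of_isClosed_subset hcl ?_
      intro p hp
      exact ball_subset_closedBall (hsub hp).1
    exact compact_inside hcpt (hh.continuousOn_inv.mono hsub) (hh.mapsTo_inv.mono_left hsub) hδ
  set Sh := {z : Euc (m+1) | 1 - ε < ‖z‖ ∧ ‖z‖ < 1 ∧ inner ℝ z x0 < (1 - δ) * ‖z‖} with hSh
  have hShB : Sh ⊆ unitBall (m+1) := fun z hz => by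
    rw [unitBall, mem_ball_zero_iff]; exact hz.2.1
  have hne : ∀ z ∈ Sh, NN (h z) ≠ t := by
    intro z hz hN
    have hzV := hh.mapsTo (hShB hz)
    have hfz := hh.left_inv z (hShB hz)
    by_cases hcase : c ≤ rho (h z) ∨ (h z) 0 ≤ 0
    · have := hM _ ⟨hN, hcase⟩
      rw [hfz] at this
      linarith [hz.1]
    · push Not at hcase
      have h1 : (h z) 0 = t := by
        rw [NN, abs_of_pos hcase.2] at hN
        rcases max_cases ((h z) 0) (rho (h z)) with h2 | h2
        · linarith
        · linarith
      have h2 := hA _ hzV h1 hcase.1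
      rw [hfz] at h2
      nlinarith [hz.2.1, hz.2.2]
  have hcn : ContinuousOn (fun z => NN (h z)) Sh :=
    NN_cont.comp_continuousOn (hh.continuousOn.mono hShB)
  have hdich : (∀ z ∈ Sh, t < NN (h z)) ∨ (∀ z ∈ Sh, NN (h z) < t) := by
    by_contra hcon
    push Not at hcon
    obtain ⟨⟨z, hz, hz1⟩, ⟨w, hw, hw1⟩⟩ := hcon
    have hpre := (shell_preconn hx hδ hδ1 (hεδ.trans_lt hδ1)).image _ hcn
    have := hpre.ordConnected.out (mem_image_of_mem _ hz) (mem_image_of_mem _ hw) ⟨hz1, hw1⟩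
    obtain ⟨v, hv, hv1⟩ := this
    exact hne v hv hv1
  have hN1 : ∀ z ∈ unitBall (m+1), 1 - ε < ‖z‖ → z ∉ Sh → PP x0 R z < r := by
    intro z hz hz1 hz2
    have hz3 : ‖z‖ < 1 := by simpa [unitBall] using hz
    have hz4 : (1 - δ) * ‖z‖ ≤ inner ℝ z x0 := by
      by_contra hcon
      exact hz2 ⟨hz1, hz3, not_le.1 hcon⟩
    have h1 := (PP_facts hx hR hz).2.2
    have h2 : ‖z - x0‖ ^ 2 = ‖z‖^2 - 2 * inner ℝ z x0 + 1 := by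
      rw [norm_sub_sq_real, hx]; ring
    have h3 : ‖z - x0‖ ^ 2 ≤ (2 * √δ) ^ 2 := by
      rw [h2, mul_pow, hsq]
      nlinarith [norm_nonneg z]
    have h4 := le_of_sq_le_sq h3 (by positivity)
    linarith
  have hδr : δ < r := by nlinarith
  obtain ⟨z3, hz3, hP3⟩ : ∃ z ∈ Sh, PP x0 R z = r := by
    obtain ⟨s, hs, hs1⟩ := ivt_cross (g := fun s : ℝ => (1 - r + s)^2 + s^2) (a := 0) (b := 1)
      (r := (1 - ε/2)^2) (by fun_prop) (by nlinarith) (by nlinarith)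
    rw [uIcc_of_le zero_le_one] at hs
    have hn := norm_PsiM hx hR r (s • ζ)
    rw [hnu s hs.1, hs1] at hn
    have hn' : ‖PsiM x0 R 1 r (s • ζ)‖ = 1 - ε/2 :=
      (pow_left_inj₀ (norm_nonneg _) (by linarith) two_ne_zero).1 hn
    refine ⟨PsiM x0 R 1 r (s • ζ), ?_, PP_PsiM _ _ _ _⟩
    by_contra hcon
    have := hN1 _ (by rw [unitBall, mem_ball_zero_iff, hn']; linarith) (by rw [hn']; linarith) hcon
    rw [PP_PsiM] at this
    exact lt_irrefl _ this
  have hz3B := hShB hz3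
  -- P at deep points
  have hdeep : ∀ z ∈ unitBall (m+1), r < 1 - ‖z‖ → r ≤ PP x0 R z := by
    intro z hz h1
    have h2 := (PP_facts hx hR hz).2.1
    have h3 := norm_sub_norm_le x0 z
    rw [hx, norm_sub_rev] at h3
    linarith
  -- crossing a curve
  have curve : ∀ γ : ℝ → Euc (m+1), Continuous γ → ∀ I : Set ℝ, I.OrdConnected → (∀ s ∈ I, γ s ∈ V) →
      ∀ a ∈ I, 1 - ε < ‖f (γ a)‖ → f (γ a) ∉ Sh → ∀ b ∈ I, r < 1 - ‖f (γ b)‖ →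
      ∃ s ∈ I, f (γ s) ∈ unitBall (m+1) ∧ PP x0 R (f (γ s)) = r := by
    intro γ hγ I hI hIV a ha ha1 ha2 b hb hb1
    have hsub := hI.uIcc_subset ha hb
    have hct : ContinuousOn (fun s => PP x0 R (f (γ s))) (uIcc a b) :=
      (PP_cont x0 R).comp_continuousOn (hh.continuousOn_inv.comp hγ.continuousOn
        fun s hs => hIV s (hsub hs))
    obtain ⟨s, hs, hs1⟩ := ivt_cross hct (hN1 _ (hh.mapsTo_inv (hIV a ha)) ha1 ha2).le
      (hdeep _ (hh.mapsTo_inv (hIV b hb)) hb1)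
    exact ⟨s, hsub hs, hh.mapsTo_inv (hIV s (hsub hs)), hs1⟩
  set γ1 : ℝ → Euc (m+1) := fun s => consE (-s) 0 with hγ1
  set γ2 : ℝ → Euc (m+1) := fun s => consE 0 (s • ζ) with hγ2
  have hc1 : Continuous γ1 := consE_cont.comp (by fun_prop : Continuous fun s : ℝ => ((-s, 0) : ℝ × Euc m))
  have hc2 : Continuous γ2 := consE_cont.comp (by fun_prop : Continuous fun s : ℝ => ((0, s • ζ) : ℝ × Euc m))
  have hgammaV : ∀ s, 0 < s → s < 1 → γ1 s ∈ V := by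
    intro s h0 h1
    refine ⟨?_, ?_⟩
    · rw [ball_iff, hγ1, consE_zero, rho_consE, norm_zero]; nlinarith
    · rintro ⟨h5, -⟩
      have : 0 ≤ -s := h5
      linarith
  have hgammaW : ∀ s, 0 < s → s < 1 → γ2 s ∈ V := by
    intro s h0 h1
    refine ⟨?_, ?_⟩
    · rw [ball_iff, hγ2, consE_zero, rho_consE, hnu s h0.le]; nlinarith
    · rintro ⟨-, h5⟩
      have h6 : rho (consE 0 (s • ζ)) ≤ cuspFun α 0 := h5
      rw [rho_consE, hnu s h0.le, cuspFun_zero] at h6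
      linarith
  have hN_1 : ∀ s, 0 < s → NN (γ1 s) = s := by
    intro s hs
    rw [NN, hγ1, consE_zero, rho_consE, norm_zero, abs_neg, abs_of_pos hs, max_eq_left hs.le]
  have hN_2 : ∀ s, 0 < s → NN (γ2 s) = s := by
    intro s hs
    rw [NN, hγ2, consE_zero, rho_consE, hnu s hs.le, abs_zero, max_eq_right hs.le]
  have h0V : (0 : Euc (m+1)) ∉ V := by
    intro h0
    refine h0.2 ⟨le_rfl, ?_⟩
    change rho (0 : Euc (m+1)) ≤ cuspFun α 0
    have := rho_le_norm (0 : Euc (m+1))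
    rw [norm_zero] at this
    rw [cuspFun_zero]; exact this
  have hconsz : consE (0:ℝ) (0 : Euc m) = 0 := by
    rw [← norm_eq_zero, ← sq_eq_zero_iff, consE_norm_sq, norm_zero]; norm_num
  rcases hdich with hgt | hlt
  · -- shell lies outside
    have start : ∀ γ : ℝ → Euc (m+1), Continuous γ → γ 0 = 0 → (∀ s, 0 < s → s < 1 → γ s ∈ V) →
        (∀ s, 0 < s → NN (γ s) = s) → ∃ a ∈ Ioc (0:ℝ) (1/2), 1 - ε < ‖f (γ a)‖ ∧ f (γ a) ∉ Sh := by
      intro γ hγ h0 hγV hγN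
      have hev := (hγ.tendsto 0).eventually (by rw [h0]; exact proper hh h0V hε)
      have hev3 := (hev.filter_mono (nhdsWithin_le_nhds (s := Ioi 0))).and (Ioo_mem_nhdsGT ht)
      obtain ⟨a, ha, ha2⟩ := hev3.exists
      have haV := hγV a ha2.1 (by linarith [ha2.2])
      refine ⟨a, ⟨ha2.1, by linarith [ha2.2]⟩, ha haV, fun hcon => ?_⟩
      have := hgt _ hcon
      rw [hh.right_inv _ haV, hγN a ha2.1] at this
      linarith [ha2.2]
    obtain ⟨a1, ha1, h11, h12⟩ := start γ1 hc1 (by simp only [hγ1, neg_zero]; exact hconsz) hgammaV hN_1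
    obtain ⟨a2, ha2, h21, h22⟩ := start γ2 hc2 (by simp only [hγ2, zero_smul]; exact hconsz) hgammaW hN_2
    obtain ⟨s1, hs1, hB1, hP1⟩ := curve γ1 hc1 (Ioc 0 (1/2)) ordConnected_Ioc
      (fun s hs => hgammaV s hs.1 (by linarith [hs.2])) a1 ha1 h11 h12 (1/2) (by constructor <;> norm_num) hd1
    obtain ⟨s2, hs2, hB2, hP2⟩ := curve γ2 hc2 (Ioc 0 (1/2)) ordConnected_Ioc
      (fun s hs => hgammaW s hs.1 (by linarith [hs.2])) a2 ha2 h21 h22 (1/2) (by constructor <;> norm_num) hd2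
    have e1 := hh.right_inv _ (hgammaV s1 hs1.1 (by linarith [hs1.2]))
    have e2 := hh.right_inv _ (hgammaW s2 hs2.1 (by linarith [hs2.2]))
    rcases le_or_gt (t/2) s1 with hle | hlt
    · refine ⟨_, hB1, _, hB2, hP1, hP2, ?_⟩
      rw [e1, e2]
      have := coord_lip (γ1 s1) (γ2 s2)
      simp only [hγ1, hγ2, consE_zero, sub_zero, abs_neg] at this
      rw [abs_of_pos hs1.1] at this
      simp only [hγ1, hγ2]
      linarith
    · refine ⟨_, hz3B, _, hB1, hP3, hP1, ?_⟩
      rw [e1]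
      have h1 := NN_lip (h z3) (γ1 s1)
      rw [hN_1 s1 hs1.1] at h1
      linarith [hgt z3 hz3]
  · -- shell lies inside
    have hgammaE : γ1 1 ∉ V := by
      intro hcon
      have h1 := hcon.1
      rw [ball_iff, hγ1, consE_zero, rho_consE, norm_zero] at h1
      norm_num at h1
    have hev := (hc1.tendsto 1).eventually (proper hh hgammaE hε)
    have hev3 := (hev.filter_mono (nhdsWithin_le_nhds (s := Iio 1))).and
      (Ioo_mem_nhdsLT (by norm_num : (1/2:ℝ) < 1))
    obtain ⟨a, ha, ha2⟩ := hev3.exists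
    have haV := hgammaV a (by linarith [ha2.1]) ha2.2
    have haS : f (γ1 a) ∉ Sh := by
      intro hcon
      have := hlt _ hcon
      rw [hh.right_inv _ haV, hN_1 a (by linarith [ha2.1])] at this
      linarith [ha2.1]
    obtain ⟨s1, hs1, hB1, hP1⟩ := curve γ1 hc1 (Ico (1/2) 1) ordConnected_Ico
      (fun s hs => hgammaV s (by linarith [hs.1]) hs.2) a ⟨ha2.1.le, ha2.2⟩ (ha haV) haS (1/2)
      (by constructor <;> norm_num) hd1
    have e1 := hh.right_inv _ (hgammaV s1 (by linarith [hs1.1]) hs1.2)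
    refine ⟨_, hB1, _, hz3B, hP1, hP3, ?_⟩
    rw [e1]
    have h1 := NN_lip (γ1 s1) (h z3)
    rw [hN_1 s1 (by linarith [hs1.1])] at h1
    linarith [hlt z3 hz3, hs1.1]


lemma MemSobolev.restrict {n : ℕ} {p : ℝ} {Ω U : Set (Euc n)} {g : Euc n → Euc n}
    {Dg : Euc n → Matrix (Fin n) (Fin n) ℝ} (h : MemSobolev p Ω g Dg) (hU : U ⊆ Ω) (hΩ : MeasurableSet Ω) :
    MemSobolev p U g Dg where
  locInt i := (h.locInt i).mono_set hU
  locIntD i j := (h.locIntD i j).mono_set hU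
  parts φ h1 h2 h3 i j := by
    have := h.parts φ h1 h2 (h3.trans hU) i j
    rw [setIntegral_eq_of_subset_of_forall_diff_eq_zero hΩ hU, setIntegral_eq_of_subset_of_forall_diff_eq_zero hΩ hU] at this
    · exact this
    · intro x hx
      rw [image_eq_zero_of_notMem_tsupport (fun hc => hx.2 (h3 hc)), mul_zero]
    · intro x hx
      have hx' : x ∉ tsupport φ := fun hc => hx.2 (h3 hc)
      have : fderiv ℝ φ x = 0 := by
        by_contra hne
        exact hx' (support_fderiv_subset ℝ hne)
      rw [this]; simp
  lp := h.lp.mono_set hU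

theorem use2 {m : ℕ} (hm : 1 ≤ m) {h : Euc (m+1) → Euc (m+1)}
    {Dh : Euc (m+1) → Matrix (Fin (m+1)) (Fin (m+1)) ℝ} (hc : ContinuousOn h (unitBall (m+1)))
    (hM : ∀ x ∈ unitBall (m+1), ‖h x‖ ≤ 1) (hS : MemSobolev ((m+1 : ℕ):ℝ) (unitBall (m+1)) h Dh)
    {x0 : Euc (m+1)} (hx : ‖x0‖ = 1) {R : Euc (m+1) ≃ₗᵢ[ℝ] Euc (m+1)} (hR : R (e0 (m+1)) = -x0) (η : ℝ) :
    ∃ A : ℝ → ℝ≥0∞, Measurable A ∧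
      ∫⁻ r, A r ≤ ∫⁻ x in unitBall (m+1) ∩ ball x0 η, ENNReal.ofReal (opNorm (Dh x) ^ (m+1)) ∧
      ∀ r, 0 < r → r < 1 → r < η → ∀ z ∈ unitBall (m+1), ∀ z' ∈ unitBall (m+1), PP x0 R z = r →
        PP x0 R z' = r → ENNReal.ofReal ‖h z - h z'‖ ^ (m+1) ≤ sliceC m * ENNReal.ofReal r * A r := by
  have hsub : unitBall (m+1) ∩ ball x0 η ⊆ unitBall (m+1) := inter_subset_left
  have hBo : IsOpen (unitBall (m+1)) := isOpen_ball
  obtain ⟨A, hAm, hAi, hA⟩ := slice hm (unitBall (m+1) ∩ ball x0 η) (hBo.inter isOpen_ball) h Dh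
    (hc.mono hsub) 1 (fun x hx => hM x (hsub hx)) (hS.restrict hsub hBo.measurableSet)
    (PsiM x0 R 1) (PsiM_lip _ _ 1 zero_le_one le_rfl) (PsiM_mp _ _ 1)
  refine ⟨A, hAm, hAi, fun r hr0 hr1 hrη z hz z' hz' hP hP' => ?_⟩
  set y := tailE (R.symm (z - x0)) with hy
  set y' := tailE (R.symm (z' - x0)) with hy'
  have ez : PsiM x0 R 1 r y = z := by rw [← hP]; exact PsiM_PP x0 R z
  have ez' : PsiM x0 R 1 r y' = z' := by rw [← hP']; exact PsiM_PP x0 R z'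
  have hyr : ‖y‖ ≤ r := by rw [← hP]; exact (PP_facts hx hR hz).1
  have hyr' : ‖y'‖ ≤ r := by rw [← hP']; exact (PP_facts hx hR hz').1
  have hzn : ‖z‖ < 1 := by simpa [unitBall] using hz
  have hzn' : ‖z'‖ < 1 := by simpa [unitBall] using hz'
  have key : ∀ y1 : Euc m, ‖PsiM x0 R 1 r y1‖ < 1 → ∀ w : Euc m, ‖w‖ ≤ ‖y1‖ →
      PsiM x0 R 1 r w ∈ unitBall (m+1) ∩ ball x0 η := by
    intro y1 h1 w hw
    have hb : PsiM x0 R 1 r w ∈ unitBall (m+1) := by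
      rw [unitBall, mem_ball_zero_iff]
      have h2 := norm_PsiM hx hR r w
      have h3 := norm_PsiM hx hR r y1
      have h4 : ‖PsiM x0 R 1 r w‖ ^ 2 ≤ ‖PsiM x0 R 1 r y1‖ ^ 2 := by
        rw [h2, h3]
        have := norm_nonneg w
        have : 0 ≤ 1 - r + ‖w‖ := by linarith
        gcongr
      exact (le_of_sq_le_sq h4 (norm_nonneg _)).trans_lt h1
    refine ⟨hb, ?_⟩
    rw [mem_ball, dist_eq_norm]
    have := (PP_facts hx hR hb).2.1
    rw [PP_PsiM] at this
    linarith
  rcases (norm_nonneg y).eq_or_lt with h0 | h0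
  · rcases (norm_nonneg y').eq_or_lt with h0' | h0'
    · have : z = z' := by
        rw [← ez, ← ez', norm_eq_zero.1 h0.symm, norm_eq_zero.1 h0'.symm]
      rw [this]; simp
    · have := hA r 0 ‖y'‖ h0' (fun w hw => key y' (by rw [ez']; exact hzn') w (by simpa using hw))
        y (by rw [mem_closedBall_zero_iff]; linarith) y' (by simp)
      rw [ez, ez'] at this
      exact this.trans (by gcongr)
  · have := hA r 0 (max ‖y‖ ‖y'‖) (lt_max_of_lt_left h0) (fun w hw => by
        have hw : ‖w‖ ≤ max ‖y‖ ‖y'‖ := by simpa using hw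
        rcases le_max_iff.1 hw with hw | hw
        · exact key y (by rw [ez]; exact hzn) w hw
        · exact key y' (by rw [ez']; exact hzn') w hw)
        y (by simp) y' (by simp)
    rw [ez, ez'] at this
    refine this.trans ?_
    gcongr
    exact max_le hyr hyr'

theorem use2b {m : ℕ} (hm : 1 ≤ m) {h : Euc (m+1) → Euc (m+1)}
    {Dh : Euc (m+1) → Matrix (Fin (m+1)) (Fin (m+1)) ℝ} (hc : ContinuousOn h (unitBall (m+1)))
    (hM : ∀ x ∈ unitBall (m+1), ‖h x‖ ≤ 1) (hS : MemSobolev ((m+1 : ℕ):ℝ) (unitBall (m+1)) h Dh)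
    {x0 : Euc (m+1)} (hx : ‖x0‖ = 1) {R : Euc (m+1) ≃ₗᵢ[ℝ] Euc (m+1)} (hR : R (e0 (m+1)) = -x0) (η : ℝ)
    {a b τ : ℝ} (ha : 0 < a) (hab : a ≤ b) (hb : b ≤ 1) (hbη : b ≤ η) (hτ : 0 ≤ τ)
    (H : ∀ r ∈ Ioo a b, ∃ z ∈ unitBall (m+1), ∃ z' ∈ unitBall (m+1), PP x0 R z = r ∧ PP x0 R z' = r ∧
      τ ≤ ‖h z - h z'‖) :
    ENNReal.ofReal (τ ^ (m+1) * Real.log (b / a)) ≤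
      sliceC m * ∫⁻ x in unitBall (m+1) ∩ ball x0 η, ENNReal.ofReal (opNorm (Dh x) ^ (m+1)) := by
  obtain ⟨A, hAm, hAi, hA⟩ := use2 hm hc hM hS hx hR η
  have hpt : ∀ r ∈ Ioo a b, ENNReal.ofReal (τ ^ (m+1) * r⁻¹) ≤ sliceC m * A r := by
    intro r hr
    have hr0 : 0 < r := ha.trans hr.1
    obtain ⟨z, hz, z', hz', hP, hP', hd⟩ := H r hr
    have h1 := hA r hr0 (hr.2.trans_le hb) (hr.2.trans_le hbη) z hz z' hz' hP hP'
    have h2 : ENNReal.ofReal (τ ^ (m+1)) ≤ sliceC m * ENNReal.ofReal r * A r := by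
      rw [ENNReal.ofReal_pow hτ]
      refine le_trans ?_ h1
      gcongr
    calc ENNReal.ofReal (τ ^ (m+1) * r⁻¹) = ENNReal.ofReal (τ^(m+1)) * ENNReal.ofReal r⁻¹ :=
          ENNReal.ofReal_mul (by positivity)
      _ ≤ (sliceC m * ENNReal.ofReal r * A r) * ENNReal.ofReal r⁻¹ := by gcongr
      _ = (sliceC m * A r) * (ENNReal.ofReal r * ENNReal.ofReal r⁻¹) := by ring
      _ = _ := by
          rw [← ENNReal.ofReal_mul hr0.le, mul_inv_cancel₀ hr0.ne', ENNReal.ofReal_one, mul_one]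
  have hintg : IntegrableOn (fun r : ℝ => τ ^ (m+1) * r⁻¹) (Ioo a b) := by
    have : ContinuousOn (fun r : ℝ => τ ^ (m+1) * r⁻¹) (Icc a b) :=
      ContinuousOn.mul continuousOn_const (continuousOn_inv₀.mono fun r hr => (ha.trans_le hr.1).ne')
    exact (this.integrableOn_Icc).mono_set Ioo_subset_Icc_self
  have hval : ∫ r in Ioo a b, τ ^ (m+1) * r⁻¹ = τ ^ (m+1) * Real.log (b / a) := by
    rw [← integral_Ioc_eq_integral_Ioo, ← intervalIntegral.integral_of_le hab,
      intervalIntegral.integral_const_mul, integral_inv_of_pos ha (ha.trans_le hab)]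
  rw [← hval, ofReal_integral_eq_lintegral_ofReal hintg]
  · calc _ ≤ ∫⁻ r in Ioo a b, sliceC m * A r := setLIntegral_mono (by fun_prop) hpt
      _ ≤ ∫⁻ r, sliceC m * A r := setLIntegral_le_lintegral _ _
      _ = sliceC m * ∫⁻ r, A r := lintegral_const_mul _ hAm
      _ ≤ _ := by gcongr
  · filter_upwards [ae_restrict_mem measurableSet_Ioo] with r hr
    have : 0 < r := ha.trans hr.1
    simp only [Pi.zero_apply]
    positivity

theorem small_energy {n : ℕ} (hn : 0 < n) {B : Set (Euc n)} (hB : MeasurableSet B) {F : Euc n → ℝ≥0∞} (hF : ∫⁻ x in B, F x ≠ ⊤) {e : ℝ}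
    (he : 0 < e) : ∃ η : ℝ, 0 < η ∧ ∀ x0 : Euc n, ∫⁻ x in B ∩ ball x0 η, F x ≤ ENNReal.ofReal e := by
  obtain ⟨d, hd, hd2⟩ := exists_pos_setLIntegral_lt_of_measure_lt hF (ε := ENNReal.ofReal e) (by simpa using he)
  have hlim : Tendsto (fun η : ℝ => volume (ball (0 : Euc n) η)) (𝓝[>] 0) (𝓝 0) := by
    have : ∀ᶠ η : ℝ in 𝓝[>] 0, ENNReal.ofReal (η ^ n) * volume (ball (0 : Euc n) 1) = volume (ball (0 : Euc n) η) := by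
      filter_upwards [self_mem_nhdsWithin] with η hη
      rw [Measure.addHaar_ball_of_pos _ _ hη, finrank_euclideanSpace_fin]
    refine Tendsto.congr' this ?_
    have h1 : Tendsto (fun η : ℝ => ENNReal.ofReal (η ^ n)) (𝓝[>] 0) (𝓝 0) := by
      have h2 : Tendsto (fun η : ℝ => ENNReal.ofReal (η ^ n)) (𝓝 0) (𝓝 (ENNReal.ofReal (0 ^ n))) :=
        ((ENNReal.continuous_ofReal.comp (continuous_pow n)).tendsto 0)
      rw [zero_pow hn.ne', ENNReal.ofReal_zero] at h2
      exact h2.mono_left nhdsWithin_le_nhds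
    have h3 := ENNReal.Tendsto.mul_const (b := volume (ball (0 : Euc n) 1)) h1 (Or.inr measure_ball_lt_top.ne)
    rwa [zero_mul] at h3
  have hev := (hlim.eventually_lt_const hd).and (self_mem_nhdsWithin (s := Ioi (0:ℝ)))
  obtain ⟨η, hη, hη0⟩ := hev.exists
  refine ⟨η, hη0, fun x0 => ?_⟩
  have := hd2 (ball x0 η) ((Measure.restrict_apply_le _ _).trans_lt (by rwa [Measure.addHaar_ball_center]))
  rw [Measure.restrict_restrict measurableSet_ball, inter_comm] at this
  exact this.le


theorem choose_t2 {α : ℝ} (hα : 0 < α) {y0 X0 : ℝ} (hy : 0 < y0) :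
    ∃ t : ℝ, 0 < t ∧ t ≤ 1/4 ∧ X0 ≤ t ^ (-α) ∧ Real.exp (-(t ^ (-α)) / 2) / t ≤ y0 := by
  have hX := tendsto_rpow_neg_nhdsGT_zero (y := -α) (by linarith)
  have hY := (tendsto_rpow_mul_exp_neg_mul_atTop_nhds_zero (1/α) (1/2) (by norm_num)).comp hX
  have hev := ((hX.eventually_ge_atTop X0).and (hY.eventually_le_const hy)).and
    (Ioo_mem_nhdsGT (by norm_num : (0:ℝ) < 1/4))
  obtain ⟨t, ⟨h1, h2⟩, h3⟩ := hev.exists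
  refine ⟨t, h3.1, h3.2.le, h1, le_of_eq_of_le ?_ h2⟩
  have h4 : (t ^ (-α)) ^ (1/α) = t⁻¹ := by
    rw [← Real.rpow_mul h3.1.le, ← Real.rpow_neg_one]
    congr 1
    field_simp
  simp only [Function.comp_apply]
  rw [h4, div_eq_inv_mul]
  congr 2
  ring

set_option maxHeartbeats 1000000 in
theorem fwd {m : ℕ} (hm : 2 ≤ m) {α : ℝ} (hα : 0 < α) {h f : Euc (m+1) → Euc (m+1)}
    {Dh Df : Euc (m+1) → Matrix (Fin (m+1)) (Fin (m+1)) ℝ}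
    (hh : IsHomeoOn h f (unitBall (m+1)) (cuspBall (m+1) (cuspFun α)))
    (hSh : MemSobolev ((m+1 : ℕ):ℝ) (unitBall (m+1)) h Dh)
    (hSf : MemSobolev ((m+1 : ℕ):ℝ) (cuspBall (m+1) (cuspFun α)) f Df) : α < ((m+1 : ℕ):ℝ) := by
  by_contra hcon
  rw [not_lt] at hcon
  obtain ⟨K, hK, hK1⟩ := use1 hm α hα f Df hh.continuousOn_inv hh.mapsTo_inv hSf
  obtain ⟨ζ, hζ, -⟩ := exists_orth hm 0
  set n : ℝ := ((m+1 : ℕ):ℝ) with hn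
  have hn0 : 0 < n := by rw [hn]; positivity
  set S := (sliceC m).toReal with hSdef
  have hS0 : 0 ≤ S := ENNReal.toReal_nonneg
  set κ : ℝ := 1 / (4 ^ (m+1) * (16 * n)) with hκ
  have hκ0 : 0 < κ := by positivity
  set e := κ / (2 * (S + 1)) with he
  have he0 : 0 < e := by positivity
  have hlp := hSh.lp
  simp only [hn, Real.rpow_natCast] at hlp
  obtain ⟨η, hη0, hη⟩ := small_energy (Nat.succ_pos m) (B := unitBall (m+1)) measurableSet_ball
    (F := fun x => ENNReal.ofReal (opNorm (Dh x) ^ (m+1))) hlp.lintegral_lt_top.ne he0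
  have hV1 : consE (-(1/2)) 0 ∈ cuspBall (m+1) (cuspFun α) := by
    refine ⟨?_, ?_⟩
    · rw [ball_iff, consE_zero, rho_consE, norm_zero]; norm_num
    · rintro ⟨h5, -⟩
      have : (0:ℝ) ≤ -(1/2) := h5
      linarith
  have hV2 : consE 0 ((1/2 : ℝ) • ζ) ∈ cuspBall (m+1) (cuspFun α) := by
    have hnu : ‖(1/2 : ℝ) • ζ‖ = 1/2 := by rw [norm_smul, hζ]; norm_num
    refine ⟨?_, ?_⟩
    · rw [ball_iff, consE_zero, rho_consE, hnu]; norm_num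
    · rintro ⟨-, h5⟩
      have h6 : rho (consE 0 ((1/2:ℝ) • ζ)) ≤ cuspFun α 0 := h5
      rw [rho_consE, hnu, cuspFun_zero] at h6
      linarith
  have hb1 : ‖f (consE (-(1/2)) 0)‖ < 1 := by simpa [unitBall] using hh.mapsTo_inv hV1
  have hb2 : ‖f (consE 0 ((1/2 : ℝ) • ζ))‖ < 1 := by
    have := hh.mapsTo_inv hV2
    rwa [unitBall, mem_ball_zero_iff] at this
  set d := min η (min (1 - ‖f (consE (-(1/2)) 0)‖) (1 - ‖f (consE 0 ((1/2 : ℝ) • ζ))‖)) with hd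
  have hd0 : 0 < d := lt_min hη0 (lt_min (by linarith) (by linarith))
  have hdη : d ≤ η := min_le_left _ _
  have hdd1 : d ≤ 1 - ‖f (consE (-(1/2)) 0)‖ := (min_le_right _ _).trans (min_le_left _ _)
  have hdd2 : d ≤ 1 - ‖f (consE 0 ((1/2 : ℝ) • ζ))‖ := (min_le_right _ _).trans (min_le_right _ _)
  have he1 := Real.exp_pos 1
  set y0 : ℝ := min (1 / (8 * Real.exp 1)) (1 / (K * Real.exp 1 * 2 ^ (m+1))) with hy0
  have hy00 : 0 < y0 := lt_min (by positivity) (by positivity)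
  obtain ⟨t2, ht20, ht24, hX, hY⟩ := choose_t2 hα (y0 := y0)
    (X0 := max (16 * n * Real.log 4) (max (8 * n * (-Real.log d)) 0)) hy00
  set X := t2 ^ (-α) with hXdef
  have hX1 : 16 * n * Real.log 4 ≤ X := (le_max_left _ _).trans hX
  have hX2 : 8 * n * (-Real.log d) ≤ X := ((le_max_left _ _).trans (le_max_right _ _)).trans hX
  have hX0 : 0 ≤ X := ((le_max_right _ _).trans (le_max_right _ _)).trans hX
  have hXpos : 0 < X := Real.rpow_pos_of_pos ht20 _
  set Y := Real.exp (-X / 2) / t2 with hYdef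
  have hY0 : 0 < Y := by positivity
  have hu : cuspFun α t2 / t2 = Real.exp 1 * Real.exp (-X/2) * Y := by
    rw [cuspFun_pos_eq ht20, hYdef, sub_eq_add_neg, Real.exp_add,
      show -t2 ^ (-α) = -X/2 + -X/2 by rw [← hXdef]; ring, Real.exp_add]
    ring
  have hE1 : Real.exp (-X/2) ≤ 1 := Real.exp_le_one_iff.2 (by linarith)
  have hu8 : 8 * cuspFun α t2 ≤ t2 := by
    have h1 : Y ≤ 1 / (8 * Real.exp 1) := hY.trans (min_le_left _ _)
    rw [le_div_iff₀ (by positivity)] at h1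
    have h2 : cuspFun α t2 / t2 ≤ 1 / 8 := by
      rw [hu]
      nlinarith [mul_le_mul_of_nonneg_left hE1 (by positivity : 0 ≤ Real.exp 1 * Y)]
    rw [div_le_iff₀ ht20] at h2
    linarith
  obtain ⟨t, ht, hdiam⟩ := hK1 t2 ht20 (by linarith) (by linarith)
  have ht0 : 0 < t := by linarith [ht.1]
  set δ := Real.exp (-(X / (2 * n))) with hδ
  have hδ0 : 0 < δ := Real.exp_pos _
  have hδ1 : δ < 1 := Real.exp_lt_one_iff.2 (by simp only [Left.neg_neg_iff]; positivity)
  have hδn : (δ / 2) ^ (m+1) = Real.exp (-X/2) / 2 ^ (m+1) := by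
    rw [div_pow, hδ, ← Real.exp_nat_mul, ← hn]
    congr 2
    field_simp
  have hdiam2 : ∀ p ∈ cuspBall (m+1) (cuspFun α), ∀ q ∈ cuspBall (m+1) (cuspFun α),
      p 0 = t → q 0 = t → rho p < 4 * cuspFun α t2 → rho q < 4 * cuspFun α t2 → ‖f p - f q‖ ≤ δ / 2 := by
    intro p hp q hq h1 h2 h3 h4
    have h5 := hdiam p hp q hq h1 h2 h3 h4
    refine le_of_pow_le_pow_left₀ (Nat.succ_ne_zero m) (by positivity) (h5.trans ?_)
    rw [hδn, mul_div_assoc, hu]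
    have h6 : Y ≤ 1 / (K * Real.exp 1 * 2 ^ (m+1)) := hY.trans (min_le_right _ _)
    calc K * (Real.exp 1 * Real.exp (-X/2) * Y) ≤
          K * (Real.exp 1 * Real.exp (-X/2) * (1 / (K * Real.exp 1 * 2 ^ (m+1)))) := by gcongr
      _ = _ := by field_simp
  have hut : cuspFun α t < cuspFun α t2 := cuspFun_lt hα ht0.le ht.2
  have hut0 : 0 < cuspFun α t := cuspFun_pos ht0
  obtain ⟨x0, hx0, hA⟩ := exists_x0 hh ζ hζ (c := 4 * cuspFun α t2) (d0 := δ / 2) ht0 (by linarith [ht.2])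
    (by linarith) (by linarith) (by positivity) (by linarith) hdiam2
  obtain ⟨R, hR⟩ := exists_R x0 hx0
  set a := 4 * √δ with ha
  set b := Real.exp (-(X / (8 * n))) with hb
  have hsq : √δ = Real.exp (-(X / (4 * n))) := by
    rw [hδ, Real.sqrt_eq_iff_mul_self_eq (Real.exp_pos _).le (Real.exp_pos _).le, ← Real.exp_add]
    congr 1
    field_simp
    norm_num
  have ha0 : 0 < a := by rw [ha, hsq]; positivity
  have hlog4 : 0 < Real.log 4 := Real.log_pos (by norm_num)
  have hXn : 2 * Real.log 4 ≤ X / (8 * n) := by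
    rw [le_div_iff₀ (by positivity)]; linarith
  have hba : Real.log (b / a) = X / (8 * n) - Real.log 4 := by
    rw [Real.log_div (Real.exp_pos _).ne' ha0.ne', ha, Real.log_mul (by norm_num) (by rw [hsq]; positivity),
      hsq, Real.log_exp, Real.log_exp]
    field_simp
    ring
  have hab : a ≤ b := by
    have : 0 ≤ Real.log (b / a) := by rw [hba]; linarith
    have h1 := Real.exp_le_exp.2 this
    rw [Real.exp_zero, Real.exp_log (by positivity), le_div_iff₀ ha0] at h1
    linarith
  have hb1' : b ≤ 1 := Real.exp_le_one_iff.2 (by simp only [Left.neg_nonpos_iff]; positivity)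
  have hbd : b ≤ d := by
    rw [← Real.exp_log hd0, hb]
    apply Real.exp_le_exp.2
    have : -Real.log d ≤ X / (8 * n) := by
      rw [le_div_iff₀ (by positivity)]; linarith
    linarith
  have hM : ∀ x ∈ unitBall (m+1), ‖h x‖ ≤ 1 := by
    intro x hx
    have := (hh.mapsTo hx).1
    rw [mem_ball_zero_iff] at this
    exact this.le
  have hfin := use2b (by omega : 1 ≤ m) hh.continuousOn hM hSh hx0 hR η (a := a) (b := b) (τ := t / 2)
    ha0 hab hb1' (hbd.trans hdη) (by positivity) (fun r hr =>
      crossing hα hh ζ hζ hx0 hR hδ0 hδ1 ht0 (by linarith [ht.2]) (c := 4 * cuspFun α t2) (by linarith)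
        (by linarith [ht.1]) (fun p hp h1 h2 => by have := hA p hp h1 h2; linarith) hr.1
        (by linarith [hr.2]) (by linarith [hr.2]) (by linarith [hr.2]))
  have hfin2 : (t/2)^(m+1) * Real.log (b / a) ≤ S * e := by
    have h1 : ENNReal.ofReal ((t/2)^(m+1) * Real.log (b / a)) ≤ ENNReal.ofReal (S * e) := by
      refine hfin.trans ?_
      rw [ENNReal.ofReal_mul hS0, hSdef, ENNReal.ofReal_toReal (sliceC_ne_top m)]
      gcongr
      exact hη x0
    exact (ENNReal.ofReal_le_ofReal_iff (by positivity)).1 h1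
  have hone : 1 ≤ t2 ^ (m+1) * X := by
    rw [← Real.rpow_natCast, hXdef, ← Real.rpow_add ht20]
    exact Real.one_le_rpow_of_pos_of_le_one_of_nonpos ht20 (by linarith) (by linarith)
  have hlow : κ ≤ (t/2)^(m+1) * Real.log (b / a) := by
    have h1 : X / (16 * n) ≤ Real.log (b / a) := by
      rw [hba]
      have : X / (8 * n) = 2 * (X / (16 * n)) := by field_simp; norm_num
      linarith
    calc κ ≤ κ * (t2 ^ (m+1) * X) := le_mul_of_one_le_right hκ0.le hone
      _ = (t2 / 4) ^ (m+1) * (X / (16 * n)) := by rw [hκ, div_pow]; field_simp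
      _ ≤ _ := by
        have : t2 / 4 ≤ t / 2 := by linarith [ht.1]
        gcongr
  have : S * e < κ := by
    rw [he, mul_div_assoc', div_lt_iff₀ (by positivity)]
    nlinarith [mul_nonneg hκ0.le hS0]
  linarith

end Helpers

/-- For `n ≥ 3`, `α > 0` and `u(t) = e / exp(t^{−α})`, the cusp ball `𝔹_u`
and the unit ball `𝔹` are bi-conformally equivalent iff `α < n`. -/
theorem stmt_8 {n : ℕ} [NeZero n] (hn : 3 ≤ n) (α : ℝ) (hα : 0 < α) :
    (∃ (h f : Euc n → Euc n) (Dh Df : Euc n → Matrix (Fin n) (Fin n) ℝ),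
        IsHomeoOn h f (unitBall n) (cuspBall n (cuspFun α)) ∧
        MemSobolev (n : ℝ) (unitBall n) h Dh ∧
        MemSobolev (n : ℝ) (cuspBall n (cuspFun α)) f Df) ↔ α < n := by
  constructor
  · rintro ⟨h, f, Dh, Df, hh, hS, hSf⟩
    obtain ⟨m, rfl⟩ : ∃ m, n = m + 1 := ⟨n - 1, by omega⟩
    exact fwd (by omega) hα hh hS hSf
  · exact bwd α hα
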